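/- The variety O = Mod{x²y² ≈ y²x², xzxyxty ≈ xzyxty} is hereditarily finitely based: for every set Σ of identities there exists a finite set Σ′ of identities such that a monoid satisfies all identities of {x²y² ≈ y²x², xzxyxty ≈ xzyxty} ∪ Σ if and only if it satisfies all identities of Σ′. -/

import Mathlib

open FreeMonoid

/-- Words over the countably infinite alphabet `ℕ`. -/
abbrev Word : Type := FreeMonoid ℕ

/-- The word corresponding to a list of letters. -/
def wd (l : List ℕ) : Word := FreeMonoid.ofList l

/-- A monoid `M` satisfies the identity `e.1 ≈ e.2`. -/
def MSat (M : Type*) [Monoid M] (e : Word × Word) : Prop :=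
  ∀ φ : Word →* M, φ e.1 = φ e.2

/-- A monoid `M` satisfies every identity of `S`. -/
def SatAll (M : Type*) [Monoid M] (S : Set (Word × Word)) : Prop :=
  ∀ e ∈ S, MSat M e

/-- The varieties `Mod S` and `Mod T` coincide (they have exactly the same members). -/
def VarEq.{u} (S T : Set (Word × Word)) : Prop :=
  ∀ (M : Type u) [Monoid M], SatAll M S ↔ SatAll M T

/-- The variety `Mod S` is finitely based. -/
def FinitelyBased.{u} (S : Set (Word × Word)) : Prop :=
  ∃ T : Finset (Word × Word), VarEq.{u} S (↑T)

/-- `G` is a subgroup (a subsemigroup which is a group) of the monoid `M`. -/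
def IsSubgroupIn (M : Type*) [Monoid M] (G : Set M) : Prop :=
  (∀ a ∈ G, ∀ b ∈ G, a * b ∈ G) ∧
    ∃ e ∈ G, (∀ g ∈ G, e * g = g ∧ g * e = g) ∧ ∀ g ∈ G, ∃ h ∈ G, g * h = e ∧ h * g = e

/-- A monoid is aperiodic if all its subgroups have exactly one element. -/
def AperiodicMonoid (M : Type*) [Monoid M] : Prop :=
  ∀ G : Set M, IsSubgroupIn M G → ∀ a ∈ G, ∀ b ∈ G, a = b

/-- The idempotents of `M` commute. -/
def CommIdem (M : Type*) [Monoid M] : Prop :=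
  ∀ e f : M, e * e = e → f * f = f → e * f = f * e

/-- `w` is a factor (contiguous subword) of some word of `W`. -/
def IsFactorIn (W : Set (List ℕ)) (w : List ℕ) : Prop := ∃ s ∈ W, w <:+: s

theorem IsFactorIn.left {W : Set (List ℕ)} {u v : List ℕ} (h : IsFactorIn W (u ++ v)) :
    IsFactorIn W u := by
  obtain ⟨s, hs, hf⟩ := h
  exact ⟨s, hs, (List.prefix_append u v).isInfix.trans hf⟩

theorem IsFactorIn.right {W : Set (List ℕ)} {u v : List ℕ} (h : IsFactorIn W (u ++ v)) :
    IsFactorIn W v := by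
  obtain ⟨s, hs, hf⟩ := h
  exact ⟨s, hs, (List.suffix_append u v).isInfix.trans hf⟩

/-- The Rees congruence on the free monoid identifying all non-factors of words of `W`. -/
def reesCon (W : Set (List ℕ)) : Con Word where
  r u v := u = v ∨ (¬ IsFactorIn W (toList u) ∧ ¬ IsFactorIn W (toList v))
  iseqv := ⟨fun _ => Or.inl rfl, fun h => by tauto, fun h₁ h₂ => by
    rcases h₁ with rfl | h₁ <;> rcases h₂ with rfl | h₂ <;> tauto⟩
  mul' := by
    rintro w x y z (rfl | ⟨hw, hx⟩) (rfl | ⟨hy, hz⟩)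
    · exact Or.inl rfl
    · refine Or.inr ⟨fun h => hy ?_, fun h => hz ?_⟩
      · rw [toList_mul] at h; exact h.right
      · rw [toList_mul] at h; exact h.right
    · refine Or.inr ⟨fun h => hw ?_, fun h => hx ?_⟩
      · rw [toList_mul] at h; exact h.left
      · rw [toList_mul] at h; exact h.left
    · refine Or.inr ⟨fun h => hw ?_, fun h => hx ?_⟩
      · rw [toList_mul] at h; exact h.left
      · rw [toList_mul] at h; exact h.left

/-- The Rees quotient `S(W)` of the free monoid over the ideal of all words that
are not factors of any word in `W`. -/
abbrev SMon (W : Set (List ℕ)) : Type := (reesCon W).Quotient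

/-- The equational theory of the monoid `N`; `Mod (Th N)` is the variety generated by `N`. -/
def Th (N : Type*) [Monoid N] : Set (Word × Word) := {e | MSat N e}

/-- The reverse of a word. -/
def revW (w : Word) : Word := ofList (toList w).reverse

/-- The set of identities defining the dual variety. -/
def dualSet (S : Set (Word × Word)) : Set (Word × Word) :=
  (fun e : Word × Word => (revW e.1, revW e.2)) '' S

/-- letters: x = 0, y = 1, z = 2, t = 3. -/
def Oset : Set (Word × Word) :=
  {(wd [0,0,1,1], wd [1,1,0,0]), (wd [0,2,0,1,0,3,1], wd [0,2,1,0,3,1])}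

def Kset : Set (Word × Word) :=
  {(wd [0,1,0], wd [0,1,0,0]), (wd [0,0,1,1], wd [1,1,0,0]), (wd [0,0,1], wd [0,0,1,0])}

def Qset : Set (Word × Word) :=
  {(wd [0,1,0], wd [0,1,0,0]), (wd [0,0,1,1], wd [1,1,0,0]), (wd [0,1,0], wd [0,0,1,0])}

def Eset : Set (Word × Word) :=
  {(wd [0,0,1,1], wd [1,1,0,0]), (wd [0,0], wd [0,0,0]), (wd [1,0,0], wd [0,1,0])}

def F0set : Set (Word × Word) :=
  {(wd [0,1,0], wd [0,1,0,0]), (wd [0,0,1,1], wd [1,1,0,0]),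
   (wd [0,1,2,0,1], wd [1,0,2,0,1]), (wd [0,0,1], wd [0,0,1,0])}

/-- The identity `x z_{π(1)}⋯z_{π(n)} x (t₁z₁)⋯(tₙzₙ) ≈ x² z_{π(1)}⋯z_{π(n)} (t₁z₁)⋯(tₙzₙ)`,
with letters `x = 0`, `zᵢ = 2i+1`, `tᵢ = 2i+2`. -/
def Jscheme (n : ℕ) (π : Equiv.Perm (Fin n)) : Word × Word :=
  (of 0 * ((List.finRange n).map fun i => of (2 * (π i : ℕ) + 1)).prod * of 0 *
      ((List.finRange n).map fun i => of (2 * (i : ℕ) + 2) * of (2 * (i : ℕ) + 1)).prod,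
   of 0 * of 0 * ((List.finRange n).map fun i => of (2 * (π i : ℕ) + 1)).prod *
      ((List.finRange n).map fun i => of (2 * (i : ℕ) + 2) * of (2 * (i : ℕ) + 1)).prod)

/-- The defining identities of the variety `J`. -/
def Jset : Set (Word × Word) :=
  {(wd [0,1,0], wd [0,1,0,0]), (wd [0,0,1,1], wd [1,1,0,0]),
   (wd [0,1,2,0,1], wd [1,0,2,0,1]), (wd [0,1,0,2,3,0], wd [0,1,0,2,0,3,0])} ∪
  {e | ∃ n : ℕ, 1 ≤ n ∧ ∃ π : Equiv.Perm (Fin n), e = Jscheme n π}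

/-- The set of letters occurring in a word. -/
def conL (w : List ℕ) : Set ℕ := {a | a ∈ w}

/-- The set of simple letters of a word. -/
def simpleSet (w : List ℕ) : Set ℕ := {a | w.count a = 1}

/-- The set of multiple letters of a word. -/
def mulSet (w : List ℕ) : Set ℕ := {a | 2 ≤ w.count a}

/-- The position of the `i`-th occurrence (`i ≥ 1`) of the letter `a` in `w`. -/
def nthOccIdx (w : List ℕ) (a : ℕ) (i : ℕ) : ℕ :=
  ((List.range w.length).filter fun j => w.getD j (a + 1) == a).getD (i - 1) w.length

/-- `h_i(w,a)`: the right-most divider (simple letter) of `w` preceding the `i`-th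
occurrence of `a` in `w`; `none` encodes the empty divider `t₀`. -/
def hdiv (w : List ℕ) (a : ℕ) (i : ℕ) : Option ℕ :=
  ((w.take (nthOccIdx w a i)).filter fun b => w.count b == 1).getLast?

/-- `t(w,a)`: the right-most divider of `w` preceding the last occurrence of `a` in `w`. -/
def tdiv (w : List ℕ) (a : ℕ) : Option ℕ := hdiv w a (w.count a)

/-- The word `b₀ t₁ b₁ t₂ b₂ ⋯ tₘ bₘ` built from blocks and dividers. -/
def assemble (b0 : List ℕ) (ps : List (ℕ × List ℕ)) : List ℕ :=
  b0 ++ (ps.map fun p => p.1 :: p.2).flatten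

/-- `t₀ b₀ t₁ b₁ ⋯ tₘ bₘ` is the decomposition of `w`: the `tᵢ` are the dividers
(simple letters) of `w` and the blocks `bᵢ` consist of multiple letters. -/
def IsDecomp (w b0 : List ℕ) (ps : List (ℕ × List ℕ)) : Prop :=
  w = assemble b0 ps ∧ (∀ p ∈ ps, w.count p.1 = 1) ∧
    (∀ a ∈ b0, 2 ≤ w.count a) ∧ ∀ p ∈ ps, ∀ a ∈ p.2, 2 ≤ w.count a

/-- The identity `u ≈ v` is well-balanced: `u` and `v` have the same dividers in the
same order and corresponding blocks have the same number of occurrences of each letter. -/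
def WellBalanced (u v : List ℕ) : Prop :=
  ∃ b0 ps c0 qs, IsDecomp u b0 ps ∧ IsDecomp v c0 qs ∧
    ps.map Prod.fst = qs.map Prod.fst ∧
    List.Forall₂ (fun b c : List ℕ => ∀ a, b.count a = c.count a)
      (b0 :: ps.map Prod.snd) (c0 :: qs.map Prod.snd)

/-- `∏_{i=a}^{b} tᵢ eᵢ` where `tᵢ = i+1`, `eᵢ = x = 0` for odd `i` and `eᵢ = y = 1`
for even `i`. -/
def prodTE (a b : ℕ) : Word :=
  ((List.range' a (b + 1 - a)).map fun i =>
    of (i + 1) * of (if i % 2 = 1 then 0 else 1)).prod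

def alphaId (n : ℕ) : Word × Word :=
  (wd [0,1] * prodTE 1 (n+1), wd [1,0] * prodTE 1 (n+1))

def betaId (n : ℕ) : Word × Word :=
  (wd [1,0,0] * prodTE 2 (n+1), wd [0,1,0] * prodTE 1 n)

def gammaId (n : ℕ) : Word × Word :=
  (wd [0,0,1] * prodTE 1 (n+1), wd [0,1,0] * prodTE 1 (n+1))

def gammaId' (n : ℕ) : Word × Word :=
  (wd [0,0,1] * prodTE 2 (n+1), wd [0,1,0] * prodTE 2 (n+1))

/-- The family `Φ` of identities from Lemma 3.5 (letters `x = 0`, `y = 1`, `t = 2`). -/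
def PhiSet : Set (Word × Word) :=
  {(wd [0,1,2,0,1], wd [1,0,2,0,1]), (wd [1,0,0,2,0,1], wd [0,1,0,2,0,1]),
   (wd [0,0,1,2,0,1], wd [0,1,0,2,0,1])} ∪
  {e | ∃ n : ℕ, 1 ≤ n ∧ (e = alphaId n ∨ e = betaId n ∨ e = gammaId n ∨ e = gammaId' n)}
universe uM


/-- An equational theory on words. -/
structure Thy (E : List ℕ → List ℕ → Prop) : Prop where
  rf : ∀ a, E a a
  sy : ∀ {a b}, E a b → E b a
  tr : ∀ {a b c}, E a b → E b c → E a c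
  mul : ∀ {a b c d}, E a b → E c d → E (a ++ c) (b ++ d)
  sub : ∀ (σ : ℕ → List ℕ) {a b}, E a b → E (a.flatMap σ) (b.flatMap σ)

/-- An equational theory containing the identities of `O`. -/
structure OThy (E : List ℕ → List ℕ → Prop) : Prop extends Thy E where
  o1 : E [0,0,1,1] [1,1,0,0]
  o2 : E [0,2,0,1,0,3,1] [0,2,1,0,3,1]

section basic
variable {E : List ℕ → List ℕ → Prop}

theorem Thy.ctx (h : Thy E) (p q : List ℕ) {a b : List ℕ} (hab : E a b) :
    E (p ++ (a ++ q)) (p ++ (b ++ q)) := h.mul (h.rf p) (h.mul hab (h.rf q))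

theorem Thy.pre (h : Thy E) (p : List ℕ) {a b : List ℕ} (hab : E a b) :
    E (p ++ a) (p ++ b) := h.mul (h.rf p) hab

theorem OThy.O1 (h : OThy E) (x y : List ℕ) : E (x ++ x ++ y ++ y) (y ++ y ++ x ++ x) := by
  have := h.sub (fun n => if n = 0 then x else y) h.o1
  simpa using this

theorem OThy.O2 (h : OThy E) (x y z t : List ℕ) :
    E (x ++ z ++ x ++ y ++ x ++ t ++ y) (x ++ z ++ y ++ x ++ t ++ y) := by
  have := h.sub (fun n => if n = 0 then x else if n = 1 then y else if n = 2 then z else t) h.o2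
  simpa using this

theorem OThy.dup (h : OThy E) {x : ℕ} {p : List ℕ} (q : List ℕ) (hx : x ∈ p) :
    E (p ++ x :: q) (p ++ x :: x :: q) := by
  obtain ⟨p1, z, rfl⟩ := List.append_of_mem hx
  have := h.ctx p1 q (h.sy (h.O2 [x] [] z []))
  simpa using this

theorem OThy.swp (h : OThy E) {x y : ℕ} {p : List ℕ} (q : List ℕ) (hx : x ∈ p) (hy : y ∈ p) :
    E (p ++ x :: y :: q) (p ++ y :: x :: q) := by
  have key : ∀ {x y : ℕ}, x ∈ p → y ∈ p → E (p ++ x :: y :: q) (p ++ x :: x :: y :: y :: q) := by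
    intro x y hx hy
    refine h.tr (h.dup _ hx) ?_
    have := h.dup (x := y) (p := p ++ [x, x]) q (by simp [hy])
    simpa using this
  refine h.tr (key hx hy) (h.tr ?_ (h.sy (key hy hx)))
  simpa using h.ctx p q (h.O1 [x] [y])

theorem OThy.L3 (h : OThy E) {x y : ℕ} {p q : List ℕ} (hx : x ∈ p) (hy : y ∈ p ∨ y ∈ q) :
    E (p ++ y :: x :: q) (p ++ x :: y :: x :: q) := by
  rcases hy with hy | hy
  · refine h.tr (b := p ++ y :: x :: x :: q) ?_ (h.swp _ hy hx)
    have := h.dup (x := x) (p := p ++ [y]) q (by simp [hx])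
    simpa using this
  · obtain ⟨p1, z, rfl⟩ := List.append_of_mem hx
    obtain ⟨t, q2, rfl⟩ := List.append_of_mem hy
    have := h.ctx p1 q2 (h.sy (h.O2 [x] [y] z t))
    simpa using this

theorem OThy.L4 (h : OThy E) {x : ℕ} (q : List ℕ) : ∀ (w p : List ℕ), x ∈ p →
    (∀ b ∈ w, 2 ≤ (p ++ (w ++ x :: q)).count b) →
    E (p ++ (w ++ x :: q)) (p ++ x :: (w ++ x :: q)) := by
  intro w
  induction w with
  | nil => intro p hx _; exact h.dup _ hx
  | cons a w ih =>
    intro p hx hw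
    have h1 := ih (p ++ [a]) (by simp [hx]) (fun b hb => by
      have := hw b (by simp [hb]); simpa using this)
    have h2 : E (p ++ a :: x :: (w ++ x :: q)) (p ++ x :: a :: x :: (w ++ x :: q)) := by
      apply h.L3 hx
      have := hw a (by simp)
      by_contra hc
      push Not at hc
      have e1 : List.count a p = 0 := List.count_eq_zero.2 hc.1
      have e2 : List.count a (w ++ x :: q) = 0 := List.count_eq_zero.2 hc.2
      have : List.count a (p ++ (a :: w ++ x :: q)) = 1 := by
        rw [List.count_append, List.cons_append, List.count_cons, e1, e2]; simp
      omega
    have h3 := ih (p ++ [x, a]) (by simp) (fun b hb => by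
      have := hw b (by simp [hb])
      simp only [List.count_append, List.count_cons, List.cons_append] at this ⊢
      simp only [List.count_nil]
      omega)
    have h1' : E (p ++ (a :: w ++ x :: q)) (p ++ a :: x :: (w ++ x :: q)) := by simpa using h1
    have h3' : E (p ++ x :: (a :: w ++ x :: q)) (p ++ x :: a :: x :: (w ++ x :: q)) := by
      simpa using h3
    exact h.tr h1' (h.tr h2 (h.sy h3'))

theorem OThy.CP (h : OThy E) {p hh r : List ℕ} (hm : ∀ b ∈ hh, 2 ≤ (p ++ (hh ++ r)).count b) :
    ∀ ws : List ℕ, (∀ c ∈ ws, c ∈ p ∧ c ∈ hh) → E (p ++ (hh ++ r)) (p ++ (ws ++ (hh ++ r))) := by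
  intro ws
  induction ws with
  | nil => intro _; exact h.rf _
  | cons c ws ih =>
    intro hc
    refine h.tr (ih fun d hd => hc d (by simp [hd])) ?_
    obtain ⟨h1, h2⟩ := hc c (by simp)
    obtain ⟨s, t, rfl⟩ := List.append_of_mem h2
    have := h.L4 (x := c) (t ++ r) (ws ++ s) p h1 (fun b hb => by
      have hb' : b ∈ s ++ c :: t := by
        rcases List.mem_append.1 hb with hb | hb
        · exact (hc b (by simp [hb])).2
        · simp [hb]
      have := hm b hb'
      simp only [List.count_append, List.count_cons] at this ⊢
      omega)
    simpa using this

theorem OThy.COM (h : OThy E) {c : ℕ} (r : List ℕ) : ∀ (hh p : List ℕ), c ∈ p → (∀ b ∈ hh, b ∈ p) →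
    E (p ++ c :: (hh ++ r)) (p ++ (hh ++ c :: r)) := by
  intro hh
  induction hh with
  | nil => intro p _ _; exact h.rf _
  | cons a hh ih =>
    intro p hc hb
    have h1 := h.swp (hh ++ r) hc (hb a (by simp))
    have h2 := ih (p ++ [a]) (by simp [hc]) (fun b hb' => by simp [hb b (by simp [hb'])])
    exact h.tr (by simpa using h1) (by simpa using h2)

theorem OThy.COMW (h : OThy E) (r : List ℕ) : ∀ (hh h' p : List ℕ), (∀ b ∈ hh, b ∈ p) →
    (∀ b ∈ h', b ∈ p) → E (p ++ (hh ++ (h' ++ r))) (p ++ (h' ++ (hh ++ r))) := by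
  intro hh
  induction hh with
  | nil => intro h' p _ _; exact h.rf _
  | cons c hh ih =>
    intro h' p h1 h2
    have e1 := ih h' (p ++ [c]) (fun b hb => by simp [h1 b (by simp [hb])])
      (fun b hb => by simp [h2 b hb])
    have e2 := h.COM (c := c) (hh ++ r) h' p (h1 c (by simp)) h2
    exact h.tr (by simpa using e1) (by simpa using e2)

theorem count_ge_two_of {p hh r : List ℕ} {b : ℕ} (h1 : b ∈ p) (h2 : b ∈ hh) :
    2 ≤ (p ++ (hh ++ r)).count b := by
  have := List.count_pos_iff.2 h1
  have := List.count_pos_iff.2 h2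
  simp only [List.count_append]; omega

theorem OThy.NF (h : OThy E) {p hh h' : List ℕ} (r : List ℕ) (h1 : ∀ b ∈ hh, b ∈ p)
    (h2 : ∀ b, b ∈ hh ↔ b ∈ h') : E (p ++ (hh ++ r)) (p ++ (h' ++ r)) := by
  have h3 : ∀ b ∈ h', b ∈ p := fun b hb => h1 b ((h2 b).2 hb)
  have e1 := h.CP (p := p) (hh := hh) (r := r) (fun b hb => count_ge_two_of (h1 b hb) hb) h'
    (fun c hc => ⟨h3 c hc, (h2 c).2 hc⟩)
  have e2 := h.CP (p := p) (hh := h') (r := r) (fun b hb => count_ge_two_of (h3 b hb) hb) hh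
    (fun c hc => ⟨h1 c hc, (h2 c).1 hc⟩)
  exact h.tr e1 (h.tr (h.COMW r h' hh p h3 h1) (h.sy e2))

end basic


/-- The word `X?Y?` selected by a pair of booleans. -/
def wB (X Y : List ℕ) (B : Bool × Bool) : List ℕ :=
  (if B.1 then X else []) ++ (if B.2 then Y else [])

/-- Canonical word with the given block profile, dividers named `n, n+1, …`. -/
def encW : ℕ → List (Bool × Bool) → List ℕ
  | _, [] => []
  | n, B :: Bs => n :: (wB [0] [1] B ++ encW (n + 1) Bs)

inductive InstW (X Y : List ℕ) : List (Bool × Bool) → List ℕ → Prop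
  | nil (w) : InstW X Y [] w
  | cons (B τ d w) : InstW X Y τ w → InstW X Y (B :: τ) (d ++ (wB X Y B ++ w))

theorem InstW.ext {X Y : List ℕ} {τ w} (h : InstW X Y τ w) (d : List ℕ) :
    InstW X Y τ (d ++ w) := by
  cases h with
  | nil => exact .nil _
  | cons B τ d' w h =>
    rw [← List.append_assoc]; exact .cons _ _ _ _ h

theorem InstW.ofSublist {τ τ' : List (Bool × Bool)} (h : τ.Sublist τ') :
    ∀ n, InstW [0] [1] τ (encW n τ') := by
  induction h with
  | slnil => intro n; exact .nil _
  | cons B h ih =>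
    intro n
    have := (ih (n+1)).ext (n :: wB [0] [1] B)
    simpa [encW] using this
  | cons_cons B h ih =>
    intro n
    exact .cons B _ [n] _ (ih (n+1))

theorem mem_encW {n : ℕ} {τ : List (Bool × Bool)} {a : ℕ} (h : a ∈ encW n τ) : a < 2 ∨ n ≤ a := by
  induction τ generalizing n with
  | nil => simp [encW] at h
  | cons B τ ih =>
    simp only [encW, wB, List.mem_cons, List.mem_append] at h
    rcases h with h | h | h
    · omega
    · left; rcases h with h | h <;> split at h <;> simp_all
    · rcases ih h with h | h <;> omega

theorem InstW.exists_subst {X Y : List ℕ} {τ w} (h : InstW X Y τ w) :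
    ∀ n, 2 ≤ n → ∃ (f : ℕ → List ℕ) (tl : List ℕ), f 0 = X ∧ f 1 = Y ∧
      (encW n τ).flatMap f ++ tl = w := by
  induction h with
  | nil w => intro n _; exact ⟨fun n => if n = 0 then X else Y, w, by simp, by simp, by simp [encW]⟩
  | cons B τ d w h ih =>
    intro n hn
    obtain ⟨f, tl, h0, h1, h2⟩ := ih (n+1) (by omega)
    refine ⟨Function.update f n d, tl, ?_, ?_, ?_⟩
    · rw [Function.update_of_ne (by omega)]; exact h0
    · rw [Function.update_of_ne (by omega)]; exact h1
    · have e : (encW (n+1) τ).flatMap (Function.update f n d) = (encW (n+1) τ).flatMap f := by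
        apply List.flatMap_congr
        intro a ha
        rw [Function.update_of_ne]
        rcases mem_encW ha with h | h <;> omega
      have n0 : (0:ℕ) ≠ n := by omega
      have n1 : (1:ℕ) ≠ n := by omega
      rw [← h2, encW]
      simp only [List.flatMap_cons, List.flatMap_append, e, Function.update_self, wB]
      rcases B with ⟨_ | _, _ | _⟩ <;> simp [Function.update_of_ne n0, Function.update_of_ne n1, h0, h1]

/-- Substituting `X` for `0` and `Y` for `1`. -/
def sb2 (X Y L : List ℕ) : List ℕ := L.flatMap (fun n => if n = 0 then X else Y)

theorem InstW.apply {F : List ℕ → List ℕ → Prop} (hF : Thy F) {X Y : List ℕ} {τ w}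
    (h : InstW X Y τ w) {L R : List ℕ} (hL : ∀ a ∈ L, a < 2) (hR : ∀ a ∈ R, a < 2)
    (hh : F (L ++ encW 2 τ) (R ++ encW 2 τ)) : F (sb2 X Y L ++ w) (sb2 X Y R ++ w) := by
  obtain ⟨f, tl, h0, h1, h2⟩ := h.exists_subst 2 le_rfl
  have e : ∀ L : List ℕ, (∀ a ∈ L, a < 2) → L.flatMap f = sb2 X Y L := by
    intro L hL
    apply List.flatMap_congr
    intro a ha
    have : a = 0 ∨ a = 1 := by have := hL a ha; omega
    rcases this with rfl | rfl <;> simp [h0, h1]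
  have := hF.mul (hF.sub f hh) (hF.rf tl)
  rw [List.flatMap_append, List.flatMap_append, List.append_assoc, List.append_assoc, h2,
    e L hL, e R hR] at this
  exact this

theorem sublist_basis {α : Type} [Finite α] (A : Set (List α))
    : ∃ T : Finset (List α), (∀ t ∈ T, t ∈ A) ∧ ∀ a ∈ A, ∃ t ∈ T, t.Sublist a := by
  classical
  let m : Set (List α) := {a | a ∈ A ∧ ∀ b ∈ A, b.Sublist a → b = a}
  have hfin : m.Finite := by
    have hw : (Set.univ : Set α).PartiallyWellOrderedOn (Eq : α → α → Prop) :=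
      Set.finite_univ.partiallyWellOrderedOn
    have h2 := Set.PartiallyWellOrderedOn.partiallyWellOrderedOn_sublistForall₂ Eq hw
    refine IsAntichain.finite_of_partiallyWellOrderedOn (r := List.SublistForall₂ Eq) ?_
      (h2.mono (fun _ _ => by simp))
    intro a ha b hb hab hs
    rw [List.sublistForall₂_iff] at hs
    obtain ⟨l, hl, hl2⟩ := hs
    rw [List.forall₂_eq_eq_eq] at hl
    subst hl
    exact hab (hb.2 a ha.1 hl2)
  refine ⟨hfin.toFinset, fun t ht => ((hfin.mem_toFinset).1 ht).1, ?_⟩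
  have key : ∀ n, ∀ a ∈ A, a.length ≤ n → ∃ t ∈ hfin.toFinset, t.Sublist a := by
    intro n
    induction n with
    | zero =>
      intro a ha hl
      refine ⟨a, (hfin.mem_toFinset).2 ⟨ha, fun b hb hs => ?_⟩, List.Sublist.refl _⟩
      exact hs.eq_of_length_le (by omega)
    | succ n ih =>
      intro a ha hl
      by_cases hm : a ∈ m
      · exact ⟨a, (hfin.mem_toFinset).2 hm, List.Sublist.refl _⟩
      · have : ∃ b ∈ A, b.Sublist a ∧ b ≠ a := by
          by_contra hc
          push Not at hc
          exact hm ⟨ha, hc⟩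
        obtain ⟨b, hb, hs, hne⟩ := this
        have hlen : b.length < a.length := by
          by_contra hc
          exact hne (hs.eq_of_length_le (by omega))
        obtain ⟨t, ht, hts⟩ := ih b hb (by omega)
        exact ⟨t, ht, hts.trans hs⟩
  exact fun a ha => key _ a ha le_rfl

/-- `F` inherits from `E` all identities of the template `(L, R)`. -/
def Tmpl (E F : List ℕ → List ℕ → Prop) (L R : List ℕ) : Prop :=
  ∀ B τ, E (L ++ (wB [0] [1] B ++ encW 2 τ)) (R ++ (wB [0] [1] B ++ encW 2 τ)) →
    F (L ++ (wB [0] [1] B ++ encW 2 τ)) (R ++ (wB [0] [1] B ++ encW 2 τ))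

theorem wB_lt (B : Bool × Bool) : ∀ a ∈ wB [0] [1] B, a < 2 := by
  intro a ha
  rcases B with ⟨_ | _, _ | _⟩ <;> simp [wB] at ha <;> omega

theorem sb2_append (X Y L R : List ℕ) : sb2 X Y (L ++ R) = sb2 X Y L ++ sb2 X Y R := by
  simp [sb2]

theorem sb2_wB (X Y : List ℕ) (B) : sb2 X Y (wB [0] [1] B) = wB X Y B := by
  rcases B with ⟨_ | _, _ | _⟩ <;> simp [wB, sb2]

theorem sb2_id (L : List ℕ) (hL : ∀ a ∈ L, a < 2) : sb2 [0] [1] L = L := by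
  unfold sb2
  conv_rhs => rw [← List.flatMap_singleton' L]
  apply List.flatMap_congr
  intro a ha
  have : a = 0 ∨ a = 1 := by have := hL a ha; omega
  rcases this with rfl | rfl <;> simp

theorem tmpl_basis (E : List ℕ → List ℕ → Prop) (L R : List ℕ) (hL : ∀ a ∈ L, a < 2)
    (hR : ∀ a ∈ R, a < 2) :
    ∃ T : Finset (List ℕ × List ℕ), (∀ e ∈ T, E e.1 e.2) ∧
      ∀ F, Thy F → (∀ e ∈ T, F e.1 e.2) → Tmpl E F L R := by
  classical
  have key : ∀ B : Bool × Bool, ∃ T : Finset (List ℕ × List ℕ), (∀ e ∈ T, E e.1 e.2) ∧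
      ∀ F, Thy F → (∀ e ∈ T, F e.1 e.2) → ∀ τ,
      E (L ++ (wB [0] [1] B ++ encW 2 τ)) (R ++ (wB [0] [1] B ++ encW 2 τ)) →
        F (L ++ (wB [0] [1] B ++ encW 2 τ)) (R ++ (wB [0] [1] B ++ encW 2 τ)) := by
    intro B
    obtain ⟨T, h1, h2⟩ := sublist_basis
      {τ | E (L ++ (wB [0] [1] B ++ encW 2 τ)) (R ++ (wB [0] [1] B ++ encW 2 τ))}
    refine ⟨T.image (fun τ => (L ++ (wB [0] [1] B ++ encW 2 τ), R ++ (wB [0] [1] B ++ encW 2 τ))),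
      ?_, ?_⟩
    · intro e he
      obtain ⟨τ, hτ, rfl⟩ := Finset.mem_image.1 he
      exact h1 τ hτ
    · intro F hF hT τ hτ
      obtain ⟨t, ht, hs⟩ := h2 τ hτ
      have h3 := hT _ (Finset.mem_image_of_mem _ ht)
      have h4 := (InstW.ofSublist hs 2).apply hF (L := L ++ wB [0] [1] B) (R := R ++ wB [0] [1] B)
        (by intro a ha; rcases List.mem_append.1 ha with h | h; exacts [hL a h, wB_lt B a h])
        (by intro a ha; rcases List.mem_append.1 ha with h | h; exacts [hR a h, wB_lt B a h])
        (by simpa using h3)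
      rw [sb2_append, sb2_append, sb2_wB, sb2_id L hL, sb2_id R hR] at h4
      simpa using h4
  choose T hT1 hT2 using key
  refine ⟨Finset.univ.biUnion T, ?_, ?_⟩
  · intro e he
    obtain ⟨B, _, hB⟩ := Finset.mem_biUnion.1 he
    exact hT1 B e hB
  · intro F hF h B
    exact hT2 B F hF (fun e he => h e (Finset.mem_biUnion.2 ⟨B, Finset.mem_univ _, he⟩))


/-- Initial divider-free block. -/
def hdB (D : ℕ → Bool) (q : List ℕ) : List ℕ := q.takeWhile (fun a => !D a)

theorem hdB_cons_D {D : ℕ → Bool} {a : ℕ} (h : D a = true) (q) : hdB D (a :: q) = [] := by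
  simp [hdB, h]

theorem hdB_cons_N {D : ℕ → Bool} {a : ℕ} (h : D a = false) (q) :
    hdB D (a :: q) = a :: hdB D q := by
  simp [hdB, h]

theorem hdB_nil {D : ℕ → Bool} : hdB D [] = [] := rfl

theorem hdB_split (D : ℕ → Bool) (q : List ℕ) :
    ∃ r, q = hdB D q ++ r ∧ (r = [] ∨ ∃ t r', r = t :: r' ∧ D t = true) := by
  induction q with
  | nil => exact ⟨[], rfl, Or.inl rfl⟩
  | cons a q ih =>
    cases h : D a with
    | true => exact ⟨a :: q, by simp [hdB_cons_D h], Or.inr ⟨a, q, rfl, h⟩⟩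
    | false =>
      obtain ⟨r, h1, h2⟩ := ih
      exact ⟨r, by rw [hdB_cons_N h, List.cons_append, ← h1], h2⟩

theorem mem_hdB {D : ℕ → Bool} {q : List ℕ} {a : ℕ} (h : a ∈ hdB D q) : a ∈ q ∧ D a = false := by
  refine ⟨(List.takeWhile_sublist _).subset h, ?_⟩
  have := List.mem_takeWhile_imp h
  simpa using this

/-- Block profile with respect to two letters. -/
def prof (D : ℕ → Bool) (x y : ℕ) : List ℕ → (Bool × Bool) × List (Bool × Bool)
  | [] => ((false, false), [])
  | a :: q =>
    if D a then ((false, false), (prof D x y q).1 :: (prof D x y q).2)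
    else (((prof D x y q).1.1 || a == x, (prof D x y q).1.2 || a == y), (prof D x y q).2)

theorem prof_1 {D : ℕ → Bool} {x y : ℕ} (q : List ℕ) : (prof D x y q).1.1 = true ↔ x ∈ hdB D q := by
  induction q with
  | nil => simp [prof, hdB]
  | cons a q ih =>
    cases h : D a with
    | true => simp [prof, h, hdB_cons_D h]
    | false => simp only [prof, h, hdB_cons_N h, List.mem_cons, Bool.or_eq_true, ih, beq_iff_eq, Bool.false_eq_true, if_false]; tauto

theorem prof_2 {D : ℕ → Bool} {x y : ℕ} (q : List ℕ) : (prof D x y q).1.2 = true ↔ y ∈ hdB D q := by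
  induction q with
  | nil => simp [prof, hdB]
  | cons a q ih =>
    cases h : D a with
    | true => simp [prof, h, hdB_cons_D h]
    | false => simp only [prof, h, hdB_cons_N h, List.mem_cons, Bool.or_eq_true, ih, beq_iff_eq, Bool.false_eq_true, if_false]; tauto

/-- The word `q` with copies of the letters of the current block inserted everywhere. -/
def padW (D : ℕ → Bool) (x y : ℕ) (Y : List ℕ) : List ℕ → List ℕ
  | [] => []
  | a :: q => a :: (wB [x] Y (prof D x y q).1 ++ padW D x y Y q)

theorem mem_wB_prof {D : ℕ → Bool} {x y : ℕ} {Y q : List ℕ} (hY : y ∈ q → Y = [y]) {c : ℕ}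
    (hc : c ∈ wB [x] Y (prof D x y q).1) : c ∈ hdB D q ∧ (c = x ∨ c = y) := by
  simp only [wB, List.mem_append] at hc
  rcases hc with hc | hc
  · split at hc
    · rename_i h
      rw [prof_1] at h
      simp at hc; subst hc; exact ⟨h, Or.inl rfl⟩
    · simp at hc
  · split at hc
    · rename_i h
      rw [prof_2] at h
      rw [hY (mem_hdB h).1] at hc
      simp at hc; subst hc; exact ⟨h, Or.inr rfl⟩
    · simp at hc

theorem OThy.Slem {F : List ℕ → List ℕ → Prop} (hF : OThy F) {D : ℕ → Bool} {x y : ℕ} {Y : List ℕ} :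
    ∀ q p : List ℕ, (y ∈ q → Y = [y]) → (x ∈ q → x ∈ p) → (y ∈ q → y ∈ p) →
      (∀ b ∈ q, D b = false → 2 ≤ (p ++ q).count b) →
      F (p ++ q) (p ++ (wB [x] Y (prof D x y q).1 ++ padW D x y Y q)) := by
  intro q
  induction q with
  | nil => intro p _ _ _ _; simpa [prof, wB, padW] using hF.rf p
  | cons a q ih =>
    intro p hY hx hy hm
    set ws := wB [x] Y (prof D x y (a :: q)).1 with hws
    obtain ⟨r, hr, _⟩ := hdB_split D (a :: q)
    have e1 : F (p ++ (a :: q)) (p ++ (ws ++ (a :: q))) := by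
      rw [hr]
      apply hF.CP
      · intro b hb
        rw [← hr]
        exact hm b (mem_hdB hb).1 (mem_hdB hb).2
      · intro c hc
        obtain ⟨h1, h2⟩ := mem_wB_prof hY hc
        refine ⟨?_, h1⟩
        rcases h2 with rfl | rfl
        · exact hx (mem_hdB h1).1
        · exact hy (mem_hdB h1).1
    have e2 := ih (p ++ (ws ++ [a])) (fun h => hY (by simp [h])) (fun h => by simp [hx (by simp [h])])
      (fun h => by simp [hy (by simp [h])]) (fun b hb hD => by
        have := hm b (by simp [hb]) hD
        simp only [List.count_append, List.count_cons, List.count_nil] at this ⊢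
        omega)
    refine hF.tr e1 ?_
    simpa [padW] using e2

theorem InstW.padW {D : ℕ → Bool} {x y : ℕ} {Y : List ℕ} (q : List ℕ) :
    InstW [x] Y (prof D x y q).2 (padW D x y Y q) := by
  induction q with
  | nil => exact .nil _
  | cons a q ih =>
    cases h : D a with
    | true =>
      have := InstW.cons (prof D x y q).1 _ [a] _ ih
      simpa [prof, h, _root_.padW] using this
    | false =>
      have := ih.ext (a :: wB [x] Y (prof D x y q).1)
      simpa [prof, h, _root_.padW] using this

/-- Restriction of a word to its dividers and to the letters `x`, `y`. -/
def resW (D : ℕ → Bool) (x y : ℕ) (q : List ℕ) : List ℕ := q.filter (fun a => D a || a == x || a == y)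

theorem OThy.N2 {E : List ℕ → List ℕ → Prop} (hE : OThy E) {D : ℕ → Bool} {x y : ℕ} {ρ : ℕ → List ℕ}
    (hx : ρ x = [0]) (hxy : x ≠ y) :
    ∀ (q p : List ℕ) (n : ℕ),
      (∀ i (h : i < (q.filter D).length), ρ ((q.filter D)[i]) = [n + i]) →
      (y ∈ q → ρ y = [1]) → (x ∈ q → 0 ∈ p) → (y ∈ q → 1 ∈ p) →
      E (p ++ (resW D x y q).flatMap ρ)
        (p ++ (wB [0] [1] (prof D x y q).1 ++ encW n (prof D x y q).2)) := by
  intro q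
  induction q with
  | nil => intro p n _ _ _ _; simpa [resW, prof, wB, encW] using hE.rf p
  | cons a q ih =>
    intro p n h1 hy h2 h3
    cases h : D a with
    | true =>
      have h1' : ∀ i (h : i < (q.filter D).length), ρ ((q.filter D)[i]) = [n + 1 + i] := by
        intro i hi
        have := h1 (i+1) (by simpa [h] using hi)
        simpa [h, add_assoc, add_comm 1 i] using this
      have h10 : ρ a = [n] := by
        have := h1 0 (by simp [h])
        simpa [h] using this
      have := ih (p ++ [n]) (n+1) h1' (fun h => hy (by simp [h])) (fun h => by simp [h2 (by simp [h])])
        (fun h => by simp [h3 (by simp [h])])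
      simpa [resW, prof, h, h10, wB, encW] using this
    | false =>
      have h1' : ∀ i (h : i < (q.filter D).length), ρ ((q.filter D)[i]) = [n + i] := by
        intro i hi
        have := h1 i (by simpa [h] using hi)
        simpa [h] using this
      by_cases ax : a = x
      · subst ax
        have := ih (p ++ [0]) n h1' (fun h => hy (by simp [h])) (fun h => by simp)
          (fun h => by simp [h3 (by simp [h])])
        refine hE.tr (by simpa [resW, hx] using this) ?_
        have h4 := hE.NF (p := p) (hh := 0 :: wB [0] [1] (prof D a y q).1)
          (h' := wB [0] [1] (prof D a y (a :: q)).1) (encW n (prof D a y q).2) (by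
            intro b hb
            rcases List.mem_cons.1 hb with rfl | hb
            · exact h2 (by simp)
            · simp only [wB, List.mem_append] at hb
              rcases hb with hb | hb
              · split at hb <;> simp at hb
                subst hb; exact h2 (by simp)
              · split at hb <;> simp at hb
                subst hb
                rename_i hh
                rw [prof_2] at hh
                exact h3 (by simp [(mem_hdB hh).1]))
          (by intro b; rcases hp : (prof D a y q).1 with ⟨_ | _, _ | _⟩ <;> simp [prof, h, hp, wB, hxy])
        simpa [prof, h] using h4
      · by_cases ay : a = y
        · subst ay
          have := ih (p ++ [1]) n h1' (fun h => hy (by simp [h])) (fun h => by simp [h2 (by simp [h])])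
            (fun h => by simp)
          refine hE.tr (by simpa [resW, hy] using this) ?_
          have h4 := hE.NF (p := p) (hh := 1 :: wB [0] [1] (prof D x a q).1)
            (h' := wB [0] [1] (prof D x a (a :: q)).1) (encW n (prof D x a q).2) (by
              intro b hb
              rcases List.mem_cons.1 hb with rfl | hb
              · exact h3 (by simp)
              · simp only [wB, List.mem_append] at hb
                rcases hb with hb | hb
                · split at hb <;> simp at hb
                  subst hb
                  rename_i hh
                  rw [prof_1] at hh
                  exact h2 (by simp [(mem_hdB hh).1])
                · split at hb <;> simp at hb
                  subst hb; exact h3 (by simp))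
            (by intro b; rcases hp : (prof D x a q).1 with ⟨_ | _, _ | _⟩ <;> simp [prof, h, hp, wB, ax] <;> tauto)
          simpa [prof, h] using h4
        · have := ih p n h1' (fun h => hy (by simp [h])) (fun h => by simp [h2 (by simp [h])])
            (fun h => by simp [h3 (by simp [h])])
          have b1 : (a == x) = false := by simpa using ax
          have b2 : (a == y) = false := by simpa using ay
          simpa [resW, h, ax, ay, prof, b1, b2] using this

theorem transfer {E F : List ℕ → List ℕ → Prop} (hE : OThy E) (hF : OThy F) {D : ℕ → Bool}
    {L R : List ℕ} (hT : Tmpl E F L R) (hL : ∀ a ∈ L, a < 2) (hR : ∀ a ∈ R, a < 2)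
    {x y : ℕ} {Y : List ℕ} {p q : List ℕ} (hxy : x ≠ y) (hxq : D x = true → x ∉ q)
    (hyq : D y = true → y ∉ q) (hY : y ∈ q → Y = [y])
    (hxL : x ∈ q → 0 ∈ L ∧ 0 ∈ R) (hyL : y ∈ q → 1 ∈ L ∧ 1 ∈ R)
    (hnd : (q.filter D).Nodup)
    (hmL : ∀ b ∈ q, D b = false → 2 ≤ (p ++ (sb2 [x] Y L ++ q)).count b)
    (hmR : ∀ b ∈ q, D b = false → 2 ≤ (p ++ (sb2 [x] Y R ++ q)).count b)
    (h : E (sb2 [x] [y] L ++ resW D x y q) (sb2 [x] [y] R ++ resW D x y q)) :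
    F (p ++ (sb2 [x] Y L ++ q)) (p ++ (sb2 [x] Y R ++ q)) := by
  let ρ : ℕ → List ℕ := fun a => if a = x then [0] else if a = y then [1] else
    if D a then [2 + (q.filter D).idxOf a] else []
  have hx : ρ x = [0] := by simp [ρ]
  have hy : ρ y = [1] := by simp [ρ, hxy.symm]
  have hL2 : ∀ L : List ℕ, (∀ a ∈ L, a < 2) → (sb2 [x] [y] L).flatMap ρ = L := by
    intro L hL
    induction L with
    | nil => rfl
    | cons a L ih =>
      have h1 := ih (fun b hb => hL b (by simp [hb]))
      have : a = 0 ∨ a = 1 := by have := hL a (by simp); omega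
      simp only [sb2, List.flatMap_cons, List.flatMap_append] at h1 ⊢
      rw [h1]
      rcases this with rfl | rfl <;> simp [hx, hy]
  have hds : ∀ i (h : i < (q.filter D).length), ρ ((q.filter D)[i]) = [2 + i] := by
    intro i hi
    have hm : (q.filter D)[i] ∈ q.filter D := List.getElem_mem hi
    rw [List.mem_filter] at hm
    have n1 : (q.filter D)[i] ≠ x := fun e => hxq (e ▸ hm.2) (e ▸ hm.1)
    have n2 : (q.filter D)[i] ≠ y := fun e => hyq (e ▸ hm.2) (e ▸ hm.1)
    simp only [ρ, if_neg n1, if_neg n2, if_pos hm.2]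
    rw [hnd.idxOf_getElem]
  have e1 := hE.sub ρ h
  rw [List.flatMap_append, List.flatMap_append, hL2 L hL, hL2 R hR] at e1
  have e2 := hE.N2 (D := D) hx hxy q L 2 hds (fun _ => hy) (fun h => (hxL h).1) (fun h => (hyL h).1)
  have e3 := hE.N2 (D := D) hx hxy q R 2 hds (fun _ => hy) (fun h => (hxL h).2) (fun h => (hyL h).2)
  have e4 := hT _ _ (hE.tr (hE.sy e2) (hE.tr e1 e3))
  have e5 := (InstW.padW (D := D) (x := x) (y := y) (Y := Y) q).apply hF.toThy
    (L := L ++ wB [0] [1] (prof D x y q).1) (R := R ++ wB [0] [1] (prof D x y q).1)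
        (by intro a ha; rcases List.mem_append.1 ha with h | h; exacts [hL a h, wB_lt _ a h])
        (by intro a ha; rcases List.mem_append.1 ha with h | h; exacts [hR a h, wB_lt _ a h])
        (by simpa using e4)
  rw [sb2_append, sb2_append, sb2_wB] at e5
  have hmem : ∀ L : List ℕ, (x ∈ q → 0 ∈ L) → (y ∈ q → 1 ∈ L) →
      (x ∈ q → x ∈ p ++ sb2 [x] Y L) ∧ (y ∈ q → y ∈ p ++ sb2 [x] Y L) := by
    intro L h0 h1
    constructor
    · intro h
      refine List.mem_append_right _ (List.mem_flatMap.2 ⟨0, h0 h, by simp⟩)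
    · intro h
      refine List.mem_append_right _ (List.mem_flatMap.2 ⟨1, h1 h, by simp [hY h]⟩)
  have m1 := hmem L (fun h => (hxL h).1) (fun h => (hyL h).1)
  have m2 := hmem R (fun h => (hxL h).2) (fun h => (hyL h).2)
  have f1 := hF.Slem (D := D) (x := x) (y := y) (Y := Y) q (p ++ sb2 [x] Y L) hY m1.1 m1.2
    (by simpa using hmL)
  have f2 := hF.Slem (D := D) (x := x) (y := y) (Y := Y) q (p ++ sb2 [x] Y R) hY m2.1 m2.2
    (by simpa using hmR)
  have f3 := hF.pre p e5
  rw [List.append_assoc] at f1 f2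
  rw [List.append_assoc] at f1 f2
  refine hF.tr f1 (hF.tr ?_ (hF.sy f2))
  simpa using f3


structure Ctx (E F : List ℕ → List ℕ → Prop) : Prop where
  hE : OThy E
  hF : OThy F
  le : ∀ {a b}, F a b → E a b
  t1 : Tmpl E F [0] [0,0]
  t2 : Tmpl E F [0,1] [0,1,0]
  t3 : Tmpl E F [0,0,1] [0,0,1,0]
  t4 : Tmpl E F [0,1] [1,0]
  dl : E [0,0,1,0] [1,0,0] → F [0,0,1,0] [1,0,0]
  th : E [0,1,0] [0,0,1,0] → F [0,1,0] [0,0,1,0]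

/-- Dividers occur once, other letters at least twice. -/
def GoodW (D : ℕ → Bool) (w : List ℕ) : Prop :=
  (w.filter D).Nodup ∧ ∀ b ∈ w, D b = false → 2 ≤ w.count b

/-- Empty or starting with a divider. -/
def dst (D : ℕ → Bool) (q : List ℕ) : Prop := q = [] ∨ ∃ t q', q = t :: q' ∧ D t = true

/-- Restriction to two letters. -/
def piW (x y : ℕ) (w : List ℕ) : List ℕ := w.filter (fun a => a == x || a == y)

def aftW (t : ℕ) : List ℕ → List ℕ
  | [] => []
  | a :: q => if a = t then q else aftW t q

def blkW (D : ℕ → Bool) (q : List ℕ) (t : ℕ) : List ℕ := hdB D (aftW t q)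

theorem flatMap_filter_of {σ : ℕ → List ℕ} {k : ℕ → Bool} {w : List ℕ}
    (h : ∀ a ∈ w, σ a = if k a then [a] else []) : w.flatMap σ = w.filter k := by
  induction w with
  | nil => rfl
  | cons a w ih =>
    rw [List.flatMap_cons, ih (fun b hb => h b (by simp [hb])), h a (by simp), List.filter_cons]
    split <;> simp

theorem nodup_D {D : ℕ → Bool} {P Q : List ℕ} (n : ((P ++ Q).filter D).Nodup) {a : ℕ} (h1 : a ∈ P)
    (h2 : D a = true) (h3 : a ∈ Q) : False := by
  rw [List.filter_append, List.nodup_append] at n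
  exact n.2.2 a (by simp [h1, h2]) a (by simp [h2, h3]) rfl

theorem filter_mem_iff {D : ℕ → Bool} {Q R : List ℕ} (hf : Q.filter D = R.filter D) {a : ℕ}
    (h : D a = true) : a ∈ Q ↔ a ∈ R := by
  have : a ∈ Q.filter D ↔ a ∈ R.filter D := by rw [hf]
  simpa [h] using this

theorem OThy.TLJ {E : List ℕ → List ℕ → Prop} (hE : OThy E) {D : ℕ → Bool} {P Q P' R : List ℕ}
    (x y : ℕ) (Z : List ℕ) (h : E (P ++ Q) (P' ++ R)) (hf : Q.filter D = R.filter D)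
    (n1 : ((P ++ Q).filter D).Nodup) (n2 : ((P' ++ R).filter D).Nodup) (hQ : dst D Q)
    (hR : dst D R) :
    E (piW x y P ++ (Z ++ resW D x y Q)) (piW x y P' ++ (Z ++ resW D x y R)) := by
  rcases hQ with rfl | ⟨t, q, rfl, ht⟩
  · have : R = [] := by
      rcases hR with rfl | ⟨t, q, rfl, ht⟩
      · rfl
      · simp [ht] at hf
    subst this
    have := hE.sub (fun a => if (a == x || a == y) then [a] else []) h
    have h2 := hE.mul this (hE.rf Z)
    rw [flatMap_filter_of (k := fun a => (a == x || a == y)) (by intros; rfl),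
      flatMap_filter_of (k := fun a => (a == x || a == y)) (by intros; rfl)] at h2
    simpa [piW, resW] using h2
  · rcases hR with rfl | ⟨t', r, rfl, ht'⟩
    · simp [ht] at hf
    have htt : t = t' := by simp [ht, ht'] at hf; exact hf.1
    subst htt
    let k : ℕ → Bool := fun a => (decide (a ∈ (t :: q).filter D)) || a == x || a == y
    let σ : ℕ → List ℕ := fun a => if a = t then Z ++ [t] else if k a then [a] else []
    have hP : ∀ P R : List ℕ, ((P ++ (t :: R)).filter D).Nodup → (t :: q).filter D = (t :: R).filter D →
        P.flatMap σ = piW x y P := by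
      intro P R n1 hf
      apply flatMap_filter_of
      intro a ha
      have nt : a ≠ t := fun e => nodup_D n1 ha (e ▸ ht) (by simp [e])
      have nm : a ∉ (t :: q).filter D := fun hm => nodup_D n1 ha (List.mem_filter.1 hm).2
        ((filter_mem_iff hf (List.mem_filter.1 hm).2).1 (List.mem_filter.1 hm).1)
      simp only [σ, nt, if_false, k, nm, decide_false, Bool.false_or]
    have hq : ∀ R : List ℕ, ((t :: R).filter D).Nodup → (t :: q).filter D = (t :: R).filter D →
        R.flatMap σ = resW D x y R := by
      intro R n1 hf
      apply flatMap_filter_of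
      intro a ha
      have nt : a ≠ t := by
        rintro rfl
        simp [ht] at n1
        exact n1.1 ha
      have : k a = (D a || a == x || a == y) := by
        simp only [k, hf]
        congr 2
        simp [ha]
      simp only [σ, nt, if_false, this]
    have st : σ t = Z ++ [t] := by simp [σ]
    have := hE.sub σ h
    rw [List.flatMap_append, List.flatMap_append, List.flatMap_cons, List.flatMap_cons,
      hP P q n1 rfl, hP P' r n2 hf, hq q (by rw [List.filter_append] at n1; exact n1.of_append_right) rfl,
      hq r (by rw [List.filter_append] at n2; exact n2.of_append_right) hf, st] at this
    simpa [resW, ht] using this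

theorem aftW_append {t : ℕ} {h q : List ℕ} (hn : t ∉ h) : aftW t (h ++ q) = aftW t q := by
  induction h with
  | nil => rfl
  | cons a h ih =>
    simp only [List.mem_cons, not_or] at hn
    simp [aftW, Ne.symm hn.1, ih hn.2]

theorem aftW_cons_self {t : ℕ} {q : List ℕ} : aftW t (t :: q) = q := by simp [aftW]

theorem aftW_cons_ne {t a : ℕ} (h : a ≠ t) {q : List ℕ} : aftW t (a :: q) = aftW t q := by
  simp [aftW, h]

theorem aftW_notMem {t : ℕ} {q : List ℕ} (h : t ∉ q) : aftW t q = [] := by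
  have := aftW_append (q := []) h
  simpa [aftW] using this

theorem hdB_append {D : ℕ → Bool} {h q : List ℕ} (hh : ∀ a ∈ h, D a = false) :
    hdB D (h ++ q) = h ++ hdB D q := by
  induction h with
  | nil => rfl
  | cons a h ih =>
    rw [List.cons_append, hdB_cons_N (hh a (by simp)), ih (fun b hb => hh b (by simp [hb]))]; rfl

theorem hdB_D {D : ℕ → Bool} {q : List ℕ} : ∀ a ∈ hdB D q, D a = false := fun _ h => (mem_hdB h).2

theorem hdB_dst {D : ℕ → Bool} {q : List ℕ} (h : dst D q) : hdB D q = [] := by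
  rcases h with rfl | ⟨t, q', rfl, ht⟩
  · rfl
  · exact hdB_cons_D ht _

theorem filter_hd {D : ℕ → Bool} {h : List ℕ} (hh : ∀ a ∈ h, D a = false) : h.filter D = [] := by
  rw [List.filter_eq_nil_iff]; intro a ha; simp [hh a ha]

theorem blkW_hd {D : ℕ → Bool} {h q : List ℕ} (hh : ∀ a ∈ h, D a = false) {t : ℕ} (ht : D t = true) :
    blkW D (h ++ q) t = blkW D q t := by
  unfold blkW
  rw [aftW_append]
  intro hm; rw [hh t hm] at ht; cases ht

/-- Matching decompositions of two words with the same dividers. -/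
theorem split_two {D : ℕ → Bool} {Q R : List ℕ} (hf : Q.filter D = R.filter D) :
    (Q = hdB D Q ∧ R = hdB D R) ∨ ∃ t Q' R', D t = true ∧ Q = hdB D Q ++ t :: Q' ∧
      R = hdB D R ++ t :: R' ∧ Q'.filter D = R'.filter D := by
  obtain ⟨q, hq, hq'⟩ := hdB_split D Q
  obtain ⟨r, hr, hr'⟩ := hdB_split D R
  have h1 : Q.filter D = q.filter D := by rw [hq]; simp [filter_hd (hdB_D (D := D) (q := Q))]
  have h2 : R.filter D = r.filter D := by rw [hr]; simp [filter_hd (hdB_D (D := D) (q := R))]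
  rw [h1, h2] at hf
  rcases hq' with rfl | ⟨t, q', rfl, ht⟩
  · rcases hr' with rfl | ⟨t, r', rfl, ht⟩
    · left; simpa using And.intro hq hr
    · simp [ht] at hf
  · rcases hr' with rfl | ⟨t', r', rfl, ht'⟩
    · simp [ht] at hf
    · right
      simp [ht, ht'] at hf
      obtain ⟨rfl, hf⟩ := hf
      exact ⟨t, q', r', ht, hq, hr, hf⟩

theorem OThy.TE {E : List ℕ → List ℕ → Prop} (hE : OThy E) {D : ℕ → Bool} : ∀ (n : ℕ) (Q R p : List ℕ),
    Q.length ≤ n → Q.filter D = R.filter D → (Q.filter D).Nodup → (∀ b, b ∈ hdB D Q ↔ b ∈ hdB D R) →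
    (∀ t, D t = true → ∀ b, b ∈ blkW D Q t ↔ b ∈ blkW D R t) → (∀ b ∈ Q, D b = false → b ∈ p) →
    E (p ++ Q) (p ++ R) := by
  intro n
  induction n with
  | zero =>
    intro Q R p hl hf _ hh _ _
    have : Q = [] := List.length_eq_zero_iff.1 (by omega)
    subst this
    rcases split_two hf with ⟨_, h2⟩ | ⟨t, Q', R', _, h, _⟩
    · have : R = [] := by
        rw [h2, List.eq_nil_iff_forall_not_mem]
        intro b hb
        have := (hh b).2 hb
        simp [hdB] at this
      subst this; exact hE.rf _
    · simp at h
  | succ n ih =>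
    intro Q R p hl hf hn hh hb hp
    have hp1 : ∀ b ∈ hdB D Q, b ∈ p := fun b hb => hp b (mem_hdB hb).1 (mem_hdB hb).2
    rcases split_two hf with ⟨h1, h2⟩ | ⟨t, Q', R', ht, h1, h2, h3⟩
    · rw [h1, h2]
      simpa using hE.NF [] hp1 hh
    · have e1 := hE.NF (t :: Q') hp1 hh
      have hn' : (Q'.filter D).Nodup ∧ t ∉ Q' := by
        rw [h1] at hn
        simp [filter_hd (hdB_D (D := D) (q := Q)), ht] at hn
        exact ⟨hn.2, hn.1⟩
      have hn2 : t ∉ R' := by rw [← filter_mem_iff h3 ht]; exact hn'.2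
      have b1 : ∀ s, D s = true → blkW D Q s = blkW D (t :: Q') s := by
        intro s hs; rw [h1]; simpa using blkW_hd hdB_D hs
      have b2 : ∀ s, D s = true → blkW D R s = blkW D (t :: R') s := by
        intro s hs; rw [h2]; simpa using blkW_hd hdB_D hs
      have e2 := ih Q' R' (p ++ (hdB D R ++ [t])) (by rw [h1] at hl; simp at hl; omega) h3 hn'.1
        (fun b => by
          have := hb t ht b
          rw [b1 t ht, b2 t ht] at this
          simpa [blkW, aftW] using this)
        (fun s hs b => by
          by_cases e : t = s
          · subst e
            simp [blkW, aftW_notMem hn'.2, aftW_notMem hn2]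
          · have := hb s hs b
            rw [b1 s hs, b2 s hs] at this
            simpa [blkW, aftW, e] using this)
        (fun b hb hD => by
          have := hp b (by rw [h1]; simp [hb]) hD
          simp [this])
      rw [h1, h2]
      refine hE.tr e1 ?_
      simpa using e2

theorem hdB_resW {D : ℕ → Bool} {x y : ℕ} (q : List ℕ) : hdB D (resW D x y q) = piW x y (hdB D q) := by
  induction q with
  | nil => rfl
  | cons a q ih =>
    unfold resW at ih ⊢
    cases h : D a with
    | true => simp [h, hdB_cons_D h, piW]
    | false =>
      rw [hdB_cons_N h, List.filter_cons]
      by_cases e : (a == x || a == y) = true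
      · simp only [h, Bool.false_or, e, if_true, hdB_cons_N h, ih, piW, List.filter_cons]
      · rw [Bool.not_eq_true] at e
        simp only [h, Bool.false_or, e, piW, List.filter_cons]; simp; exact ih

theorem aftW_resW {D : ℕ → Bool} {x y : ℕ} {t : ℕ} (ht : D t = true) (q : List ℕ) :
    aftW t (resW D x y q) = resW D x y (aftW t q) := by
  induction q with
  | nil => rfl
  | cons a q ih =>
    by_cases e : a = t
    · subst e
      simp [resW, ht, aftW]
    · unfold resW at ih ⊢
      rw [List.filter_cons]
      split <;> simp [aftW, e, ih]

theorem resW_append {D : ℕ → Bool} {x y : ℕ} (h q : List ℕ) (hh : ∀ a ∈ h, D a = false) :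
    resW D x y (h ++ q) = piW x y h ++ resW D x y q := by
  unfold resW piW
  rw [List.filter_append]
  congr 1
  apply List.filter_congr
  intro a ha; simp [hh a ha]

theorem resW_hd {D : ℕ → Bool} {x y : ℕ} {q Q : List ℕ} (h : q = hdB D q ++ Q) :
    resW D x y q = piW x y (hdB D q) ++ resW D x y Q := by
  conv_lhs => rw [h]
  exact resW_append _ _ hdB_D

theorem mem_piW {x y a : ℕ} {w : List ℕ} : a ∈ piW x y w ↔ a ∈ w ∧ (a = x ∨ a = y) := by
  simp [piW]

theorem OThy.TEr {E : List ℕ → List ℕ → Prop} (hE : OThy E) {D : ℕ → Bool} {Q R X : List ℕ}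
    {x y : ℕ} (hf : Q.filter D = R.filter D) (hn : (Q.filter D).Nodup) (hQ : dst D Q) (hR : dst D R)
    (hb : ∀ t, D t = true → ∀ b, b ∈ blkW D Q t ↔ b ∈ blkW D R t) (hx : x ∈ X) (hy : y ∈ X) :
    E (X ++ resW D x y Q) (X ++ resW D x y R) := by
  have ff : ∀ Q, (resW D x y Q).filter D = Q.filter D := by
    intro Q
    unfold resW
    rw [List.filter_filter]
    apply List.filter_congr
    intro a _
    cases D a <;> simp
  refine hE.TE (D := D) _ _ _ _ le_rfl (by rw [ff, ff, hf]) (by rw [ff]; exact hn) ?_ ?_ ?_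
  · intro b; rw [hdB_resW, hdB_resW, hdB_dst hQ, hdB_dst hR]
  · intro t ht b
    unfold blkW at hb ⊢
    rw [aftW_resW ht, aftW_resW ht, hdB_resW, hdB_resW, mem_piW, mem_piW, hb t ht b]
  · intro b hb hD
    simp [resW, hD] at hb
    rcases hb.2 with rfl | rfl <;> assumption


theorem piW_append (x y : ℕ) (a b : List ℕ) : piW x y (a ++ b) = piW x y a ++ piW x y b := by
  simp [piW]

theorem piW_x (x y : ℕ) (b : List ℕ) : piW x y (x :: b) = x :: piW x y b := by
  simp [piW]

theorem piW_y (x y : ℕ) (b : List ℕ) : piW x y (y :: b) = y :: piW x y b := by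
  simp [piW]

theorem TX {E F : List ℕ → List ℕ → Prop} (C : Ctx E F) {D : ℕ → Bool} {c y : ℕ}
    {s Y q r1 r2 R : List ℕ} (hcy : c ≠ y) (hDc : D c = false) (hys : y ∉ s)
    (hY : piW c y Y = [y]) (hYq : y ∈ q → Y = [y])
    (h : E (s ++ c :: (Y ++ q)) (r1 ++ c :: (r2 ++ R))) (hU : GoodW D (s ++ c :: (Y ++ q)))
    (hV : ((r1 ++ c :: (r2 ++ R)).filter D).Nodup) (hf : q.filter D = R.filter D) (hR : dst D R)
    (hc1 : c ∈ r1) (hy1 : y ∈ r1) :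
    F (s ++ c :: (Y ++ q)) (s ++ c :: (Y ++ c :: q)) := by
  have hE := C.hE
  have hF := C.hF
  obtain ⟨Q, hq, hQ⟩ := hdB_split D q
  have hfQ : Q.filter D = R.filter D := by
    rw [← hf]; conv_rhs => rw [hq]
    simp [filter_hd (hdB_D (D := D) (q := q))]
  have hyY : y ∈ Y := by
    have : y ∈ piW c y Y := by rw [hY]; simp
    exact (mem_piW.1 this).1
  have hqe : s ++ c :: (Y ++ q) = (s ++ c :: (Y ++ hdB D q)) ++ Q := by
    conv_lhs => rw [hq]
    simp
  have hVe : r1 ++ c :: (r2 ++ R) = (r1 ++ c :: r2) ++ R := by simp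
  have tl : ∀ Z, _ := fun Z => hE.TLJ (D := D) c y Z (by rw [← hqe, ← hVe]; exact h) hfQ
    (by rw [← hqe]; exact hU.1) (by rw [← hVe]; exact hV) hQ hR
  have tl0 := tl []
  have tl1 := tl [c]
  have nf : E (piW c y (r1 ++ c :: r2) ++ ([] ++ resW D c y R))
      (piW c y (r1 ++ c :: r2) ++ ([c] ++ resW D c y R)) := by
    have := hE.NF (p := piW c y r1) (hh := c :: piW c y r2) (h' := c :: (piW c y r2 ++ [c]))
      (resW D c y R) (by
        intro b hb
        have : b = c ∨ b = y := by
          rcases List.mem_cons.1 hb with rfl | hb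
          · simp
          · exact (mem_piW.1 hb).2
        rw [mem_piW]
        rcases this with rfl | rfl <;> simp [*]) (by intro b; simp; tauto)
    simpa [piW_append, piW_x] using this
  have e1 := hE.tr tl0 (hE.tr nf (hE.sy tl1))
  rw [piW_append, piW_x, piW_append, hY] at e1
  have e2 : E (piW c y s ++ c :: y :: resW D c y q) (piW c y s ++ c :: y :: c :: resW D c y q) := by
    rw [resW_hd hq]
    have := hE.COM (c := c) (resW D c y Q) (piW c y (hdB D q)) (piW c y s ++ [c, y]) (by simp)
      (by intro b hb; rcases (mem_piW.1 hb).2 with rfl | rfl <;> simp)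
    refine hE.tr (by simpa using e1) (hE.sy ?_)
    simpa using this
  have hDy : D y = true → y ∉ q := fun hd hm => by
    have := nodup_D (P := s ++ c :: Y) (Q := q) (by simpa using hU.1) (by simp [hyY]) hd
    exact this hm
  have hnq : (q.filter D).Nodup := by
    have := hU.1
    simp only [List.filter_append, List.filter_cons, hDc] at this
    exact (this.of_append_right).of_append_right
  have hDcq : D c = true → c ∉ q := by rw [hDc]; intro h; cases h
  by_cases hcs : c ∈ s
  · obtain ⟨m, hm⟩ : ∃ m, piW c y s = c :: m := by
      cases hp : piW c y s with
      | nil =>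
        have : c ∈ piW c y s := mem_piW.2 ⟨hcs, by simp⟩
        rw [hp] at this; simp at this
      | cons a m =>
        have h1 : a ∈ piW c y s := by rw [hp]; simp
        rcases mem_piW.1 h1 with ⟨h2, rfl | rfl⟩
        · exact ⟨m, rfl⟩
        · exact absurd h2 hys
    have hmc : ∀ b ∈ m, b = c := by
      intro b hb
      have h1 : b ∈ piW c y s := by rw [hm]; simp [hb]
      rcases mem_piW.1 h1 with ⟨h2, rfl | rfl⟩
      · rfl
      · exact absurd h2 hys
    have nf2 : ∀ T, E (piW c y s ++ c :: T) (c :: c :: T) := by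
      intro T
      have := hE.NF (p := [c]) (hh := m ++ [c]) (h' := [c]) T (by
        intro b hb; simp at hb; rcases hb with hb | hb
        · simp [hmc b hb]
        · simp [hb]) (by
        intro b; simp; exact hmc b)
      rw [hm]
      simpa using this
    have e3 := hE.tr (hE.sy (nf2 _)) (hE.tr e2 (nf2 _))
    have f1 := transfer hE hF (D := D) C.t3 (by simp) (by simp) (x := c) (y := y) (Y := Y) (p := s)
      (q := q) hcy hDcq hDy hYq (by simp) (by simp) hnq
      (by
        intro b hb hD
        have := hU.2 b (by simp [hb]) hD
        simp [sb2, List.count_append, List.count_cons] at this ⊢; omega)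
      (by
        intro b hb hD
        have := hU.2 b (by simp [hb]) hD
        simp [sb2, List.count_append, List.count_cons] at this ⊢; omega)
      (by simpa [sb2] using e3)
    have f2 := hF.dup (x := c) (p := s) (Y ++ q) hcs
    have f3 := hF.dup (x := c) (p := s) (Y ++ c :: q) hcs
    refine hF.tr f2 (hF.tr ?_ (hF.sy f3))
    simpa [sb2] using f1
  · have hs0 : piW c y s = [] := by
      rw [List.eq_nil_iff_forall_not_mem]
      intro b hb
      rcases mem_piW.1 hb with ⟨h2, rfl | rfl⟩
      · exact hcs h2
      · exact hys h2
    rw [hs0] at e2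
    have f1 := transfer hE hF (D := D) C.t2 (by simp) (by simp) (x := c) (y := y) (Y := Y) (p := s)
      (q := q) hcy hDcq hDy hYq (by simp) (by simp) hnq
      (by
        intro b hb hD
        have := hU.2 b (by simp [hb]) hD
        simp [sb2, List.count_append, List.count_cons] at this ⊢; omega)
      (by
        intro b hb hD
        have := hU.2 b (by simp [hb]) hD
        simp [sb2, List.count_append, List.count_cons] at this ⊢; omega)
      (by simpa [sb2] using e2)
    simpa [sb2] using f1

theorem TD {E F : List ℕ → List ℕ → Prop} (C : Ctx E F) {D : ℕ → Bool} {c : ℕ}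
    {s q V0 R : List ℕ} (hDc : D c = false) (hcs : c ∉ s)
    (h : E (s ++ c :: q) (V0 ++ R)) (hU : GoodW D (s ++ c :: q))
    (hV : ((V0 ++ R).filter D).Nodup) (hf : q.filter D = R.filter D) (hR : dst D R)
    (hc : 2 ≤ V0.count c) :
    F (s ++ c :: q) (s ++ c :: c :: q) := by
  have hE := C.hE
  have hF := C.hF
  obtain ⟨Q, hq, hQ⟩ := hdB_split D q
  have hfQ : Q.filter D = R.filter D := by
    rw [← hf]; conv_rhs => rw [hq]
    simp [filter_hd (hdB_D (D := D) (q := q))]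
  obtain ⟨y, hy⟩ := Infinite.exists_notMem_finset ((c :: (s ++ q ++ V0)).toFinset)
  simp only [List.mem_toFinset, List.mem_cons, List.mem_append, not_or] at hy
  obtain ⟨hyc, ⟨hys, hyq⟩, hyV⟩ := hy
  have hqe : s ++ c :: q = (s ++ c :: hdB D q) ++ Q := by
    conv_lhs => rw [hq]
    simp
  have tl : ∀ Z, _ := fun Z => hE.TLJ (D := D) c y Z (by rw [← hqe]; exact h) hfQ
    (by rw [← hqe]; exact hU.1) hV hQ hR
  have tl0 := tl []
  have tl1 := tl [c]
  have hs0 : piW c y s = [] := by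
    rw [List.eq_nil_iff_forall_not_mem]
    intro b hb
    rcases mem_piW.1 hb with ⟨h2, rfl | rfl⟩
    · exact hcs h2
    · exact hys h2
  have hV0 : ∀ b ∈ piW c y V0, b = c := by
    intro b hb
    rcases mem_piW.1 hb with ⟨h2, rfl | rfl⟩
    · rfl
    · exact absurd h2 hyV
  have hcount : 2 ≤ (piW c y V0).count c := by
    rw [piW, List.count_filter (by simp)]; exact hc
  obtain ⟨m, hm⟩ : ∃ m, piW c y V0 = c :: c :: m := by
    match hp : piW c y V0 with
    | [] => rw [hp] at hcount; simp at hcount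
    | [a] => rw [hp] at hcount; simp [List.count_cons] at hcount; split at hcount <;> omega
    | a :: b :: m =>
      rw [hp] at hV0
      exact ⟨m, by rw [hV0 a (by simp), hV0 b (by simp)]⟩
  have nf : E (piW c y V0 ++ ([] ++ resW D c y R)) (piW c y V0 ++ ([c] ++ resW D c y R)) := by
    have := hE.NF (p := [c]) (hh := c :: m) (h' := c :: (m ++ [c])) (resW D c y R) (by
      intro b hb
      have := hV0 b (by rw [hm]; simp at hb ⊢; tauto)
      simp [this]) (by intro b; simp; tauto)
    rw [hm]
    simpa using this
  have e1 := hE.tr tl0 (hE.tr nf (hE.sy tl1))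
  rw [piW_append, piW_x, hs0] at e1
  have e2 : E (c :: resW D c y q) (c :: c :: resW D c y q) := by
    rw [resW_hd hq]
    have := hE.COM (c := c) (resW D c y Q) (piW c y (hdB D q)) [c] (by simp)
      (by
        intro b hb
        rcases mem_piW.1 hb with ⟨h2, rfl | rfl⟩
        · simp
        · exact absurd (mem_hdB h2).1 hyq)
    refine hE.tr (by simpa using e1) (hE.sy ?_)
    simpa using this
  have hnq : (q.filter D).Nodup := by
    have := hU.1
    simp only [List.filter_append, List.filter_cons, hDc] at this
    exact this.of_append_right
  have hDcq : D c = true → c ∉ q := by rw [hDc]; intro h; cases h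
  have f1 := transfer hE hF (D := D) C.t1 (by simp) (by simp) (x := c) (y := y) (Y := [y]) (p := s)
      (q := q) (Ne.symm hyc) hDcq (fun _ => hyq) (fun _ => rfl) (by simp) (fun h => absurd h hyq) hnq
      (by
        intro b hb hD
        have := hU.2 b (by simp [hb]) hD
        simp [sb2, List.count_append, List.count_cons] at this ⊢; omega)
      (by
        intro b hb hD
        have := hU.2 b (by simp [hb]) hD
        simp [sb2, List.count_append, List.count_cons] at this ⊢; omega)
      (by simpa [sb2] using e2)
  simpa [sb2] using f1

/-- Insert `c` right after a divider. -/
theorem TA {E F : List ℕ → List ℕ → Prop} (C : Ctx E F) {D : ℕ → Bool} {c t : ℕ}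
    {p q p' r : List ℕ} (hDc : D c = false) (hDt : D t = true)
    (h : E (p ++ t :: q) (p' ++ t :: r)) (hU : GoodW D (p ++ t :: q))
    (hV : ((p' ++ t :: r).filter D).Nodup) (hf : q.filter D = r.filter D)
    (hc : c ∈ p) (hc' : c ∈ p') (hcr : c ∈ hdB D r) :
    F (p ++ t :: q) (p ++ t :: c :: q) := by
  obtain ⟨s, w, rfl, hw⟩ : ∃ s w, p = s ++ c :: w ∧ c ∉ w := by
    obtain ⟨w', s', h1, h2⟩ := List.eq_append_cons_of_mem (List.mem_reverse.2 hc)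
    refine ⟨s'.reverse, w'.reverse, ?_, by simpa using h2⟩
    have := congrArg List.reverse h1
    simpa using this
  obtain ⟨R, hr, hR⟩ := hdB_split D r
  obtain ⟨a, b, hab⟩ := List.append_of_mem hcr
  have hct : c ≠ t := by rintro rfl; rw [hDc] at hDt; cases hDt
  have hR0 : r.filter D = R.filter D := by
    conv_lhs => rw [hr]
    simp [filter_hd (hdB_D (D := D) (q := r))]
  have hV' : p' ++ t :: r = (p' ++ t :: a) ++ c :: (b ++ R) := by
    conv_lhs => rw [hr, hab]
    simp
  have htw : t ∉ s ++ c :: w := fun hm => nodup_D hU.1 hm hDt (by simp)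
  simp only [List.mem_append, List.mem_cons, not_or] at htw
  have htq : t ∉ q := fun hm => by
    refine nodup_D (P := s ++ c :: (w ++ [t])) (Q := q) (by simpa using hU.1) (a := t) (by simp) hDt hm
  have := TX C (D := D) (c := c) (y := t) (s := s) (Y := w ++ [t]) (q := q) (r1 := p' ++ t :: a)
    (r2 := b) (R := R) hct hDc htw.1 (by
      rw [piW_append]
      have : piW c t w = [] := by
        rw [List.eq_nil_iff_forall_not_mem]
        intro b hb
        rcases mem_piW.1 hb with ⟨h2, rfl | rfl⟩
        · exact hw h2
        · exact htw.2.2 h2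
      rw [this]; simp [piW]) (fun h => absurd h htq) (by rw [← hV']; simpa using h) (by simpa using hU)
      (by rw [← hV']; exact hV) (by rw [hf, hR0]) hR (by simp [hc']) (by simp)
  simpa using this


theorem GoodW.perm {D : ℕ → Bool} {w w' : List ℕ} (h : GoodW D w) (hp : w.Perm w') : GoodW D w' := by
  refine ⟨((hp.filter D).nodup_iff).1 h.1, fun b hb hD => ?_⟩
  rw [← hp.count_eq]; exact h.2 b (hp.mem_iff.2 hb) hD

theorem GoodW.ins {D : ℕ → Bool} {p q cs : List ℕ} (h : GoodW D (p ++ q))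
    (hc : ∀ c ∈ cs, c ∈ p ∧ D c = false) : GoodW D (p ++ (cs ++ q)) := by
  refine ⟨?_, fun b hb hD => ?_⟩
  · have := h.1
    simpa [filter_hd (fun a ha => (hc a ha).2)] using this
  · have : b ∈ p ++ q := by
      simp only [List.mem_append] at hb ⊢
      rcases hb with hb | hb | hb
      · simp [hb]
      · simp [(hc b hb).1]
      · simp [hb]
    have := h.2 b this hD
    simp only [List.count_append] at this ⊢; omega

theorem GoodW.del {D : ℕ → Bool} {p s q : List ℕ} {c : ℕ} (h : GoodW D (p ++ (s ++ c :: q)))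
    (hc : 2 ≤ p.count c) (hD : D c = false) : GoodW D (p ++ (s ++ q)) := by
  refine ⟨?_, fun b hb hDb => ?_⟩
  · have := h.1
    simpa [hD] using this
  · by_cases e : b = c
    · subst e; simp only [List.count_append]; omega
    · have := h.2 b (by simp only [List.mem_append, List.mem_cons] at hb ⊢; tauto) hDb
      have e' : ¬ c = b := fun h => e h.symm
      simpa [List.count_append, List.count_cons, e'] using this

theorem mem_of_count2 {z : ℕ} {s X : List ℕ} (h : 2 ≤ (s ++ z :: X).count z) : z ∈ s ∨ z ∈ X := by
  by_contra hc
  push Not at hc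
  rw [List.count_append, List.count_cons_self, List.count_eq_zero.2 hc.1,
    List.count_eq_zero.2 hc.2] at h
  omega

theorem MR {E F : List ℕ → List ℕ → Prop} (C : Ctx E F) {D : ℕ → Bool} {c : ℕ}
    {q r1 r2 R : List ℕ} (hDc : D c = false)
    (hV : ((r1 ++ c :: (r2 ++ R)).filter D).Nodup) (hf : q.filter D = R.filter D) (hR : dst D R)
    (hc1 : c ∈ r1) : ∀ s2 s1 : List ℕ, c ∈ s1 → (∀ z ∈ s2, z ∈ r1 ∧ D z = false) →
    E (s1 ++ c :: (s2 ++ q)) (r1 ++ c :: (r2 ++ R)) → GoodW D (s1 ++ c :: (s2 ++ q)) →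
    F (s1 ++ c :: (s2 ++ q)) (s1 ++ (s2 ++ c :: q)) := by
  intro s2
  induction s2 with
  | nil => intro s1 _ _ _ _; exact C.hF.rf _
  | cons z s2 ih =>
    intro s1 hc hz h hU
    obtain ⟨hz1, hDz⟩ := hz z (by simp)
    have hf2 : (s2 ++ q).filter D = R.filter D := by
      rw [List.filter_append, filter_hd (fun a ha => (hz a (by simp [ha])).2), ← hf]; rfl
    have step : F (s1 ++ c :: (z :: s2 ++ q)) (s1 ++ z :: c :: (s2 ++ q)) := by
      by_cases hzs : z ∈ s1
      · exact C.hF.swp _ hc hzs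
      · have hcz : c ≠ z := by rintro rfl; exact hzs hc
        have f1 := TX C (D := D) (c := c) (y := z) (s := s1) (Y := [z]) (q := s2 ++ q) hcz hDc hzs
          (by simp [piW]) (fun _ => rfl) (by simpa using h) (by simpa using hU) hV hf2 hR hc1 hz1
        have hm := hU.2 z (by simp) hDz
        have hm' : z ∈ s1 ∨ z ∈ s2 ++ q := by
          have hm2 : 2 ≤ ((s1 ++ [c]) ++ z :: (s2 ++ q)).count z := by simpa using hm
          rcases mem_of_count2 hm2 with h | h
          · simp [hzs] at h; exact absurd h.symm hcz
          · right; exact h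
        have f2 := C.hF.L3 (x := c) (y := z) (p := s1) (q := s2 ++ q) hc hm'
        exact C.hF.tr (by simpa using f1) (C.hF.sy f2)
    have f3 := ih (s1 ++ [z]) (by simp [hc]) (fun a ha => hz a (by simp [ha]))
      (by
        have := C.hE.tr (C.hE.sy (C.le step)) h
        simpa using this)
      (by
        refine hU.perm ?_
        simp only [List.append_assoc, List.cons_append, List.nil_append]
        exact (List.Perm.swap _ _ _).append_left _)
    refine C.hF.tr step ?_
    simpa using f3

theorem GLem {E F : List ℕ → List ℕ → Prop} (C : Ctx E F) {D : ℕ → Bool} {c : ℕ}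
    {p q r : List ℕ} (h : E (p ++ q) (p ++ r)) (hU : GoodW D (p ++ q))
    (hV : ((p ++ r).filter D).Nodup) (hf : q.filter D = r.filter D) (hc : c ∈ p)
    (hcr : c ∈ hdB D r) (ht : ∃ t ∈ p, D t = true) : F (p ++ q) (p ++ c :: q) := by
  have hDc := (mem_hdB hcr).2
  obtain ⟨R, hr, hR⟩ := hdB_split D r
  obtain ⟨a, b, hab⟩ := List.append_of_mem hcr
  have hR0 : r.filter D = R.filter D := by
    conv_lhs => rw [hr]
    simp [filter_hd (hdB_D (D := D) (q := r))]
  obtain ⟨p0, t, s, rfl, hDt, hs⟩ : ∃ p0 t s, p = p0 ++ t :: s ∧ D t = true ∧ ∀ a ∈ s, D a = false := by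
    clear h hU hV hc
    induction p using List.reverseRecOn with
    | nil => simp at ht
    | append_singleton l x ih =>
      by_cases hx : D x = true
      · exact ⟨l, x, [], by simp, hx, by simp⟩
      · obtain ⟨t, h1, h2⟩ := ht
        have : t ∈ l := by
          rcases List.mem_append.1 h1 with h1 | h1
          · exact h1
          · simp at h1; subst h1; exact absurd h2 hx
        obtain ⟨p0, t, s, rfl, h3, h4⟩ := ih ⟨t, this, h2⟩
        refine ⟨p0, t, s ++ [x], by simp, h3, ?_⟩
        intro a ha
        rcases List.mem_append.1 ha with ha | ha
        · exact h4 a ha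
        · simp at ha; subst ha; simpa using hx
  set p := p0 ++ t :: s with hp
  have hV' : p ++ r = (p ++ a) ++ c :: (b ++ R) := by
    conv_lhs => rw [hr, hab]
    simp
  -- first produce an extra occurrence of `c` in the last block of `p`
  obtain ⟨s1, s2, hss, hcs, f1⟩ : ∃ s1 s2, p = s1 ++ s2 ∧ c ∈ s1 ∧ (∀ z ∈ s2, z ∈ p ∧ D z = false) ∧
      F (p ++ q) (s1 ++ c :: (s2 ++ q)) := by
    by_cases hc0 : c ∈ p0
    · refine ⟨p0 ++ [t], s, by simp [hp], by simp [hc0], fun z hz => ⟨by simp [hp, hz], hs z hz⟩, ?_⟩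
      have := TA C (D := D) (c := c) (t := t) (p := p0) (q := s ++ q) (p' := p0) (r := s ++ r) hDc hDt
        (by simpa [hp] using h) (by simpa [hp] using hU) (by simpa [hp] using hV)
        (by rw [List.filter_append, List.filter_append, hf]) hc0 hc0
        (by rw [hdB_append hs]; simp [hcr])
      simpa [hp] using this
    · have hct : c ≠ t := by rintro rfl; rw [hDc] at hDt; cases hDt
      have hcs : c ∈ s := by
        rw [hp] at hc
        simp [hc0, hct] at hc; exact hc
      obtain ⟨s1, s2, h1, h2⟩ := List.eq_append_cons_of_mem hcs
      refine ⟨p0 ++ t :: (s1 ++ [c]), s2, by simp [hp, h1], by simp,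
        fun z hz => ⟨by simp [hp, h1, hz], hs z (by simp [h1, hz])⟩, ?_⟩
      have := TD C (D := D) (c := c) (s := p0 ++ t :: s1) (q := s2 ++ q) (V0 := p ++ (a ++ c :: b))
        (R := R) hDc (by simp [hc0, hct, h2]) (by
          have h' := h
          rw [hV'] at h'
          rw [hp, h1] at h' ⊢
          simpa using h') (by rw [hp, h1] at hU; simpa using hU)
          (by rw [hV'] at hV; simpa using hV)
          (by rw [List.filter_append, filter_hd (fun x hx => hs x (by simp [h1, hx])), ← hR0, ← hf]; rfl)
          hR (by
            have := List.count_pos_iff.2 hc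
            have h3 : 0 < (a ++ c :: b).count c := List.count_pos_iff.2 (by simp)
            rw [List.count_append (l₁ := p)]; omega)
      rw [hp, h1]
      simpa using this
  obtain ⟨hs2, f1⟩ := f1
  have hU2 : GoodW D (s1 ++ c :: (s2 ++ q)) := by
    have h1 := hU.ins (cs := [c]) (fun x hx => by simp at hx; subst hx; exact ⟨hc, hDc⟩)
    refine h1.perm ?_
    rw [hss]
    simp only [List.append_assoc, List.cons_append, List.nil_append]
    exact List.perm_middle.append_left _
  have f2 := MR C (D := D) (c := c) (q := q) (r1 := p ++ a) (r2 := b) (R := R) hDc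
    (by rw [← hV']; exact hV) (by rw [hf, hR0]) hR (by simp [hc]) s2 s1 hcs
    (fun z hz => ⟨by simp [(hs2 z hz).1], (hs2 z hz).2⟩)
    (by rw [← hV']; exact C.hE.tr (C.hE.sy (C.le f1)) h) hU2
  refine C.hF.tr f1 (C.hF.tr f2 ?_)
  rw [hss]
  simpa using C.hF.rf _

theorem GLs {E F : List ℕ → List ℕ → Prop} (C : Ctx E F) {D : ℕ → Bool}
    {p q r : List ℕ} (h : E (p ++ q) (p ++ r)) (hU : GoodW D (p ++ q))
    (hV : ((p ++ r).filter D).Nodup) (hf : q.filter D = r.filter D) (ht : ∃ t ∈ p, D t = true) :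
    ∀ cs : List ℕ, (∀ c ∈ cs, c ∈ p ∧ c ∈ hdB D r) → F (p ++ q) (p ++ (cs ++ q)) := by
  intro cs
  induction cs with
  | nil => intro _; exact C.hF.rf _
  | cons c cs ih =>
    intro hc
    have f1 := ih (fun a ha => hc a (by simp [ha]))
    have hcs : ∀ a ∈ cs, a ∈ p ∧ D a = false := fun a ha =>
      ⟨(hc a (by simp [ha])).1, (mem_hdB (hc a (by simp [ha])).2).2⟩
    have f2 := GLem C (D := D) (c := c) (p := p) (q := cs ++ q) (r := r)
      (C.hE.tr (C.hE.sy (C.le f1)) h) (hU.ins hcs) hV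
      (by rw [List.filter_append, filter_hd (fun a ha => (hcs a ha).2), ← hf]; rfl)
      (hc c (by simp)).1 (hc c (by simp)).2 ht
    exact C.hF.tr f1 (by simpa using f2)


/-- Equality of occurrence numbers capped at two. -/
def capE (c : ℕ) (l l' : List ℕ) : Prop := min 2 (l.count c) = min 2 (l'.count c)

theorem capE.mem {c : ℕ} {l l' : List ℕ} (h : capE c l l') : c ∈ l ↔ c ∈ l' := by
  unfold capE at h
  rw [← List.count_pos_iff, ← List.count_pos_iff]; omega

theorem capE.two {c : ℕ} {l l' : List ℕ} (h : capE c l l') : 2 ≤ l.count c ↔ 2 ≤ l'.count c := by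
  unfold capE at h; omega

theorem piW_eq_nil {x y : ℕ} {w : List ℕ} (hx : x ∉ w) (hy : y ∉ w) : piW x y w = [] := by
  rw [List.eq_nil_iff_forall_not_mem]
  intro b hb
  rcases mem_piW.1 hb with ⟨h2, rfl | rfl⟩
  · exact hx h2
  · exact hy h2

theorem count_piW_x {x y : ℕ} {w : List ℕ} : (piW x y w).count x = w.count x := by
  rw [piW, List.count_filter (by simp)]

theorem count_piW_y {x y : ℕ} {w : List ℕ} : (piW x y w).count y = w.count y := by
  rw [piW, List.count_filter (by simp)]

theorem resW_filter_count {D : ℕ → Bool} {x y : ℕ} {w : List ℕ} :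
    (resW D x y w).count x = w.count x := by
  rw [resW, List.count_filter (by simp)]

theorem filter_tail {D : ℕ → Bool} {q Q : List ℕ} (hq : q = hdB D q ++ Q) : q.filter D = Q.filter D := by
  conv_lhs => rw [hq]
  simp [filter_hd (hdB_D (D := D) (q := q))]

theorem blk_tail {D : ℕ → Bool} {q Q : List ℕ} (hq : q = hdB D q ++ Q) {t : ℕ} (ht : D t = true) :
    blkW D q t = blkW D Q t := by
  conv_lhs => rw [hq]
  exact blkW_hd hdB_D ht

theorem SW {E F : List ℕ → List ℕ → Prop} (C : Ctx E F) {D : ℕ → Bool} {e a : ℕ}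
    {s q s' R0 R : List ℕ} (hea : e ≠ a) (hDe : D e = false) (hDa : D a = false)
    (hes : e ∉ s) (has : a ∉ s) (hes' : e ∉ s') (has' : a ∉ s')
    (h : E (s ++ e :: a :: q) (s' ++ a :: (R0 ++ R))) (hU : GoodW D (s ++ e :: a :: q))
    (hV : GoodW D (s' ++ a :: (R0 ++ R))) (hf : q.filter D = R.filter D)
    (hR : dst D R) (hce : capE e (e :: a :: hdB D q) (a :: R0))
    (hca : capE a (e :: a :: hdB D q) (a :: R0))
    (hb : ∀ t, D t = true → ∀ b, b ∈ blkW D q t ↔ b ∈ blkW D R t) :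
    F (s ++ e :: a :: q) (s ++ a :: e :: q) := by
  have hE := C.hE
  have hF := C.hF
  obtain ⟨Q, hq, hQ⟩ := hdB_split D q
  have hfQ : Q.filter D = R.filter D := by rw [← hf, filter_tail hq]
  have hqe : s ++ e :: a :: q = (s ++ e :: a :: hdB D q) ++ Q := by
    conv_lhs => rw [hq]
    simp
  have hVe : s' ++ a :: (R0 ++ R) = (s' ++ a :: R0) ++ R := by simp
  have hnq : (q.filter D).Nodup := by
    have := hU.1
    simp only [List.filter_append, List.filter_cons, hDe, hDa] at this
    exact this.of_append_right
  set w := piW e a (hdB D q) with hw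
  have tl := hE.TLJ (D := D) e a w (by rw [← hqe, ← hVe]; exact h) hfQ
    (by rw [← hqe]; exact hU.1) (by rw [← hVe]; exact hV.1) hQ hR
  have hw2 : ∀ b ∈ w, b = e ∨ b = a := fun b hb => (mem_piW.1 hb).2
  rw [piW_append, piW_append, piW_eq_nil hes has, piW_eq_nil hes' has', piW_x, piW_y, piW_y] at tl
  have l1 : E (e :: a :: (w ++ resW D e a Q)) (e :: a :: (w ++ (w ++ resW D e a Q))) := by
    have := hE.NF (p := [e, a]) (hh := w) (h' := w ++ w) (resW D e a Q)
      (fun b hb => by rcases hw2 b hb with rfl | rfl <;> simp) (by simp)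
    simpa using this
  have heR : e ∈ R0 := by
    have := hce.mem.1 (by simp)
    simpa [hea] using this
  have haw : 2 ≤ (a :: R0).count a → a ∈ w := by
    intro h2
    have := hca.two.2 h2
    rw [List.count_cons_of_ne hea, List.count_cons_self] at this
    exact mem_piW.2 ⟨List.count_pos_iff.1 (by omega), by simp⟩
  have hew : 2 ≤ R0.count e → e ∈ w := by
    intro h2
    have := hce.two.2 (by rw [List.count_cons_of_ne hea.symm]; exact h2)
    rw [List.count_cons_self, List.count_cons_of_ne hea.symm] at this
    exact mem_piW.2 ⟨List.count_pos_iff.1 (by omega), by simp⟩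
  obtain ⟨l, w', h1, h2⟩ := List.eq_append_cons_of_mem (mem_piW.2 ⟨heR, Or.inl rfl⟩ : e ∈ piW e a R0)
  have hR0c : ∀ b, b ∈ l ∨ b ∈ w' → b = e ∨ b = a := by
    intro b hb
    have : b ∈ piW e a R0 := by rw [h1]; simp; tauto
    exact (mem_piW.1 this).2
  have hla : ∀ b ∈ l, b = a := by
    intro b hb
    rcases hR0c b (Or.inl hb) with rfl | rfl
    · exact absurd hb h2
    · rfl
  have hlaw : ∀ b, b = a → (b ∈ l ∨ b ∈ w') → a ∈ w := by
    rintro b rfl hb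
    apply haw
    have : b ∈ R0 := by
      have : b ∈ piW e b R0 := by rw [h1]; simp; tauto
      exact (mem_piW.1 this).1
    have := List.count_pos_iff.2 this
    rw [List.count_cons_self]; omega
  have hw'w : ∀ b ∈ w', b ∈ w := by
    intro b hb
    rcases hR0c b (Or.inr hb) with rfl | rfl
    · apply hew
      have h3 := count_piW_x (x := b) (y := a) (w := R0)
      rw [h1, List.count_append, List.count_cons_self] at h3
      have := List.count_pos_iff.2 hb
      omega
    · exact hlaw b rfl (Or.inr hb)
  have he2 : 2 ≤ ([a] ++ (e :: (w' ++ w) ++ resW D e a R)).count e := by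
    have h3 := hV.2 e (by simp [heR]) hDe
    rw [List.count_append, List.count_cons_of_ne hea.symm, List.count_eq_zero.2 hes',
      List.count_append] at h3
    have h4 := count_piW_x (x := e) (y := a) (w := R0)
    rw [h1, List.count_append, List.count_cons_self, List.count_eq_zero.2 h2] at h4
    have h5 := resW_filter_count (D := D) (x := e) (y := a) (w := R)
    show 2 ≤ (a :: e :: ((w' ++ w) ++ resW D e a R)).count e
    rw [List.count_cons_of_ne hea.symm, List.count_cons_self, List.count_append, List.count_append]
    omega
  have r1 : E (a :: (e :: (w' ++ w) ++ resW D e a R))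
      (a :: (l ++ (e :: (w' ++ w) ++ resW D e a R))) := by
    have := hE.CP (p := [a]) (hh := e :: (w' ++ w)) (r := resW D e a R) (by
      intro b hb
      by_cases hbe : b = e
      · subst hbe; exact he2
      · have : b = a := by
          simp only [List.mem_cons, List.mem_append] at hb
          rcases hb with hb | hb | hb
          · exact absurd hb hbe
          · rcases hR0c b (Or.inr hb) with h | h
            · exact absurd h hbe
            · exact h
          · rcases hw2 b hb with h | h
            · exact absurd h hbe
            · exact h
        subst this
        exact count_ge_two_of (by simp) hb) l (by
      intro c hc
      have := hla c hc
      subst this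
      exact ⟨by simp, by simp [hlaw c rfl (Or.inl hc)]⟩)
    simpa using this
  have r2 : E (a :: e :: ((w' ++ w) ++ resW D e a R)) (a :: e :: (w ++ resW D e a R)) := by
    have := hE.NF (p := [a, e]) (hh := w' ++ w) (h' := w) (resW D e a R)
      (fun b hb => by
        rcases List.mem_append.1 hb with hb | hb
        · rcases hw2 b (hw'w b hb) with rfl | rfl <;> simp
        · rcases hw2 b hb with rfl | rfl <;> simp) (by intro b; simp; exact hw'w b)
    simpa using this
  have r3 : E (a :: e :: (w ++ resW D e a Q)) (a :: e :: (w ++ resW D e a R)) := by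
    have := hE.TEr (D := D) (Q := Q) (R := R) (X := a :: e :: w) (x := e) (y := a) hfQ
      (by rw [← filter_tail hq]; exact hnq) hQ hR
      (fun t ht b => by rw [← blk_tail hq ht]; exact hb t ht b) (by simp) (by simp)
    simpa using this
  have tl2 : E (e :: a :: (w ++ (w ++ resW D e a Q))) (a :: (l ++ (e :: (w' ++ w) ++ resW D e a R))) := by
    rw [h1] at tl
    simpa using tl
  have main : E (e :: a :: resW D e a q) (a :: e :: resW D e a q) := by
    rw [resW_hd hq]
    refine hE.tr l1 (hE.tr tl2 (hE.tr (hE.sy r1) (hE.tr ?_ (hE.sy r3))))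
    simpa using r2
  have no : ∀ x, D x = false → D x = true → x ∉ q := by
    intro x h1 h2; rw [h1] at h2; cases h2
  have f1 := transfer hE hF (D := D) C.t4 (by simp) (by simp) (x := e) (y := a) (Y := [a]) (p := s)
      (q := q) hea (no e hDe) (no a hDa) (fun _ => rfl) (by simp) (by simp) hnq
      (by
        intro b hb hD
        have := hU.2 b (by simp [hb]) hD
        simp [sb2, List.count_append, List.count_cons] at this ⊢; omega)
      (by
        intro b hb hD
        have := hU.2 b (by simp [hb]) hD
        simp [sb2, List.count_append, List.count_cons] at this ⊢; omega)
      (by simpa [sb2] using main)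
  simpa [sb2] using f1

theorem OThy.CC {E : List ℕ → List ℕ → Prop} (hE : OThy E) {c : ℕ} {l : List ℕ} (X : List ℕ)
    (h : ∀ b ∈ l, b = c) (h2 : 2 ≤ l.count c) : E (l ++ X) (c :: c :: X) := by
  match l, h, h2 with
  | [], _, h2 => simp at h2
  | [a], _, h2 => simp [List.count_cons] at h2; split at h2 <;> omega
  | a :: b :: m, h, _ =>
    have ha := h a (by simp)
    have hb := h b (by simp)
    subst ha hb
    have := hE.NF (p := [b]) (hh := b :: m) (h' := [b]) X (by
      intro d hd; simp; exact h d (by simp at hd ⊢; tauto)) (by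
      intro d; simp; intro hd; exact h d (by simp [hd]))
    simpa using this

theorem RS {E F : List ℕ → List ℕ → Prop} (C : Ctx E F) {D : ℕ → Bool} {c z : ℕ}
    {s q s' R0 R : List ℕ} (hcz : c ≠ z) (hDc : D c = false) (hDz : D z = false)
    (hcs : 2 ≤ s.count c) (hzs : z ∉ s) (hcs' : 2 ≤ s'.count c) (hzs' : z ∉ s')
    (hcq : c ∉ hdB D q) (hcR : c ∉ R0)
    (h : E (s ++ z :: c :: q) (s' ++ (R0 ++ R))) (hU : GoodW D (s ++ z :: c :: q))
    (hV : ((s' ++ (R0 ++ R)).filter D).Nodup) (hf : q.filter D = R.filter D)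
    (hR : dst D R) (hcap : capE z (z :: hdB D q) R0)
    (hb : ∀ t, D t = true → ∀ b, b ∈ blkW D q t ↔ b ∈ blkW D R t) :
    F (s ++ z :: c :: q) (s ++ c :: z :: q) := by
  have hE := C.hE
  have hF := C.hF
  obtain ⟨Q, hq, hQ⟩ := hdB_split D q
  have hfQ : Q.filter D = R.filter D := by rw [← hf, filter_tail hq]
  have hqe : s ++ z :: c :: q = (s ++ z :: c :: hdB D q) ++ Q := by
    conv_lhs => rw [hq]
    simp
  have hVe : s' ++ (R0 ++ R) = (s' ++ R0) ++ R := by simp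
  have hnq : (q.filter D).Nodup := by
    have := hU.1
    simp only [List.filter_append, List.filter_cons, hDc, hDz] at this
    exact this.of_append_right
  have tl := hE.TLJ (D := D) c z [] (by rw [← hqe, ← hVe]; exact h) hfQ
    (by rw [← hqe]; exact hU.1) (by rw [← hVe]; exact hV) hQ hR
  rw [piW_append, piW_append, piW_y, piW_x] at tl
  have onlyc : ∀ s : List ℕ, z ∉ s → ∀ b ∈ piW c z s, b = c := by
    intro s hs b hb
    rcases mem_piW.1 hb with ⟨h2, rfl | rfl⟩
    · rfl
    · exact absurd h2 hs
  have onlyz : ∀ s : List ℕ, c ∉ s → ∀ b ∈ piW c z s, b = z := by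
    intro s hs b hb
    rcases mem_piW.1 hb with ⟨h2, rfl | rfl⟩
    · exact absurd h2 hs
    · rfl
  have hzR : z ∈ R0 := hcap.mem.1 (by simp)
  obtain ⟨m, hm⟩ : ∃ m, piW c z R0 = z :: m := by
    cases hp : piW c z R0 with
    | nil =>
      have : z ∈ piW c z R0 := mem_piW.2 ⟨hzR, by simp⟩
      rw [hp] at this; simp at this
    | cons a m =>
      have := onlyz R0 hcR a (by rw [hp]; simp)
      exact ⟨m, by rw [this]⟩
  have hmz : ∀ b ∈ m, b = z := fun b hb => onlyz R0 hcR b (by rw [hm]; simp [hb])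
  have hmem : ∀ b, b ∈ m ↔ b ∈ piW c z (hdB D q) := by
    have h0 : z ∈ m ↔ z ∈ hdB D q := by
      have h1 := hcap.two
      rw [List.count_cons_self, ← count_piW_y (x := c) (y := z) (w := R0), hm,
        List.count_cons_self] at h1
      rw [← List.count_pos_iff, ← List.count_pos_iff]
      omega
    intro b
    constructor
    · intro hb
      have := hmz b hb
      subst this
      exact mem_piW.2 ⟨h0.1 hb, by simp⟩
    · intro hb
      have := onlyz _ hcq b hb
      subst this
      exact h0.2 (mem_piW.1 hb).1
  have c1 := hE.CC (z :: c :: (piW c z (hdB D q) ++ resW D c z Q)) (onlyc s hzs)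
    (by rw [count_piW_x]; exact hcs)
  have c2 := hE.CC (z :: (m ++ resW D c z R)) (onlyc s' hzs')
    (by rw [count_piW_x]; exact hcs')
  have c3 : E (c :: c :: z :: (m ++ resW D c z R))
      (c :: c :: z :: (piW c z (hdB D q) ++ resW D c z R)) := by
    have := hE.NF (p := [c, c, z]) (hh := m) (h' := piW c z (hdB D q)) (resW D c z R)
      (fun b hb => by simp [hmz b hb]) hmem
    simpa using this
  have c4 : E (c :: c :: z :: (piW c z (hdB D q) ++ resW D c z Q))
      (c :: c :: z :: (piW c z (hdB D q) ++ resW D c z R)) := by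
    have := hE.TEr (D := D) (Q := Q) (R := R) (X := c :: c :: z :: piW c z (hdB D q)) (x := c) (y := z)
      hfQ (by rw [← filter_tail hq]; exact hnq) hQ hR
      (fun t ht b => by rw [← blk_tail hq ht]; exact hb t ht b) (by simp) (by simp)
    simpa using this
  have tl2 : E (piW c z s ++ z :: c :: (piW c z (hdB D q) ++ resW D c z Q))
      (piW c z s' ++ z :: (m ++ resW D c z R)) := by
    rw [hm] at tl
    simpa using tl
  have main : E (c :: c :: z :: resW D c z q) (c :: c :: z :: c :: resW D c z q) := by
    rw [resW_hd hq]
    exact hE.tr c4 (hE.tr (hE.sy c3) (hE.tr (hE.sy c2) (hE.tr (hE.sy tl2) c1)))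
  have no : ∀ x, D x = false → D x = true → x ∉ q := by
    intro x h1 h2; rw [h1] at h2; cases h2
  have f1 := transfer hE hF (D := D) C.t3 (by simp) (by simp) (x := c) (y := z) (Y := [z]) (p := s)
      (q := q) hcz (no c hDc) (no z hDz) (fun _ => rfl) (by simp) (by simp) hnq
      (by
        intro b hb hD
        have := hU.2 b (by simp [hb]) hD
        simp [sb2, List.count_append, List.count_cons] at this ⊢; omega)
      (by
        intro b hb hD
        have := hU.2 b (by simp [hb]) hD
        simp [sb2, List.count_append, List.count_cons] at this ⊢; omega)
      (by simpa [sb2] using main)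
  have hcs1 : c ∈ s := List.count_pos_iff.1 (by omega)
  have hzq : z ∈ s ∨ z ∈ q := by
    rcases mem_of_count2 (hU.2 z (by simp) hDz) with h | h
    · exact Or.inl h
    · right; simpa [Ne.symm hcz] using h
  have f2 := hF.L3 (x := c) (y := z) (p := s) (q := q) hcs1 hzq
  have f3 := hF.dup (x := c) (p := s) (z :: c :: q) hcs1
  have f4 := hF.dup (x := c) (p := s) (z :: q) hcs1
  refine hF.tr f2 (hF.tr f3 (hF.tr ?_ (hF.sy f4)))
  exact hF.sy (by simpa [sb2] using f1)


theorem capE.perm {c : ℕ} {l l' m : List ℕ} (h : capE c l m) (hp : l.Perm l') : capE c l' m := by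
  unfold capE at h ⊢; rw [← hp.count_eq]; exact h

theorem RLmove {E F : List ℕ → List ℕ → Prop} (C : Ctx E F) {D : ℕ → Bool} {c : ℕ}
    {p R0 R : List ℕ} (hDc : D c = false) (hcp : 2 ≤ p.count c) (hcR : c ∉ R0)
    (hV : ((p ++ (R0 ++ R)).filter D).Nodup) (hR : dst D R) :
    ∀ s q : List ℕ, (∀ z ∈ s, D z = false) → c ∉ s → c ∉ hdB D q → q.filter D = R.filter D →
    (∀ z, z ∉ p → capE z (s ++ hdB D q) R0) →
    (∀ t, D t = true → ∀ b, b ∈ blkW D q t ↔ b ∈ blkW D R t) →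
    E (p ++ (s ++ c :: q)) (p ++ (R0 ++ R)) → GoodW D (p ++ (s ++ c :: q)) →
    F (p ++ (s ++ c :: q)) (p ++ c :: (s ++ q)) := by
  intro s
  induction s using List.reverseRecOn with
  | nil => intros; exact C.hF.rf _
  | append_singleton s z ih =>
    intro q hs hcs hcq hf hcap hb h hU
    have hcp1 : c ∈ p := List.count_pos_iff.1 (by omega)
    have hDz : D z = false := hs z (by simp)
    have hcz : c ≠ z := fun e => hcs (by simp [e])
    have f1 : F ((p ++ s) ++ z :: c :: q) ((p ++ s) ++ c :: z :: q) := by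
      by_cases hz : z ∈ p ++ s
      · exact C.hF.swp _ hz (by simp [hcp1])
      · simp only [List.mem_append, not_or] at hz
        refine RS C (s' := p) (R0 := R0) (R := R) hcz hDc hDz (by rw [List.count_append]; omega)
          (by simp [hz]) hcp hz.1 hcq hcR (by simpa using h) (by simpa using hU) hV hf hR ?_ hb
        have := hcap z hz.1
        unfold capE at this ⊢
        rw [← this]
        simp [List.count_append, List.count_eq_zero.2 hz.2]
    have f1' : F (p ++ ((s ++ [z]) ++ c :: q)) (p ++ (s ++ c :: (z :: q))) := by simpa using f1
    have f2 := ih (z :: q) (fun y hy => hs y (by simp [hy]))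
      (fun hc => hcs (by simp [hc])) (by
        rw [hdB_cons_N hDz]; simp [hcz, hcq]) (by simpa [hDz] using hf)
      (fun y hy => by rw [hdB_cons_N hDz]; simpa using hcap y hy)
      (fun t ht b => by
        have := blkW_hd (D := D) (h := [z]) (q := q) (by simp [hDz]) ht
        simp only [List.singleton_append] at this
        rw [this]; exact hb t ht b)
      (C.hE.tr (C.hE.sy (C.le f1')) h)
      (hU.perm (by
        simp only [List.append_assoc, List.singleton_append]
        exact (List.Perm.refl _).append ((List.Perm.refl _).append (List.Perm.swap _ _ _))))
    exact C.hF.tr f1' (by simpa using f2)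

theorem RLs {E F : List ℕ → List ℕ → Prop} (C : Ctx E F) {D : ℕ → Bool}
    {p h R0 R Q : List ℕ} (hh : ∀ b ∈ h, b ∈ p) (hDh : ∀ b ∈ h, D b = false)
    (hcR : ∀ b ∈ h, b ∉ R0) (hV : (((p ++ h) ++ (R0 ++ R)).filter D).Nodup)
    (hf : Q.filter D = R.filter D) (hQ : dst D Q) (hR : dst D R)
    (hb : ∀ t, D t = true → ∀ b, b ∈ blkW D Q t ↔ b ∈ blkW D R t) :
    ∀ (n : ℕ) (H : List ℕ), H.length ≤ n → (∀ b ∈ H, D b = false) →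
    (∀ z, z ∉ p ++ h → capE z H R0) →
    E ((p ++ h) ++ (H ++ Q)) ((p ++ h) ++ (R0 ++ R)) → GoodW D ((p ++ h) ++ (H ++ Q)) →
    F ((p ++ h) ++ (H ++ Q)) ((p ++ h) ++ (H.filter (fun b => decide (b ∉ h)) ++ Q)) := by
  intro n
  induction n with
  | zero =>
    intro H hn _ _ _ _
    have : H = [] := List.length_eq_zero_iff.1 (by omega)
    subst this; exact C.hF.rf _
  | succ n ih =>
    intro H hn hHD hcap hE hU
    by_cases hex : ∃ c ∈ H, c ∈ h
    · obtain ⟨c, hcH, hch⟩ := hex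
      obtain ⟨s1, s2, rfl, hs1⟩ := List.eq_append_cons_of_mem hcH
      have hDc := hDh c hch
      have hcc : 2 ≤ (p ++ h).count c := by
        simpa using count_ge_two_of (hh := h) (r := []) (hh c hch) hch
      have hD2 : ∀ b ∈ s2, D b = false := fun b hb => hHD b (by simp [hb])
      have hhd : hdB D (s2 ++ Q) = s2 := by rw [hdB_append hD2, hdB_dst hQ, List.append_nil]
      have step : F ((p ++ h) ++ ((s1 ++ c :: s2) ++ Q)) ((p ++ h) ++ ((s1 ++ s2) ++ Q)) := by
        by_cases hc2 : c ∈ s2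
        · obtain ⟨w, x, rfl⟩ := List.append_of_mem hc2
          have hU' : GoodW D ((p ++ h) ++ ((s1 ++ (w ++ c :: x)) ++ Q)) := by
            have := hU
            rw [List.append_assoc s1] at this
            simpa using this.del hcc hDc
          have := C.hF.L4 (x := c) (x ++ Q) w ((p ++ h) ++ s1) (by simp [hch]) (by
            intro b hb
            have := hU'.2 b (by simp [hb]) (hD2 b (by simp [hb]))
            simpa using this)
          exact C.hF.sy (by simpa using this)
        · have f1 := RLmove C (R0 := R0) (R := R) hDc hcc (hcR c hch) hV hR s1 (s2 ++ Q)
            (fun z hz => hHD z (by simp [hz])) hs1 (by rw [hhd]; exact hc2)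
            (by rw [List.filter_append, filter_hd hD2]; exact hf)
            (fun z hz => by
              rw [hhd]
              have := hcap z hz
              unfold capE at this ⊢
              rw [← this]
              have hzc : c ≠ z := fun e => hz (by simp [← e, hch])
              rw [List.count_append, List.count_append, List.count_cons_of_ne hzc])
            (fun t ht b => by rw [blkW_hd hD2 ht]; exact hb t ht b)
            (by simpa using hE) (by simpa using hU)
          have f2 := C.hF.NF (p := p) (hh := h ++ [c]) (h' := h) (s1 ++ (s2 ++ Q)) (by
            intro b hb
            simp only [List.mem_append, List.mem_singleton] at hb
            rcases hb with hb | rfl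
            · exact hh b hb
            · exact hh b hch) (by
            intro b; simp only [List.mem_append, List.mem_singleton]
            constructor
            · rintro (hb | rfl)
              · exact hb
              · exact hch
            · exact Or.inl)
          exact C.hF.tr (by simpa using f1) (by simpa using f2)
      have f3 := ih (s1 ++ s2) (by simp at hn ⊢; omega)
        (fun b hb => hHD b (by simp at hb ⊢; tauto))
        (fun z hz => by
          have := hcap z hz
          unfold capE at this ⊢
          rw [← this]
          have hzc : c ≠ z := fun e => hz (by simp [← e, hch])
          rw [List.count_append, List.count_append, List.count_cons_of_ne hzc])
        (C.hE.tr (C.hE.sy (C.le step)) hE) (by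
          have := hU
          rw [List.append_assoc s1] at this
          simpa using this.del hcc hDc)
      refine C.hF.tr step ?_
      have e : (s1 ++ c :: s2).filter (fun b => decide (b ∉ h)) =
          (s1 ++ s2).filter (fun b => decide (b ∉ h)) := by simp [hch]
      rw [e]; exact f3
    · have : H.filter (fun b => decide (b ∉ h)) = H := by
        rw [List.filter_eq_self]
        intro b hb
        simp only [decide_eq_true_eq]
        exact fun hbh => hex ⟨b, hb, hbh⟩
      rw [this]; exact C.hF.rf _

theorem ML {E F : List ℕ → List ℕ → Prop} (C : Ctx E F) {D : ℕ → Bool} {a : ℕ}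
    {p R0 R : List ℕ} (hDa : D a = false) (hap : a ∉ p)
    (hV : GoodW D (p ++ a :: (R0 ++ R))) (hR : dst D R) :
    ∀ s q : List ℕ, (∀ z ∈ s, D z = false) → a ∉ s → q.filter D = R.filter D →
    (∀ e ∈ s, e ∈ p → e ∈ R0) →
    (∀ z, z ∉ p → capE z (s ++ a :: hdB D q) (a :: R0)) →
    (∀ t, D t = true → ∀ b, b ∈ blkW D q t ↔ b ∈ blkW D R t) →
    E (p ++ (s ++ a :: q)) (p ++ a :: (R0 ++ R)) → GoodW D (p ++ (s ++ a :: q)) →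
    F (p ++ (s ++ a :: q)) (p ++ a :: (s ++ q)) := by
  intro s
  induction s using List.reverseRecOn with
  | nil => intros; exact C.hF.rf _
  | append_singleton s e ih =>
    intro q hs has hf hep hcap hb h hU
    have hDe : D e = false := hs e (by simp)
    have hea : e ≠ a := fun h => has (by simp [h])
    have has' : a ∉ s := fun h => has (by simp [h])
    have h' : E ((p ++ s) ++ e :: a :: q) (p ++ a :: (R0 ++ R)) := by simpa using h
    have hU' : GoodW D ((p ++ s) ++ e :: a :: q) := by simpa using hU
    have f1 : F ((p ++ s) ++ e :: a :: q) ((p ++ s) ++ a :: e :: q) := by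
      by_cases hz : e ∈ p ++ s
      · obtain ⟨r1, r2, hr, her, har⟩ : ∃ r1 r2, p ++ a :: R0 = r1 ++ e :: r2 ∧ e ∈ r1 ∧ a ∈ r1 := by
          by_cases hep' : e ∈ p
          · obtain ⟨x, y, hxy⟩ := List.append_of_mem (hep e (by simp) hep')
            exact ⟨p ++ a :: x, y, by rw [hxy]; simp, by simp [hep'], by simp⟩
          · have hes : e ∈ s := by simpa [hep'] using hz
            have h2 := (hcap e hep').two.1 (by
              have := List.count_pos_iff.2 hes
              simp [List.count_append]; omega)
            rw [List.count_cons_of_ne hea.symm] at h2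
            obtain ⟨x, y, hxy, hx⟩ := List.eq_append_cons_of_mem
              (List.count_pos_iff.1 (by omega : 0 < R0.count e))
            rw [hxy, List.count_append, List.count_cons_self, List.count_eq_zero.2 hx] at h2
            obtain ⟨y1, y2, hy⟩ := List.append_of_mem
              (List.count_pos_iff.1 (by omega : 0 < y.count e))
            exact ⟨p ++ a :: x ++ e :: y1, y2, by rw [hxy, hy]; simp, by simp, by simp⟩
        have hVe : p ++ a :: (R0 ++ R) = r1 ++ e :: (r2 ++ R) := by
          have := congrArg (· ++ R) hr
          simpa using this
        have haq : a ∈ q := by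
          rcases mem_of_count2 (s := p ++ s ++ [e]) (X := q) (by
            have := hU'.2 a (by simp) hDa
            simpa using this) with h | h
          · simp [hap, has', hea.symm] at h
          · exact h
        have g1 := TX C (c := e) (y := a) (s := p ++ s) (Y := [a]) (q := q) (r1 := r1) (r2 := r2)
          (R := R) (D := D) hea hDe (by simp [hap, has']) (by simp [piW]) (fun _ => rfl)
          (by rw [← hVe]; exact h') hU' (by rw [← hVe]; exact hV.1) hf hR her har
        have g2 := C.hF.L3 (x := e) (y := a) (p := p ++ s) (q := q) hz (Or.inr haq)
        exact C.hF.tr g1 (C.hF.sy g2)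
      · simp only [List.mem_append, not_or] at hz
        refine SW C (s' := p) (R0 := R0) (R := R) hea hDe hDa (by simp [hz]) (by simp [hap, has'])
          hz.1 hap h' hU' hV hf hR ?_ ?_ hb
        · have := hcap e hz.1
          unfold capE at this ⊢
          rw [← this]
          simp [List.count_append, List.count_eq_zero.2 hz.2]
        · have := hcap a hap
          unfold capE at this ⊢
          rw [← this]
          simp [List.count_append, List.count_eq_zero.2 has']
    have f1' : F (p ++ ((s ++ [e]) ++ a :: q)) (p ++ (s ++ a :: (e :: q))) := by simpa using f1
    have f2 := ih (e :: q) (fun y hy => hs y (by simp [hy])) has' (by simpa [hDe] using hf)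
      (fun y hy => hep y (by simp [hy]))
      (fun y hy => by
        rw [hdB_cons_N hDe]
        refine (hcap y hy).perm ?_
        simp only [List.append_assoc, List.singleton_append]
        exact (List.Perm.refl _).append (List.Perm.swap _ _ _))
      (fun t ht b => by
        have := blkW_hd (D := D) (h := [e]) (q := q) (by simp [hDe]) ht
        simp only [List.singleton_append] at this
        rw [this]; exact hb t ht b)
      (C.hE.tr (C.hE.sy (C.le f1')) h)
      (hU.perm (by
        simp only [List.append_assoc, List.singleton_append]
        exact (List.Perm.refl _).append ((List.Perm.refl _).append (List.Perm.swap _ _ _))))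
    exact C.hF.tr f1' (by simpa using f2)


theorem aftW_t {D : ℕ → Bool} {t : ℕ} {h Q : List ℕ} (hh : ∀ a ∈ h, D a = false) (ht : D t = true) :
    aftW t (h ++ t :: Q) = Q := by
  rw [aftW_append, aftW_cons_self]
  intro hm; rw [hh t hm] at ht; cases ht

/-- The invariant of the scanning procedure. -/
structure ScanInv (E : List ℕ → List ℕ → Prop) (D : ℕ → Bool) (p q r : List ℕ) : Prop where
  ht : ∃ t ∈ p, D t = true
  h : E (p ++ q) (p ++ r)
  hU : GoodW D (p ++ q)
  hV : GoodW D (p ++ r)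
  hf : q.filter D = r.filter D
  cF : ∀ c, c ∉ p → capE c (hdB D q) (hdB D r)
  cB : ∀ t, D t = true → ∀ c, capE c (blkW D q t) (blkW D r t)

theorem first_notMem {p : List ℕ} : ∀ l : List ℕ, ¬ (∀ c ∈ l, c ∈ p) →
    ∃ g a l1, l = g ++ a :: l1 ∧ (∀ c ∈ g, c ∈ p) ∧ a ∉ p := by
  intro l
  induction l with
  | nil => intro h; simp at h
  | cons b l ih =>
    intro h
    by_cases hb : b ∈ p
    · obtain ⟨g, a, l1, e, hg, ha⟩ := ih (fun h' => h (by
        intro c hc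
        rcases List.mem_cons.1 hc with rfl | hc
        · exact hb
        · exact h' c hc))
      refine ⟨b :: g, a, l1, by rw [e]; rfl, ?_, ha⟩
      intro c hc
      rcases List.mem_cons.1 hc with rfl | hc
      · exact hb
      · exact hg c hc
    · exact ⟨[], b, l, rfl, by simp, hb⟩

theorem Scan {E F : List ℕ → List ℕ → Prop} (C : Ctx E F) {D : ℕ → Bool} :
    ∀ (n : ℕ) (p q r : List ℕ), q.length < n → ScanInv E D p q r → F (p ++ q) (p ++ r) := by
  intro n
  induction n with
  | zero =>
    intro p q r hn I
    omega
  | succ n ih =>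
    intro p q r hn I
    by_cases hA : ∀ c ∈ hdB D r, c ∈ p
    · have hA' : ∀ c ∈ hdB D q, c ∈ p := by
        intro c hc
        by_contra hcp
        exact hcp (hA c ((I.cF c hcp).mem.1 hc))
      have f1 := GLs C I.h I.hU I.hV.1 I.hf I.ht (hdB D r) (fun c hc => ⟨hA c hc, hc⟩)
      have f2 := GLs C (C.hE.sy I.h) I.hV I.hU.1 I.hf.symm I.ht (hdB D q) (fun c hc => ⟨hA' c hc, hc⟩)
      have f3 : ∀ R, F (p ++ ((hdB D q ++ hdB D r) ++ R)) (p ++ ((hdB D r ++ hdB D q) ++ R)) := by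
        intro R
        refine C.hF.NF R ?_ ?_
        · intro b hb
          rcases List.mem_append.1 hb with hb | hb
          · exact hA' b hb
          · exact hA b hb
        · intro b; simp [or_comm]
      rcases split_two I.hf with ⟨e1, e2⟩ | ⟨t, Q, R, hDt, e1, e2, hf⟩
      · rw [← e1, ← e2] at f3
        rw [← e2] at f1
        rw [← e1] at f2
        have := f3 []
        simp only [List.append_nil] at this
        exact C.hF.tr f1 (C.hF.sy (C.hF.tr f2 this))
      · set g := hdB D r ++ hdB D q with hg
        have hgD : ∀ c ∈ g, c ∈ p ∧ D c = false := by
          intro c hc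
          rcases List.mem_append.1 hc with hc | hc
          · exact ⟨hA c hc, hdB_D c hc⟩
          · exact ⟨hA' c hc, hdB_D c hc⟩
        have e : p ++ (hdB D r ++ q) = (p ++ (g ++ [t])) ++ Q := by
          conv_lhs => rw [e1]
          simp [hg]
        have e' : p ++ (hdB D q ++ r) = p ++ ((hdB D q ++ hdB D r) ++ (t :: R)) := by
          conv_lhs => rw [e2]
          simp
        have f1' : F (p ++ q) ((p ++ (g ++ [t])) ++ Q) := by
          rw [← e]; exact f1
        have f2' : F (p ++ r) ((p ++ (g ++ [t])) ++ R) := by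
          have := f3 (t :: R)
          rw [← e'] at this
          exact C.hF.tr f2 (by simpa [hg] using this)
        have hnq : t ∉ Q := by
          intro hm
          refine nodup_D (P := p ++ (hdB D q ++ [t])) (Q := Q) (a := t) (D := D) ?_ (by simp) hDt hm
          have := I.hU.1
          rw [e1] at this
          simpa using this
        have hnr : t ∉ R := fun hm => hnq ((filter_mem_iff hf hDt).2 hm)
        have bq : blkW D q t = hdB D Q := by
          unfold blkW; rw [e1, aftW_t hdB_D hDt]
        have br : blkW D r t = hdB D R := by
          unfold blkW; rw [e2, aftW_t hdB_D hDt]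
        have bq' : ∀ t', D t' = true → t ≠ t' → blkW D q t' = blkW D Q t' := by
          intro t' h1 h2
          rw [e1, blkW_hd hdB_D h1]; unfold blkW; rw [aftW_cons_ne h2]
        have br' : ∀ t', D t' = true → t ≠ t' → blkW D r t' = blkW D R t' := by
          intro t' h1 h2
          rw [e2, blkW_hd hdB_D h1]; unfold blkW; rw [aftW_cons_ne h2]
        have f4 := ih (p ++ (g ++ [t])) Q R (by
          have := congrArg List.length e1
          simp at this; omega)
          { ht := ⟨t, by simp, hDt⟩
            h := C.hE.tr (C.hE.sy (C.le f1')) (C.hE.tr I.h (C.le f2'))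
            hU := by
              rw [← e]; exact I.hU.ins (fun c hc => ⟨hA c hc, hdB_D c hc⟩)
            hV := by
              have := I.hV.ins (fun c hc => ⟨hA' c hc, hdB_D c hc⟩)
              rw [e'] at this
              refine this.perm ?_
              simp only [hg, List.append_assoc, List.singleton_append]
              refine (List.Perm.refl _).append ?_
              rw [← List.append_assoc, ← List.append_assoc]
              exact List.perm_append_comm.append (List.Perm.refl _)
            hf := hf
            cF := fun c _ => by rw [← bq, ← br]; exact I.cB t hDt c
            cB := fun t' ht' c => by
              by_cases e : t = t'
              · subst e
                unfold blkW
                rw [aftW_notMem hnq, aftW_notMem hnr]; rfl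
              · rw [← bq' t' ht' e, ← br' t' ht' e]; exact I.cB t' ht' c }
        exact C.hF.tr f1' (C.hF.tr f4 (C.hF.sy f2'))
    · obtain ⟨g, a, l, hr, hg, hap⟩ := first_notMem _ hA
      obtain ⟨R, hrR, hR⟩ := hdB_split D r
      obtain ⟨Q, hqQ, hQ⟩ := hdB_split D q
      have hrD : ∀ c ∈ hdB D r, D c = false := hdB_D
      have hgD : ∀ c ∈ g, D c = false := fun c hc => hrD c (by rw [hr]; simp [hc])
      have hDa : D a = false := hrD a (by rw [hr]; simp)
      have hlD : ∀ c ∈ l, D c = false := fun c hc => hrD c (by rw [hr]; simp [hc])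
      have hr' : r = g ++ a :: (l ++ R) := by
        conv_lhs => rw [hrR, hr]
        simp
      have hfQ : Q.filter D = R.filter D := by
        rw [← filter_tail hqQ, ← filter_tail hrR]; exact I.hf
      have bq : ∀ t, D t = true → blkW D q t = blkW D Q t := fun t ht => blk_tail hqQ ht
      have br : ∀ t, D t = true → blkW D r t = blkW D R t := fun t ht => blk_tail hrR ht
      -- insert `g` on the left-hand side
      have f1 := GLs C I.h I.hU I.hV.1 I.hf I.ht g (fun c hc => ⟨hg c hc, by rw [hr]; simp [hc]⟩)
      set p1 := p ++ g with hp1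
      have mp1 : ∀ c, c ∈ p1 ↔ c ∈ p := by
        intro c; simp only [hp1, List.mem_append]
        exact ⟨fun h => h.elim id (hg c), Or.inl⟩
      have eV : p ++ r = p1 ++ (a :: (l ++ R)) := by rw [hr', hp1]; simp
      have eU : p ++ (g ++ q) = p1 ++ q := by simp [hp1]
      have hU1 : GoodW D (p1 ++ q) := by
        rw [← eU]; exact I.hU.ins (fun c hc => ⟨hg c hc, hgD c hc⟩)
      have hV1 : GoodW D (p1 ++ (a :: (l ++ R))) := by rw [← eV]; exact I.hV
      rw [eU] at f1
      have h1 : E (p1 ++ q) (p1 ++ (a :: (l ++ R))) := by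
        rw [← eV]; exact C.hE.tr (C.hE.sy (C.le f1)) I.h
      have ht1 : ∃ t ∈ p1, D t = true := by
        obtain ⟨t, h1, h2⟩ := I.ht
        exact ⟨t, (mp1 t).2 h1, h2⟩
      have hf1 : q.filter D = (a :: (l ++ R)).filter D := by
        rw [filter_tail hqQ, hfQ]
        simp [hDa, filter_hd hlD]
      -- the letters that must leave the block
      set h := (hdB D q).filter (fun c => decide (c ∈ p1 ∧ c ∉ l)) with hh
      have mh : ∀ c, c ∈ h ↔ c ∈ hdB D q ∧ c ∈ p1 ∧ c ∉ l := by intro c; simp [hh]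
      have hhp : ∀ c ∈ h, c ∈ p1 ∧ D c = false := fun c hc =>
        ⟨((mh c).1 hc).2.1, hdB_D c ((mh c).1 hc).1⟩
      have f2 := GLs C (C.hE.sy h1) hV1 hU1.1 hf1.symm ht1 h
        (fun c hc => ⟨(hhp c hc).1, ((mh c).1 hc).1⟩)
      have f3 : F (p1 ++ q) (p1 ++ (h ++ q)) := by
        have := C.hF.CP (p := p1) (hh := hdB D q) (r := Q) (by
          intro b hb
          rw [← hqQ]
          exact hU1.2 b (by simp [(mem_hdB hb).1]) (hdB_D b hb)) h
          (fun c hc => ⟨(hhp c hc).1, ((mh c).1 hc).1⟩)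
        rwa [← hqQ] at this
      have hU2 := hU1.ins hhp
      have hV2 := hV1.ins hhp
      have h2 : E (p1 ++ (h ++ q)) (p1 ++ (h ++ (a :: (l ++ R)))) :=
        C.hE.tr (C.hE.sy (C.le f3)) (C.hE.tr h1 (C.le f2))
      set p2 := p1 ++ h with hp2
      have mp2 : ∀ c, c ∈ p2 ↔ c ∈ p := by
        intro c; rw [hp2, List.mem_append, ← mp1 c]
        exact ⟨fun h => h.elim id (fun h => (hhp c h).1), Or.inl⟩
      have eV2 : p1 ++ (h ++ (a :: (l ++ R))) = p2 ++ ((a :: l) ++ R) := by simp [hp2]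
      have eU2 : p1 ++ (h ++ q) = p2 ++ (hdB D q ++ Q) := by rw [← hqQ]; simp [hp2]
      rw [eV2] at h2 hV2 f2
      rw [eU2] at h2 hU2 f3
      have hb : ∀ t, D t = true → ∀ b, b ∈ blkW D Q t ↔ b ∈ blkW D R t := by
        intro t ht b
        rw [← bq t ht, ← br t ht]; exact (I.cB t ht b).mem
      have hcap : ∀ z, z ∉ p → capE z (hdB D q) (a :: l) := by
        intro z hz
        have := I.cF z hz
        rw [hr] at this
        unfold capE at this ⊢
        rw [this, List.count_append, List.count_eq_zero.2 (fun h => hz (hg z h)), Nat.zero_add]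
      have f4 := RLs C (p := p1) (h := h) (R0 := a :: l) (R := R) (Q := Q) (D := D)
        (fun b hb => (hhp b hb).1) (fun b hb => (hhp b hb).2) (by
          intro b hb
          have := ((mh b).1 hb).2
          simp only [List.mem_cons, not_or]
          exact ⟨fun e => hap (e ▸ (mp1 b).1 this.1), this.2⟩) hV2.1 hfQ hQ hR hb _ (hdB D q) le_rfl
        hdB_D (fun z hz => hcap z (fun h => hz ((mp2 z).2 h))) h2 hU2
      set H := (hdB D q).filter (fun b => decide (b ∉ h)) with hH
      have mH : ∀ c, c ∈ H ↔ c ∈ hdB D q ∧ c ∉ h := by intro c; simp [hH]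
      have hcH : ∀ z, z ∉ h → H.count z = (hdB D q).count z := by
        intro z hz; rw [hH, List.count_filter (by simpa using hz)]
      have hap2 : a ∉ p2 := fun h => hap ((mp2 a).1 h)
      have hnp2 : ∀ z, z ∉ p2 → z ∉ h := fun z hz hzh => hz (by simp [hp2, hzh])
      have haH : a ∈ H := (mH a).2 ⟨(hcap a hap).mem.2 (by simp), hnp2 a hap2⟩
      obtain ⟨s1, s2, hs, has⟩ := List.eq_append_cons_of_mem haH
      have hHD : ∀ c ∈ H, D c = false := fun c hc => hdB_D c ((mH c).1 hc).1
      have hD2 : ∀ c ∈ s2, D c = false := fun c hc => hHD c (by rw [hs]; simp [hc])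
      have hD1 : ∀ c ∈ s1, D c = false := fun c hc => hHD c (by rw [hs]; simp [hc])
      have hhd : hdB D (s2 ++ Q) = s2 := by rw [hdB_append hD2, hdB_dst hQ, List.append_nil]
      have hU3 : GoodW D (p2 ++ (H ++ Q)) := by
        refine ⟨?_, fun b hb hDb => ?_⟩
        · have := hU2.1
          simpa [filter_hd hHD, filter_hd (hdB_D (D := D) (q := q))] using this
        · by_cases hbh : b ∈ h
          · have := count_ge_two_of (r := H ++ Q) (hhp b hbh).1 hbh
            simpa [hp2] using this
          · have := hU2.2 b (by
              simp only [List.mem_append, mH] at hb ⊢; tauto) hDb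
            simp only [List.count_append] at this ⊢
            rw [hcH b hbh]; exact this
      have h3 : E (p2 ++ (H ++ Q)) (p2 ++ ((a :: l) ++ R)) := C.hE.tr (C.hE.sy (C.le f4)) h2
      have eU3 : p2 ++ (H ++ Q) = p2 ++ (s1 ++ a :: (s2 ++ Q)) := by rw [hs]; simp
      rw [eU3] at h3 hU3 f4
      have f5 := ML C (R0 := l) (R := R) (p := p2) (D := D) hDa hap2 hV2 hR s1 (s2 ++ Q) hD1 has
        (by rw [List.filter_append, filter_hd hD2]; exact hfQ)
        (by
          intro e he hep
          have := (mH e).1 (by rw [hs]; simp [he])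
          by_contra hel
          exact this.2 ((mh e).2 ⟨this.1, (mp1 e).2 ((mp2 e).1 hep), hel⟩))
        (by
          intro z hz
          rw [hhd, ← hs]
          have := hcap z (fun h => hz ((mp2 z).2 h))
          unfold capE at this ⊢
          rw [hcH z (hnp2 z hz)]; exact this)
        (fun t ht b => by rw [blkW_hd hD2 ht]; exact hb t ht b) h3 hU3
      have f6 : F (p ++ q) ((p2 ++ [a]) ++ (s1 ++ (s2 ++ Q))) := by
        refine C.hF.tr f1 (C.hF.tr f3 (C.hF.tr f4 ?_))
        simpa using f5
      have f7 : F (p ++ r) ((p2 ++ [a]) ++ (l ++ R)) := by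
        rw [eV]; simpa using f2
      have hhd2 : hdB D (s1 ++ (s2 ++ Q)) = s1 ++ s2 := by rw [hdB_append hD1, hhd]
      have hhdl : hdB D (l ++ R) = l := by rw [hdB_append hlD, hdB_dst hR, List.append_nil]
      have f8 := ih (p2 ++ [a]) (s1 ++ (s2 ++ Q)) (l ++ R) (by
        have e1 := congrArg List.length hqQ
        have e2 := congrArg List.length hs
        have e3 : H.length ≤ (hdB D q).length := List.length_filter_le _ _
        simp at e1 e2 ⊢; omega)
        { ht := by
            obtain ⟨t, h1, h2⟩ := I.ht
            exact ⟨t, by simp [(mp2 t).2 h1], h2⟩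
          h := C.hE.tr (C.hE.sy (C.le f6)) (C.hE.tr I.h (C.le f7))
          hU := by
            refine hU3.perm ?_
            simp only [List.append_assoc, List.singleton_append]
            exact (List.Perm.refl _).append List.perm_middle
          hV := by simpa using hV2
          hf := by
            rw [List.filter_append, List.filter_append, List.filter_append, filter_hd hD1,
              filter_hd hD2, filter_hd hlD]; simpa using hfQ
          cF := by
            intro z hz
            simp only [List.mem_append, List.mem_singleton, not_or] at hz
            have := hcap z (fun h => hz.1 ((mp2 z).2 h))
            unfold capE at this ⊢
            rw [hhd2, hhdl]
            rw [← hcH z (hnp2 z hz.1), hs, List.count_append,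
              List.count_cons_of_ne (Ne.symm hz.2), List.count_cons_of_ne (Ne.symm hz.2)] at this
            rw [List.count_append]; exact this
          cB := by
            intro t ht c
            rw [blkW_hd hD1 ht, blkW_hd hD2 ht, blkW_hd hlD ht, ← bq t ht, ← br t ht]
            exact I.cB t ht c }
      exact C.hF.tr f6 (C.hF.tr f8 (C.hF.sy f7))


theorem Thy.pi2 {E : List ℕ → List ℕ → Prop} (hE : Thy E) {U V : List ℕ} (x y : ℕ) (h : E U V) :
    E (piW x y U) (piW x y V) := by
  have := hE.sub (fun a => if (a == x || a == y) then [a] else []) h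
  rwa [flatMap_filter_of (fun a _ => rfl), flatMap_filter_of (fun a _ => rfl)] at this

theorem OThy.del_pre {E : List ℕ → List ℕ → Prop} (hE : OThy E) {c t : ℕ}
    {l1 l2 l3 : List ℕ} (h : E (l1 ++ t :: l2) (t :: l3)) (h1 : ∀ b ∈ l1, b = c) (h2 : ∀ b ∈ l2, b = c)
    (h3 : ∀ b ∈ l3, b = c) (hc : c ∈ l1) (hc3 : c ∈ l3) : E (l1 ++ [t, c]) [t, c, c] := by
  have a1 := hE.NF (p := l1 ++ [t]) (hh := l2 ++ [c]) (h' := [c]) [] (by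
    intro b hb
    simp only [List.mem_append, List.mem_singleton] at hb
    have : b = c := hb.elim (h2 b) id
    subst this; simp [hc]) (by
    intro b; simp only [List.mem_append, List.mem_singleton]
    exact ⟨fun hb => hb.elim (h2 b) id, Or.inr⟩)
  have a2 := hE.mul h (hE.rf [c])
  have a3 := hE.CC (c := c) (l := l3 ++ [c]) [] (by
    intro b; simp only [List.mem_append, List.mem_singleton]
    exact fun hb => hb.elim (h3 b) id) (by
    have := List.count_pos_iff.2 hc3
    rw [List.count_append]; simp; omega)
  have a4 := hE.pre [t] a3
  refine hE.tr ?_ (hE.tr (a := l1 ++ (t :: (l2 ++ [c]))) ?_ (by simpa using a4))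
  · exact hE.sy (by simpa using a1)
  · simpa using a2

theorem single_of {c : ℕ} {l : List ℕ} (h1 : ∀ b ∈ l, b = c) (hc : c ∈ l) (h : ¬ 2 ≤ l.count c) :
    l = [c] := by
  have := List.eq_replicate_of_mem h1
  rw [this, List.count_replicate_self] at h
  rcases hl : l.length with _ | _ | n
  · rw [List.length_eq_zero_iff] at hl; subst hl; simp at hc
  · rw [this, hl]; rfl
  · omega

theorem Thy.ren {E : List ℕ → List ℕ → Prop} (hE : Thy E) {c t : ℕ} (_ : c ≠ t) {a b : List ℕ} (h : E a b) :
    E (a.flatMap (fun n => if n = c then [0] else [1])) (b.flatMap (fun n => if n = c then [0] else [1])) :=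
  hE.sub _ h

theorem OThy.delta_of {E : List ℕ → List ℕ → Prop} (hE : OThy E) {c t : ℕ} (hct : c ≠ t)
    {l1 : List ℕ} (h : E (l1 ++ [t, c]) [t, c, c]) (h1 : ∀ b ∈ l1, b = c) (hc : c ∈ l1) :
    E [0,0,1,0] [1,0,0] := by
  have key : E [c,c,t,c] [t,c,c] := by
    by_cases h2 : 2 ≤ l1.count c
    · exact hE.tr (hE.sy (hE.CC [t,c] h1 h2)) h
    · have := single_of h1 hc h2
      subst this
      have a1 := hE.pre [c] h
      have a2 := hE.dup (x := c) (p := [c,t]) [] (by simp)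
      exact hE.tr a1 (hE.tr (hE.sy a2) h)
  have := hE.ren hct key
  simpa [hct.symm] using this

theorem OThy.theta_one {E : List ℕ → List ℕ → Prop} (hE : OThy E) {c t : ℕ} (hct : c ≠ t)
    (h : E [c, t, c] [t, c, c]) : E [0,1,0] [0,0,1,0] := by
  have h2 := hE.delta_of (l1 := [c]) hct h (by simp) (by simp)
  have := hE.ren hct h
  have h3 : E [0,1,0] [1,0,0] := by simpa [hct.symm] using this
  exact hE.tr h3 (hE.sy h2)

theorem OThy.theta_two {E : List ℕ → List ℕ → Prop} (hE : OThy E) {c t : ℕ} (hct : c ≠ t)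
    {l1 l2 l3 : List ℕ} (h : E (l1 ++ t :: l2) (c :: t :: l3)) (h1 : ∀ b ∈ l1, b = c)
    (h2 : ∀ b ∈ l2, b = c) (h3 : ∀ b ∈ l3, b = c) (hc : 2 ≤ l1.count c) : E [0,1,0] [0,0,1,0] := by
  have a1 := hE.mul h (hE.rf [c])
  have a2 := hE.CC (c := c) (t :: (l2 ++ [c])) h1 hc
  have nf : ∀ (p l : List ℕ), (∀ b ∈ l, b = c) → c ∈ p → E (p ++ (l ++ [c])) (p ++ [c]) := by
    intro p l hl hp
    have := hE.NF (p := p) (hh := l ++ [c]) (h' := [c]) [] (by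
      intro b hb
      simp only [List.mem_append, List.mem_singleton] at hb
      have : b = c := hb.elim (hl b) id
      subst this; exact hp) (by
      intro b; simp only [List.mem_append, List.mem_singleton]
      exact ⟨fun hb => hb.elim (hl b) id, Or.inr⟩)
    simpa using this
  have a3 := nf [c,c,t] l2 h2 (by simp)
  have a4 := nf [c,t] l3 h3 (by simp)
  have key : E [c,c,t,c] [c,t,c] := by
    refine hE.tr (hE.sy a3) (hE.tr (hE.sy (by simpa using a2)) (hE.tr ?_ a4))
    simpa using a1
  have := hE.ren hct key
  exact hE.sy (by simpa [hct.symm] using this)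

/-- The part of a word before the first occurrence of a letter. -/
def befW (t : ℕ) : List ℕ → List ℕ
  | [] => []
  | a :: q => if a = t then [] else a :: befW t q

theorem befW_self {t : ℕ} {p q : List ℕ} (h : t ∉ p) : befW t (p ++ t :: q) = p := by
  induction p with
  | nil => simp [befW]
  | cons a p ih =>
    simp only [List.mem_cons, not_or] at h
    simp [befW, Ne.symm h.1, ih h.2]

theorem befW_append {t : ℕ} {p q : List ℕ} (h : t ∉ p) : befW t (p ++ q) = p ++ befW t q := by
  induction p with
  | nil => simp
  | cons a p ih =>
    simp only [List.mem_cons, not_or] at h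
    simp [befW, Ne.symm h.1, ih h.2]

theorem befW_mem {t : ℕ} {p q : List ℕ} (h : t ∈ p) : befW t (p ++ q) = befW t p := by
  obtain ⟨a, b, rfl, h2⟩ := List.eq_append_cons_of_mem h
  rw [List.append_assoc, List.cons_append, befW_self h2, befW_self h2]

theorem befW_sub {t a : ℕ} {p : List ℕ} (h : a ∈ befW t p) : a ∈ p := by
  induction p with
  | nil => exact h
  | cons b p ih =>
    unfold befW at h
    split at h
    · simp at h
    · rcases List.mem_cons.1 h with rfl | h
      · simp
      · simp [ih h]

theorem split_uniq {t : ℕ} {a b a' b' : List ℕ} (h : a ++ t :: b = a' ++ t :: b') (h1 : t ∉ a) (h2 : t ∉ a') :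
    a = a' ∧ b = b' := by
  have e1 : a = a' := by rw [← befW_self (q := b) h1, h, befW_self h2]
  subst e1
  simpa using h

theorem last_D {D : ℕ → Bool} : ∀ A : List ℕ, (∃ x ∈ A, D x = true) →
    ∃ P t h, A = P ++ t :: h ∧ D t = true ∧ ∀ b ∈ h, D b = false := by
  intro A
  induction A using List.reverseRecOn with
  | nil => rintro ⟨x, hx, _⟩; simp at hx
  | append_singleton A a ih =>
    rintro ⟨x, hx, hD⟩
    by_cases ha : D a = true
    · exact ⟨A, a, [], rfl, ha, by simp⟩
    · obtain ⟨P, t, h, rfl, h1, h2⟩ := ih (by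
        rcases List.mem_append.1 hx with hx | hx
        · exact ⟨x, hx, hD⟩
        · simp at hx; subst hx; exact absurd hD ha)
      refine ⟨P, t, h ++ [a], by simp, h1, ?_⟩
      intro b hb
      rcases List.mem_append.1 hb with hb | hb
      · exact h2 b hb
      · simp at hb; subst hb; simpa using ha

theorem D_split {D : ℕ → Bool} {t : ℕ} {w : List ℕ} (hn : (w.filter D).Nodup) (hD : D t = true) (ht : t ∈ w) :
    ∃ a b, w = a ++ t :: b ∧ t ∉ a ∧ t ∉ b := by
  obtain ⟨a, b, rfl, h⟩ := List.eq_append_cons_of_mem ht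
  refine ⟨a, b, rfl, h, fun hb => ?_⟩
  exact nodup_D (P := a ++ [t]) (Q := b) (D := D) (by simpa using hn) (by simp) hD hb

theorem filter_split {D : ℕ → Bool} {t : ℕ} {a b a' b' : List ℕ} (hD : D t = true)
    (h : (a ++ t :: b).filter D = (a' ++ t :: b').filter D) (h1 : t ∉ a) (h2 : t ∉ a') :
    a.filter D = a'.filter D ∧ b.filter D = b'.filter D := by
  simp only [List.filter_append, List.filter_cons, hD, if_true] at h
  exact split_uniq h (fun hm => h1 (List.mem_filter.1 hm).1) (fun hm => h2 (List.mem_filter.1 hm).1)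

theorem piW_only {c t : ℕ} {l : List ℕ} (ht : t ∉ l) : ∀ b ∈ piW c t l, b = c := by
  intro b hb
  rcases mem_piW.1 hb with ⟨h, rfl | rfl⟩
  · rfl
  · exact absurd h ht


/-- `V'` arises from `V` by inserting copies of `c`. -/
def InsC (D : ℕ → Bool) (c : ℕ) (V V' : List ℕ) : Prop :=
  ∃ P R cs, V = P ++ R ∧ V' = P ++ (cs ++ R) ∧ P ≠ [] ∧ (∀ b ∈ cs, b = c) ∧ D c = false ∧ c ∈ V

theorem InsC.filt {D : ℕ → Bool} {c : ℕ} {V V' : List ℕ} (h : InsC D c V V') : V'.filter D = V.filter D := by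
  obtain ⟨P, R, cs, rfl, rfl, hP, hcs, hD, hc⟩ := h
  have : ∀ a ∈ cs, D a = false := fun a ha => by rw [hcs a ha]; exact hD
  simp [filter_hd this]

theorem InsC.mem {D : ℕ → Bool} {c : ℕ} {V V' : List ℕ} (h : InsC D c V V') (b : ℕ) : b ∈ V' ↔ b ∈ V := by
  obtain ⟨P, R, cs, rfl, rfl, hP, hcs, hD, hc⟩ := h
  simp only [List.mem_append] at hc ⊢
  constructor
  · rintro (h | h | h)
    · exact Or.inl h
    · rw [hcs b h]; exact hc
    · exact Or.inr h
  · tauto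

theorem InsC.good {D : ℕ → Bool} {c : ℕ} {V V' : List ℕ} (h : InsC D c V V') (hV : GoodW D V) : GoodW D V' := by
  refine ⟨by rw [h.filt]; exact hV.1, fun b hb hD => ?_⟩
  have := hV.2 b ((h.mem b).1 hb) hD
  obtain ⟨P, R, cs, rfl, rfl, hP, hcs, hD, hc⟩ := h
  simp only [List.count_append] at this ⊢; omega

theorem InsC.head {D : ℕ → Bool} {c t : ℕ} {V V' : List ℕ} (h : InsC D c V V') (hV : ∃ q, V = t :: q) :
    ∃ q, V' = t :: q := by
  obtain ⟨P, R, cs, rfl, rfl, hP, hcs, hD, hc⟩ := h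
  obtain ⟨q, hq⟩ := hV
  cases P with
  | nil => exact absurd rfl hP
  | cons a P => simp at hq; exact ⟨P ++ (cs ++ R), by simp [hq.1]⟩

theorem InsC.bef {D : ℕ → Bool} {c : ℕ} {V V' : List ℕ} (h : InsC D c V V') {b t : ℕ} (hb : b ≠ c)
    (ht : D t = true) : b ∈ befW t V' ↔ b ∈ befW t V := by
  obtain ⟨P, R, cs, rfl, rfl, hP, hcs, hD, hc⟩ := h
  by_cases h : t ∈ P
  · rw [befW_mem h, befW_mem h]
  · have : t ∉ cs := fun hm => by rw [hcs t hm, hD] at ht; cases ht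
    rw [befW_append h, befW_append h, befW_append this]
    simp only [List.mem_append]
    have : b ∉ cs := fun hm => hb (hcs b hm)
    tauto

/-- The common state of the two words. -/
structure StW (E : List ℕ → List ℕ → Prop) (D : ℕ → Bool) (t0 : ℕ) (U V : List ℕ) : Prop where
  h : E U V
  hU : GoodW D U
  hV : GoodW D V
  hf : U.filter D = V.filter D
  hd0 : D t0 = true
  eU : ∃ q, U = t0 :: q
  eV : ∃ q, V = t0 :: q
  me : ∀ c, c ∈ U ↔ c ∈ V

theorem StW.symm {E : List ℕ → List ℕ → Prop} {D : ℕ → Bool} {t0 : ℕ} {U V : List ℕ} (hE : OThy E)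
    (S : StW E D t0 U V) : StW E D t0 V U :=
  ⟨hE.sy S.h, S.hV, S.hU, S.hf.symm, S.hd0, S.eV, S.eU, fun c => (S.me c).symm⟩

theorem StW.insV {E F : List ℕ → List ℕ → Prop} (C : Ctx E F) {D : ℕ → Bool} {t0 c : ℕ} {U V V' : List ℕ}
    (S : StW E D t0 U V) (h : InsC D c V V') (hF : F V V') : StW E D t0 U V' :=
  ⟨C.hE.tr S.h (C.le hF), S.hU, h.good S.hV, by rw [h.filt]; exact S.hf, S.hd0, S.eU, h.head S.eV,
    fun c => by rw [h.mem]; exact S.me c⟩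

theorem I2a {E F : List ℕ → List ℕ → Prop} (C : Ctx E F) {D : ℕ → Bool} {t0 c t : ℕ} {U V : List ℕ}
    (S : StW E D t0 U V) (hDc : D c = false) (hDt : D t = true) (hcU : c ∈ befW t U)
    (hcV : c ∉ befW t V) :
    ∃ V', F V V' ∧ InsC D c V V' ∧ ∀ t', D t' = true → (c ∈ befW t' U ↔ c ∈ befW t' V') := by
  have hE := C.hE
  have hF := C.hF
  have neD : ∀ x, D x = true → c ≠ x := fun x hx e => by rw [e, hx] at hDc; cases hDc
  have hct : c ≠ t := neD t hDt
  have htU : t ∈ U := by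
    by_contra hn
    have hn' : t ∉ V := fun h => hn ((S.me t).2 h)
    have e1 := befW_append (q := []) hn
    have e2 := befW_append (q := []) hn'
    simp only [List.append_nil, befW] at e1 e2
    rw [e1] at hcU
    rw [e2] at hcV
    exact hcV ((S.me c).1 hcU)
  have htV : t ∈ V := (S.me t).1 htU
  -- position of the first `c` in `U`
  obtain ⟨A, Q, hA, hcA⟩ := List.eq_append_cons_of_mem (befW_sub hcU)
  obtain ⟨P, t1, hh, hAe, hDt1, hhD⟩ := last_D (D := D) A (by
    obtain ⟨q, hq⟩ := S.eU
    cases A with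
    | nil => rw [hA] at hq; simp at hq; exact absurd hq.1 (neD t0 S.hd0)
    | cons a A =>
      rw [hA] at hq; simp at hq
      exact ⟨a, by simp, by rw [hq.1]; exact S.hd0⟩)
  have hUe : U = P ++ t1 :: (hh ++ c :: Q) := by rw [hA, hAe]; simp
  have hcP : c ∉ P := fun h => hcA (by rw [hAe]; simp [h])
  have ht1P : t1 ∉ P := fun hm => nodup_D (P := P) (Q := t1 :: (hh ++ c :: Q)) (D := D)
    (by rw [← hUe]; exact S.hU.1) hm hDt1 (by simp)
  obtain ⟨P', R, hVe, ht1P', ht1R⟩ := D_split (t := t1) S.hV.1 hDt1 ((S.me t1).1 (by rw [hUe]; simp))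
  have hff := filter_split hDt1 (by rw [← hUe, ← hVe]; exact S.hf) ht1P ht1P'
  have htP : t ∉ P := by
    intro hm
    rw [hUe, befW_mem hm] at hcU
    exact hcP (befW_sub hcU)
  have htt1 : t ≠ t1 := by
    rintro rfl
    rw [hUe, befW_self ht1P] at hcU
    exact hcP hcU
  have htP' : t ∉ P' := fun hm => htP ((filter_mem_iff hff.1 hDt).2 hm)
  have htPt' : t ∉ P' ++ [t1] := by simp [htP', htt1]
  have hVe' : V = (P' ++ [t1]) ++ R := by rw [hVe]; simp
  rw [hVe', befW_append htPt', List.mem_append, not_or] at hcV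
  have hcP' : c ∉ P' := fun h => hcV.1 (by simp [h])
  have hcR : c ∈ R := by
    have := (S.me c).1 (befW_sub hcU)
    rw [hVe] at this
    simpa [hcP', neD t1 hDt1] using this
  obtain ⟨R1, R2, hRe, hcR1⟩ := List.eq_append_cons_of_mem hcR
  have htR1 : t ∈ R1 := by
    by_contra hn
    apply hcV.2
    rw [hRe, befW_append hn]
    simp [befW, hct]
  have hVfull : V = (P' ++ t1 :: R1) ++ c :: R2 := by rw [hVe, hRe]; simp
  have hcS : c ∉ P' ++ t1 :: R1 := by simp [hcP', hcR1, neD t1 hDt1]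
  have hcR2 : c ∈ R2 := by
    have := S.hV.2 c (by rw [hVfull]; simp) hDc
    rw [hVfull] at this
    exact (mem_of_count2 this).resolve_left hcS
  -- split both words at `t`
  obtain ⟨B, B', hUt, htB, htB'⟩ := D_split (t := t) S.hU.1 hDt htU
  have hcB : c ∈ B := by rw [hUt, befW_self htB] at hcU; exact hcU
  obtain ⟨R11, R12, hR1e, htR11⟩ := List.eq_append_cons_of_mem htR1
  set V1 := P' ++ t1 :: R11 with hV1
  set V2 := R12 ++ c :: R2 with hV2
  have hVt : V = V1 ++ t :: V2 := by rw [hVfull, hR1e]; simp [hV1, hV2]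
  have htV1 : t ∉ V1 := by simp [hV1, htP', htt1, htR11]
  have htV2 : t ∉ V2 := fun hm => nodup_D (P := V1 ++ [t]) (Q := V2) (D := D)
    (by have := S.hV.1; rw [hVt] at this; simpa using this) (by simp) hDt hm
  have hcV1 : c ∉ V1 := by
    simp only [hR1e, List.mem_append, List.mem_cons, not_or] at hcR1
    simp [hV1, hcP', hcR1.1, neD t1 hDt1]
  have hfB := (filter_split hDt (by rw [← hUt, ← hVt]; exact S.hf) htB htV1).2
  have pre : E (piW c t B ++ [t, c]) [t, c, c] := by
    have := hE.pi2 c t S.h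
    rw [hUt, hVt, piW_append, piW_append, piW_y, piW_y, piW_eq_nil hcV1 htV1] at this
    exact hE.del_pre this (piW_only htB) (piW_only htB') (piW_only htV2)
      (mem_piW.2 ⟨hcB, by simp⟩) (mem_piW.2 ⟨by simp [hV2], by simp⟩)
  have dE := hE.delta_of hct pre (piW_only htB) (mem_piW.2 ⟨hcB, by simp⟩)
  have dF := C.dl dE
  -- double the first `c`
  have s1 : F V ((P' ++ t1 :: R1) ++ c :: c :: R2) := by
    by_cases hc2 : c ∈ hdB D R2
    · obtain ⟨R3, hR3, _⟩ := hdB_split D R2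
      obtain ⟨w, x, hwx⟩ := List.append_of_mem hc2
      have e : R2 = w ++ c :: (x ++ R3) := by rw [hR3, hwx]; simp
      have := hF.L4 (x := c) (x ++ R3) w ((P' ++ t1 :: R1) ++ [c]) (by simp) (by
        intro b hb
        have e2 : ((P' ++ t1 :: R1) ++ [c]) ++ (w ++ c :: (x ++ R3)) = V := by
          rw [hVfull, e]; simp
        rw [e2]
        refine S.hV.2 b ?_ (hdB_D (D := D) (q := R2) b (by rw [hwx]; simp [hb]))
        rw [← e2]; simp [hb])
      rw [← e] at this
      rw [hVfull]; simpa using this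
    · obtain ⟨R3, hR3, hd⟩ := hdB_split D R2
      have hcR3 : c ∈ R3 := by
        have := hcR2
        rw [hR3, List.mem_append] at this
        exact this.resolve_left hc2
      obtain ⟨t2, R4, hR3e, hDt2⟩ : ∃ t2 R4, R3 = t2 :: R4 ∧ D t2 = true := by
        rcases hd with h | h
        · rw [h] at hcR3; simp at hcR3
        · exact h
      have thE : E [0,1,0] [0,0,1,0] := by
        by_cases h2 : 2 ≤ (piW c t B).count c
        · have hV2e : V2 = (R12 ++ c :: hdB D R2) ++ t2 :: R4 := by
            rw [hV2, ← hR3e, List.append_assoc, List.cons_append, ← hR3]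
          have ht2B' : t2 ∈ B' := (filter_mem_iff hfB hDt2).2 (by rw [hV2e]; simp)
          have hB'n : (B'.filter D).Nodup := by
            have := S.hU.1
            rw [hUt, List.filter_append] at this
            have := this.of_append_right
            simp only [List.filter_cons, hDt, if_true] at this
            exact this.of_cons
          obtain ⟨B3, B4, hB', h3, h4⟩ := D_split (t := t2) hB'n hDt2 ht2B'
          have hUe2 : U = (B ++ t :: B3) ++ t2 :: B4 := by rw [hUt, hB']; simp
          have hVe2 : V = ((P' ++ t1 :: R1) ++ c :: hdB D R2) ++ t2 :: R4 := by
            rw [hVt, hV2e, hV1, hR1e]; simp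
          have n1 : t2 ∉ B ++ t :: B3 := fun hm => nodup_D (P := B ++ t :: B3) (Q := t2 :: B4) (D := D)
            (by rw [← hUe2]; exact S.hU.1) hm hDt2 (by simp)
          have n2 : t2 ∉ (P' ++ t1 :: R1) ++ c :: hdB D R2 := fun hm =>
            nodup_D (P := (P' ++ t1 :: R1) ++ c :: hdB D R2) (Q := t2 :: R4) (D := D)
            (by rw [← hVe2]; exact S.hV.1) hm hDt2 (by simp)
          have n3 : t2 ∉ R4 := fun hm =>
            nodup_D (P := ((P' ++ t1 :: R1) ++ c :: hdB D R2) ++ [t2]) (Q := R4) (D := D)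
            (by have := S.hV.1; rw [hVe2] at this; simpa using this) (by simp) hDt2 hm
          have hh := hE.pi2 c t2 S.h
          have e5 : piW c t2 ((P' ++ t1 :: R1) ++ c :: hdB D R2) = [c] := by
            rw [piW_append, piW_x, piW_eq_nil hcS (fun hm => n2 (by
              rw [List.mem_append]; exact Or.inl hm)), piW_eq_nil hc2 (fun hm => n2 (by
              simp [hm]))]
            rfl
          rw [hUe2, hVe2, piW_append _ _ (B ++ t :: B3), piW_append _ _ _ (t2 :: R4), e5, piW_y,
            piW_y] at hh
          refine hE.theta_two (neD t2 hDt2) hh (piW_only n1) (piW_only h4) (piW_only n3) ?_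
          rw [count_piW_x] at h2 ⊢
          rw [List.count_append]; omega
        · have := single_of (piW_only htB) (mem_piW.2 ⟨hcB, by simp⟩) h2
          rw [this] at pre
          exact hE.theta_one hct pre
      have thF := C.th thE
      obtain ⟨W, Z, hWZ⟩ := List.append_of_mem hcR2
      have a1 := hF.sub (fun n => if n = 0 then [c] else W) thF
      have a2 := hF.ctx (P' ++ t1 :: R1) Z a1
      rw [hVfull, hWZ]
      simpa using a2
  have s2 : F ((P' ++ t1 :: R1) ++ c :: c :: R2) (P' ++ t1 :: (c :: c :: R)) := by
    have a1 := hF.sub (fun n => if n = 0 then [c] else R1) dF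
    have a2 := hF.ctx (P' ++ [t1]) R2 a1
    rw [hRe]
    exact hF.sy (by simpa using a2)
  refine ⟨P' ++ t1 :: (c :: c :: R), hF.tr s1 s2, ⟨P' ++ [t1], R, [c, c], hVe', by simp, by simp,
    by simp, hDc, by rw [hVfull]; simp⟩, ?_⟩
  intro t' hDt'
  rw [hUe]
  by_cases h1 : t' ∈ P
  · have h2 : t' ∈ P' := (filter_mem_iff hff.1 hDt').1 h1
    rw [befW_mem h1, befW_mem h2]
    exact ⟨fun h => absurd (befW_sub h) hcP, fun h => absurd (befW_sub h) hcP'⟩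
  · have h2 : t' ∉ P' := fun h => h1 ((filter_mem_iff hff.1 hDt').2 h)
    by_cases h3 : t' = t1
    · subst h3
      rw [befW_self h1, befW_self h2]
      exact ⟨fun h => absurd h hcP, fun h => absurd h hcP'⟩
    · have e1 : P ++ t1 :: (hh ++ c :: Q) = (P ++ t1 :: (hh ++ [c])) ++ Q := by simp
      have e2 : P' ++ t1 :: (c :: c :: R) = (P' ++ [t1, c]) ++ (c :: R) := by simp
      rw [e1, e2, befW_append, befW_append]
      · simp
      · simp [h2, h3, (neD t' hDt').symm]
      · have : t' ∉ hh := fun h => by rw [hhD t' h] at hDt'; cases hDt'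
        simp [h1, h3, this, (neD t' hDt').symm]


theorem I2all {E F : List ℕ → List ℕ → Prop} (C : Ctx E F) {D : ℕ → Bool} {t0 : ℕ} {U V : List ℕ}
    (S : StW E D t0 U V) (L : List ℕ) :
    ∃ U' V', F U U' ∧ F V V' ∧ StW E D t0 U' V' ∧ (∀ b, b ∈ U' ↔ b ∈ U) ∧
      ∀ c ∈ L, D c = false → ∀ t, D t = true → (c ∈ befW t U' ↔ c ∈ befW t V') := by
  induction L with
  | nil => exact ⟨U, V, C.hF.rf _, C.hF.rf _, S, fun _ => Iff.rfl, by simp⟩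
  | cons c L ih =>
    obtain ⟨U1, V1, f1, f2, S1, m, hL⟩ := ih
    by_cases hDc : D c = false
    · by_cases hall : ∀ t, D t = true → (c ∈ befW t U1 ↔ c ∈ befW t V1)
      · refine ⟨U1, V1, f1, f2, S1, m, ?_⟩
        intro b hb
        rcases List.mem_cons.1 hb with rfl | hb
        · exact fun _ => hall
        · exact hL b hb
      · push Not at hall
        obtain ⟨t, hDt, hor⟩ := hall
        rcases hor with ⟨h1, h2⟩ | ⟨h1, h2⟩
        · obtain ⟨V2, g, i, hg⟩ := I2a C S1 hDc hDt h1 h2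
          refine ⟨U1, V2, f1, C.hF.tr f2 g, S1.insV C i g, m, ?_⟩
          intro b hb hDb t' ht'
          by_cases e : b = c
          · subst e; exact hg t' ht'
          · rw [i.bef e ht']
            exact hL b ((List.mem_cons.1 hb).resolve_left e) hDb t' ht'
        · obtain ⟨U2, g, i, hg⟩ := I2a C (S1.symm C.hE) hDc hDt h2 h1
          refine ⟨U2, V1, C.hF.tr f1 g, f2, ((S1.symm C.hE).insV C i g).symm C.hE,
            fun b => by rw [i.mem, m], ?_⟩
          intro b hb hDb t' ht'
          by_cases e : b = c
          · subst e; exact (hg t' ht').symm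
          · rw [i.bef e ht']
            exact hL b ((List.mem_cons.1 hb).resolve_left e) hDb t' ht'
    · refine ⟨U1, V1, f1, f2, S1, m, ?_⟩
      intro b hb hDb
      rcases List.mem_cons.1 hb with rfl | hb
      · exact absurd hDb hDc
      · exact hL b hb hDb

/-- Insertion of copies of `c` into the block of `t`, after an earlier `c`. -/
def InsB (D : ℕ → Bool) (t c : ℕ) (U U' : List ℕ) : Prop :=
  ∃ p h cs R, U = p ++ t :: (h ++ R) ∧ U' = p ++ t :: (h ++ (cs ++ R)) ∧ t ∉ p ∧ D t = true ∧
    (∀ b ∈ h, D b = false) ∧ (∀ b ∈ cs, b = c) ∧ (c ∈ p ∨ c ∈ h) ∧ D c = false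

theorem InsB.insC {D : ℕ → Bool} {t c : ℕ} {U U' : List ℕ} (h : InsB D t c U U') : InsC D c U U' := by
  obtain ⟨p, h, cs, R, rfl, rfl, h1, h2, h3, h4, h5, h6⟩ := h
  refine ⟨p ++ t :: h, R, cs, by simp, by simp, by simp, h4, h6, ?_⟩
  rcases h5 with h | h <;> simp [h]

theorem InsB.bef {D : ℕ → Bool} {t c : ℕ} {U U' : List ℕ} (h : InsB D t c U U') {b t' : ℕ}
    (ht' : D t' = true) : b ∈ befW t' U' ↔ b ∈ befW t' U := by
  by_cases e : b = c
  · subst e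
    obtain ⟨p, h, cs, R, rfl, rfl, h1, h2, h3, h4, h5, h6⟩ := h
    have e1 : p ++ t :: (h ++ R) = (p ++ t :: h) ++ R := by simp
    have e2 : p ++ t :: (h ++ (cs ++ R)) = (p ++ t :: h) ++ (cs ++ R) := by simp
    rw [e1, e2]
    by_cases hm : t' ∈ p ++ t :: h
    · rw [befW_mem hm, befW_mem hm]
    · rw [befW_append hm, befW_append hm]
      have : b ∈ p ++ t :: h := by rcases h5 with h | h <;> simp [h]
      simp only [List.mem_append] at this ⊢; tauto
  · exact h.insC.bef e ht'

theorem hdB_upTo {D : ℕ → Bool} {t : ℕ} (ht : D t = true) (p X Y : List ℕ) :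
    hdB D (p ++ t :: X) = hdB D (p ++ t :: Y) := by
  induction p with
  | nil => simp [hdB, ht]
  | cons a p ih =>
    by_cases ha : D a = true
    · simp [hdB, ha]
    · simp only [Bool.not_eq_true] at ha
      rw [List.cons_append, List.cons_append, hdB_cons_N ha, hdB_cons_N ha, ih]

theorem InsB.blk_ne {D : ℕ → Bool} {t c : ℕ} {U U' : List ℕ} (h : InsB D t c U U') {t' : ℕ}
    (ht' : D t' = true) (hne : t' ≠ t) : blkW D U' t' = blkW D U t' := by
  obtain ⟨p, h, cs, R, rfl, rfl, h1, h2, h3, h4, h5, h6⟩ := h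
  unfold blkW
  by_cases hm : t' ∈ p
  · obtain ⟨a, b, rfl, hb⟩ := List.eq_append_cons_of_mem hm
    rw [List.append_assoc, List.append_assoc, List.cons_append, List.cons_append,
      aftW_append hb, aftW_append hb, aftW_cons_self, aftW_cons_self]
    exact hdB_upTo h2 _ _ _
  · have n1 : t' ∉ h := fun h => by rw [h3 t' h] at ht'; cases ht'
    have n2 : t' ∉ cs := fun h => by rw [h4 t' h, h6] at ht'; cases ht'
    rw [aftW_append hm, aftW_append hm, aftW_cons_ne hne.symm, aftW_cons_ne hne.symm,
      aftW_append n1, aftW_append n1, aftW_append n2]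

theorem InsB.blk_count {D : ℕ → Bool} {t c : ℕ} {U U' : List ℕ} (h : InsB D t c U U') {t' c' : ℕ}
    (ht' : D t' = true) (hne : ¬ (t' = t ∧ c' = c)) :
    (blkW D U' t').count c' = (blkW D U t').count c' := by
  by_cases e : t' = t
  · subst e
    have hcc : c' ≠ c := fun h => hne ⟨rfl, h⟩
    obtain ⟨p, h, cs, R, rfl, rfl, h1, h2, h3, h4, h5, h6⟩ := h
    unfold blkW
    have hcsD : ∀ b ∈ cs, D b = false := fun b hb => by rw [h4 b hb]; exact h6
    have hcc' : cs.count c' = 0 := List.count_eq_zero.2 (fun hm => hcc (h4 _ hm))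
    rw [aftW_append h1, aftW_append h1, aftW_cons_self, aftW_cons_self, hdB_append h3, hdB_append h3,
      hdB_append hcsD, List.count_append, List.count_append, List.count_append, hcc', Nat.zero_add]
  · rw [h.blk_ne ht' e]

theorem PA {E F : List ℕ → List ℕ → Prop} (C : Ctx E F) {D : ℕ → Bool} {t c : ℕ} {p q p' r : List ℕ}
    (h : E (p ++ t :: q) (p' ++ t :: r)) (hU : GoodW D (p ++ t :: q)) (hV : GoodW D (p' ++ t :: r))
    (hf : q.filter D = r.filter D) (htp : t ∉ p) (hDt : D t = true) (hDc : D c = false)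
    (hor : (c ∈ p ∧ c ∈ p' ∧ (c ∈ hdB D q ∨ c ∈ hdB D r)) ∨
      (c ∉ p ∧ c ∈ hdB D q ∧ (2 ≤ (hdB D q).count c ∨ 2 ≤ (hdB D r).count c))) :
    ∃ U', F (p ++ t :: q) U' ∧ InsB D t c (p ++ t :: q) U' ∧ 2 ≤ (blkW D U' t).count c := by
  have hF := C.hF
  have hct : c ≠ t := fun e => by rw [e, hDt] at hDc; cases hDc
  obtain ⟨Q, hqQ, hQ⟩ := hdB_split D q
  rcases hor with ⟨h1, h2, h3⟩ | ⟨h1, h2, h3⟩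
  · refine ⟨p ++ t :: (c :: c :: q), ?_, ⟨p, [], [c, c], q, rfl, rfl, htp, hDt, by simp, by simp,
      Or.inl h1, hDc⟩, ?_⟩
    · have base : F (p ++ t :: q) (p ++ t :: (c :: q)) := by
        rcases h3 with h3 | h3
        · have := hF.CP (p := p ++ [t]) (hh := hdB D q) (r := Q) (by
            intro b hb
            rw [← hqQ]
            have := hU.2 b (by simp [(mem_hdB hb).1]) (hdB_D b hb)
            simpa using this) [c] (by simp [h1, h3])
          rw [← hqQ] at this
          simpa using this
        · exact TA C hDc hDt h hU hV.1 hf h1 h2 h3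
      have d := hF.dup (x := c) (p := p ++ [t]) q (by simp [h1])
      exact hF.tr base (by simpa using d)
    · unfold blkW
      rw [aftW_append htp, aftW_cons_self, hdB_cons_N hDc, hdB_cons_N hDc, List.count_cons_self,
        List.count_cons_self]
      omega
  · by_cases h4 : 2 ≤ (hdB D q).count c
    · refine ⟨_, hF.rf _, ⟨p, hdB D q, [], Q, by rw [← hqQ], by simp [← hqQ], htp, hDt, hdB_D,
        by simp, Or.inr h2, hDc⟩, ?_⟩
      unfold blkW
      rw [aftW_append htp, aftW_cons_self]; exact h4
    · have h5 := h3.resolve_left h4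
      obtain ⟨w, x, hwx, hcw⟩ := List.eq_append_cons_of_mem h2
      obtain ⟨R, hrR, hR⟩ := hdB_split D r
      have hD : ∀ b ∈ w ++ c :: x, D b = false := by rw [← hwx]; exact hdB_D
      have hw : ∀ b ∈ w, D b = false := fun b hb => hD b (by simp [hb])
      have hx : ∀ b ∈ x, D b = false := fun b hb => hD b (by simp [hb])
      have hqe : q = w ++ c :: (x ++ Q) := by
        conv_lhs => rw [hqQ, hwx]
        simp
      have hUe : p ++ t :: q = (p ++ t :: w) ++ c :: (x ++ Q) := by rw [hqe]; simp
      have hVe : p' ++ t :: r = (p' ++ t :: hdB D r) ++ R := by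
        conv_lhs => rw [hrR]
        simp
      have f := TD C (D := D) (c := c) (s := p ++ t :: w) (q := x ++ Q) (V0 := p' ++ t :: hdB D r) (R := R)
        hDc (by simp [h1, hct, hcw]) (by rw [← hUe, ← hVe]; exact h) (by rw [← hUe]; exact hU)
        (by rw [← hVe]; exact hV.1) (by
          rw [List.filter_append, filter_hd hx, ← filter_tail hrR, ← hf]
          conv_rhs => rw [filter_tail hqQ]
          rfl) hR (by rw [List.count_append, List.count_cons]; omega)
      refine ⟨_, by rw [hUe]; exact f, ⟨p, w ++ [c], [c], x ++ Q, by rw [hqe]; simp, by simp, htp, hDt,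
        ?_, by simp, by simp, hDc⟩, ?_⟩
      · intro b hb
        rcases List.mem_append.1 hb with hb | hb
        · exact hw b hb
        · simp at hb; rw [hb]; exact hDc
      · unfold blkW
        rw [List.append_assoc, List.cons_append, aftW_append htp, aftW_cons_self, hdB_append hw,
          hdB_cons_N hDc, hdB_cons_N hDc, List.count_append, List.count_cons_self,
          List.count_cons_self]
        omega


def BefE (D : ℕ → Bool) (U V : List ℕ) : Prop :=
  ∀ c, D c = false → ∀ t, D t = true → (c ∈ befW t U ↔ c ∈ befW t V)

theorem PAstep {E F : List ℕ → List ℕ → Prop} (C : Ctx E F) {D : ℕ → Bool} {t0 t c : ℕ} {U V : List ℕ}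
    (S : StW E D t0 U V) (B : BefE D U V) (hDt : D t = true) (hDc : D c = false) :
    ∃ U' V', F U U' ∧ F V V' ∧ StW E D t0 U' V' ∧ BefE D U' V' ∧ (∀ b, b ∈ U' ↔ b ∈ U) ∧
      capE c (blkW D U' t) (blkW D V' t) ∧
      ∀ t' c', D t' = true → ¬ (t' = t ∧ c' = c) → capE c' (blkW D U t') (blkW D V t') →
        capE c' (blkW D U' t') (blkW D V' t') := by
  have hct : c ≠ t := fun e => by rw [e, hDt] at hDc; cases hDc
  by_cases hcap : capE c (blkW D U t) (blkW D V t)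
  · exact ⟨U, V, C.hF.rf _, C.hF.rf _, S, B, fun _ => Iff.rfl, hcap, fun _ _ _ _ h => h⟩
  have htU : t ∈ U := by
    by_contra hn
    have hn' : t ∉ V := fun h => hn ((S.me t).2 h)
    apply hcap
    unfold blkW
    rw [aftW_notMem hn, aftW_notMem hn']; rfl
  obtain ⟨p, q, hU, htp, htq⟩ := D_split S.hU.1 hDt htU
  obtain ⟨p', r, hV, htp', htr⟩ := D_split S.hV.1 hDt ((S.me t).1 htU)
  have hff := filter_split hDt (by rw [← hU, ← hV]; exact S.hf) htp htp'
  have hcp : c ∈ p ↔ c ∈ p' := by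
    have := B c hDc t hDt
    rwa [hU, hV, befW_self htp, befW_self htp'] at this
  have bU : blkW D U t = hdB D q := by unfold blkW; rw [hU, aftW_append htp, aftW_cons_self]
  have bV : blkW D V t = hdB D r := by unfold blkW; rw [hV, aftW_append htp', aftW_cons_self]
  rw [bU, bV] at hcap
  have conds : ((c ∈ p ∧ c ∈ p' ∧ (c ∈ hdB D q ∨ c ∈ hdB D r)) ∨
      (c ∉ p ∧ c ∈ hdB D q ∧ (2 ≤ (hdB D q).count c ∨ 2 ≤ (hdB D r).count c))) ∧
      ((c ∈ p' ∧ c ∈ p ∧ (c ∈ hdB D r ∨ c ∈ hdB D q)) ∨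
      (c ∉ p' ∧ c ∈ hdB D r ∧ (2 ≤ (hdB D r).count c ∨ 2 ≤ (hdB D q).count c))) := by
    by_cases hc : c ∈ p
    · have hc' := hcp.1 hc
      have : c ∈ hdB D q ∨ c ∈ hdB D r := by
        by_contra hn
        push Not at hn
        apply hcap
        unfold capE
        rw [List.count_eq_zero.2 hn.1, List.count_eq_zero.2 hn.2]
      exact ⟨Or.inl ⟨hc, hc', this⟩, Or.inl ⟨hc', hc, this.symm⟩⟩
    · have hc' : c ∉ p' := fun h => hc (hcp.2 h)
      have hmem : c ∈ hdB D q ↔ c ∈ hdB D r := by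
        rcases split_two hff.2 with ⟨e1, e2⟩ | ⟨t2, Q, R, hDt2, e1, e2, _⟩
        · have := S.me c
          rw [hU, hV] at this
          rw [← e1, ← e2]
          simpa [hc, hc', hct] using this
        · have eU : U = (p ++ t :: hdB D q) ++ t2 :: Q := by
            rw [hU]; conv_lhs => rw [e1]
            simp
          have eV : V = (p' ++ t :: hdB D r) ++ t2 :: R := by
            rw [hV]; conv_lhs => rw [e2]
            simp
          have n1 : t2 ∉ p ++ t :: hdB D q := fun hm => nodup_D (Q := t2 :: Q)
            (by rw [← eU]; exact S.hU.1) hm hDt2 (by simp)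
          have n2 : t2 ∉ p' ++ t :: hdB D r := fun hm => nodup_D (Q := t2 :: R)
            (by rw [← eV]; exact S.hV.1) hm hDt2 (by simp)
          have := B c hDc t2 hDt2
          rw [eU, eV, befW_self n1, befW_self n2] at this
          simpa [hc, hc', hct] using this
      have h1 : c ∈ hdB D q := by
        by_contra hn
        have hn' : c ∉ hdB D r := fun h => hn (hmem.2 h)
        apply hcap
        unfold capE
        rw [List.count_eq_zero.2 hn, List.count_eq_zero.2 hn']
      have h2 := hmem.1 h1
      have h3 : 2 ≤ (hdB D q).count c ∨ 2 ≤ (hdB D r).count c := by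
        by_contra hn
        push Not at hn
        apply hcap
        unfold capE
        have := List.count_pos_iff.2 h1
        have := List.count_pos_iff.2 h2
        omega
      exact ⟨Or.inr ⟨hc, h1, h3⟩, Or.inr ⟨hc', h2, h3.symm⟩⟩
  obtain ⟨U', f1, i1, k1⟩ := PA C (by rw [← hU, ← hV]; exact S.h) (by rw [← hU]; exact S.hU)
    (by rw [← hV]; exact S.hV) hff.2 htp hDt hDc conds.1
  obtain ⟨V', f2, i2, k2⟩ := PA C (C.hE.sy (by rw [← hU, ← hV]; exact S.h)) (by rw [← hV]; exact S.hV)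
    (by rw [← hU]; exact S.hU) hff.2.symm htp' hDt hDc conds.2
  rw [← hU] at f1 i1
  rw [← hV] at f2 i2
  have S1 := S.insV C i2.insC f2
  have S2 := ((S1.symm C.hE).insV C i1.insC f1).symm C.hE
  refine ⟨U', V', f1, f2, S2, ?_, i1.insC.mem, ?_, ?_⟩
  · intro b hb t' ht'
    rw [i1.bef ht', i2.bef ht']; exact B b hb t' ht'
  · unfold capE; omega
  · intro t' c' ht' hne h
    unfold capE at h ⊢
    rw [i1.blk_count ht' hne, i2.blk_count ht' hne]; exact h

theorem PAall {E F : List ℕ → List ℕ → Prop} (C : Ctx E F) {D : ℕ → Bool} {t0 : ℕ} {U V : List ℕ}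
    (S : StW E D t0 U V) (B : BefE D U V) (L : List (ℕ × ℕ)) :
    ∃ U' V', F U U' ∧ F V V' ∧ StW E D t0 U' V' ∧ BefE D U' V' ∧ (∀ b, b ∈ U' ↔ b ∈ U) ∧
      ∀ x ∈ L, D x.1 = true → D x.2 = false → capE x.2 (blkW D U' x.1) (blkW D V' x.1) := by
  induction L with
  | nil => exact ⟨U, V, C.hF.rf _, C.hF.rf _, S, B, fun _ => Iff.rfl, by simp⟩
  | cons y L ih =>
    obtain ⟨U1, V1, f1, f2, S1, B1, m, hL⟩ := ih
    by_cases hy : D y.1 = true ∧ D y.2 = false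
    · obtain ⟨U2, V2, g1, g2, S2, B2, m2, hc, hk⟩ := PAstep C S1 B1 hy.1 hy.2
      refine ⟨U2, V2, C.hF.tr f1 g1, C.hF.tr f2 g2, S2, B2, fun b => by rw [m2, m], ?_⟩
      intro x hx h1 h2
      by_cases e : x = y
      · subst e; exact hc
      · exact hk _ _ h1 (fun h => e (Prod.ext h.1 h.2))
          (hL x ((List.mem_cons.1 hx).resolve_left e) h1 h2)
    · refine ⟨U1, V1, f1, f2, S1, B1, m, ?_⟩
      intro x hx h1 h2
      rcases List.mem_cons.1 hx with rfl | hx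
      · exact absurd ⟨h1, h2⟩ hy
      · exact hL x hx h1 h2

theorem aftW_sub {t a : ℕ} {q : List ℕ} (h : a ∈ aftW t q) : a ∈ q := by
  induction q with
  | nil => exact h
  | cons b q ih =>
    unfold aftW at h
    split at h
    · simp [h]
    · simp [ih h]

theorem PhaseEnd {E F : List ℕ → List ℕ → Prop} (C : Ctx E F) {D : ℕ → Bool} {t0 : ℕ} {U V : List ℕ}
    (S : StW E D t0 U V) : F U V := by
  obtain ⟨U1, V1, f1, f2, S1, m1, hB⟩ := I2all C S U
  have B1 : BefE D U1 V1 := by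
    intro c hc t ht
    by_cases h : c ∈ U
    · exact hB c h hc t ht
    · have n1 : c ∉ U1 := fun h' => h ((m1 c).1 h')
      have n2 : c ∉ V1 := fun h' => n1 ((S1.me c).2 h')
      exact ⟨fun h => absurd (befW_sub h) n1, fun h => absurd (befW_sub h) n2⟩
  obtain ⟨U2, V2, g1, g2, S2, B2, m2, hP⟩ := PAall C S1 B1 (U1.product U1)
  have caps : ∀ t, D t = true → ∀ c, capE c (blkW D U2 t) (blkW D V2 t) := by
    intro t ht c
    have triv : c ∉ blkW D U2 t → c ∉ blkW D V2 t → capE c (blkW D U2 t) (blkW D V2 t) := by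
      intro h1 h2
      unfold capE
      rw [List.count_eq_zero.2 h1, List.count_eq_zero.2 h2]
    by_cases hDc : D c = false
    · by_cases hc : c ∈ U1
      · by_cases htm : t ∈ U1
        · exact hP (t, c) (List.pair_mem_product.2 ⟨htm, hc⟩) ht hDc
        · have n1 : t ∉ U2 := fun h => htm ((m2 t).1 h)
          have n2 : t ∉ V2 := fun h => n1 ((S2.me t).2 h)
          unfold blkW
          rw [aftW_notMem n1, aftW_notMem n2]; rfl
      · have n1 : c ∉ U2 := fun h => hc ((m2 c).1 h)
        have n2 : c ∉ V2 := fun h => n1 ((S2.me c).2 h)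
        exact triv (fun h => n1 (aftW_sub (mem_hdB h).1)) (fun h => n2 (aftW_sub (mem_hdB h).1))
    · exact triv (fun h => hDc (mem_hdB h).2) (fun h => hDc (mem_hdB h).2)
  obtain ⟨q, hq⟩ := S2.eU
  obtain ⟨r, hr⟩ := S2.eV
  have hD0 := S2.hd0
  have n1 : t0 ∉ q := fun hm => nodup_D (P := [t0]) (Q := q) (D := D)
    (by rw [List.singleton_append, ← hq]; exact S2.hU.1) (by simp) hD0 hm
  have n2 : t0 ∉ r := fun hm => nodup_D (P := [t0]) (Q := r) (D := D)
    (by rw [List.singleton_append, ← hr]; exact S2.hV.1) (by simp) hD0 hm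
  have k := Scan C (D := D) (q.length + 1) [t0] q r (by omega)
    { ht := ⟨t0, by simp, hD0⟩
      h := by simpa [← hq, ← hr] using S2.h
      hU := by simpa [← hq] using S2.hU
      hV := by simpa [← hr] using S2.hV
      hf := by
        have := S2.hf
        rw [hq, hr] at this
        simpa [hD0] using this
      cF := by
        intro c _
        have := caps t0 hD0 c
        unfold blkW at this
        rwa [hq, hr, aftW_cons_self, aftW_cons_self] at this
      cB := by
        intro t ht c
        by_cases e : t0 = t
        · subst e
          unfold blkW
          rw [aftW_notMem n1, aftW_notMem n2]; rfl
        · have := caps t ht c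
          unfold blkW at this ⊢
          rwa [hq, hr, aftW_cons_ne e, aftW_cons_ne e] at this }
  have k' : F U2 V2 := by rw [hq, hr]; simpa using k
  exact C.hF.tr (C.hF.tr f1 g1) (C.hF.tr k' (C.hF.sy (C.hF.tr f2 g2)))


section assembly
variable {E F : List ℕ → List ℕ → Prop}

theorem Thy.oneL (hE : Thy E) {u v : List ℕ} (c d : ℕ) (h : E u v) :
    E (List.replicate (u.count c) d) (List.replicate (v.count c) d) := by
  have key : ∀ w : List ℕ, w.flatMap (fun a => if a = c then [d] else []) = List.replicate (w.count c) d := by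
    intro w
    induction w with
    | nil => simp
    | cons a w ih =>
      by_cases h : a = c
      · subst h; simp [ih, List.replicate_succ]
      · simp [ih, h]
  have := hE.sub (fun a => if a = c then [d] else []) h
  rwa [key, key] at this

theorem OThy.cap (hE : OThy E) (x k : ℕ) : E (List.replicate k x) (List.replicate (min k 2) x) := by
  induction k with
  | zero => exact hE.rf _
  | succ k ih =>
    rcases k with _ | _ | k
    · exact hE.rf _
    · exact hE.rf _
    · have h2 : min (k + 1 + 1 + 1) 2 = min (k + 1 + 1) 2 := by omega
      rw [h2]
      refine hE.tr ?_ ih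
      have := hE.sy (hE.dup (x := x) (p := [x]) (List.replicate k x) (by simp))
      simpa [List.replicate_succ] using this

theorem OThy.triv (hE : OThy E) {k : ℕ} (hk : 0 < k) (h : E (List.replicate k 0) []) : E [0] [] := by
  by_cases h1 : k = 1
  · subst h1; simpa using h
  have h2 : E [0,0] [] := by
    have := hE.cap 0 k
    rw [show min k 2 = 2 by omega] at this
    exact hE.tr (hE.sy this) h
  have h3 : E [0,0,0] [0] := by simpa using hE.mul (hE.rf [0]) h2
  have h4 : E [0,0,0] [0,0] := hE.cap 0 3
  exact hE.tr (hE.sy h3) (hE.tr h4 h2)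

theorem OThy.idem (hE : OThy E) {k : ℕ} (hk : 2 ≤ k) (h : E [0] (List.replicate k 0)) : E [0] [0,0] := by
  have := hE.cap 0 k
  rw [show min k 2 = 2 by omega] at this
  exact hE.tr h this

theorem OThy.comm_of_idem (hE : OThy E) (h : E [0] [0,0]) : E [0,1] [1,0] := by
  have h0 : ∀ x, E [x] [x,x] := fun x => by simpa using hE.sub (fun _ => [x]) h
  have h1 : ∀ x y, E [x,y] [x,x,y,y] := fun x y => hE.mul (h0 x) (h0 y)
  exact hE.tr (h1 0 1) (hE.tr hE.o1 (hE.sy (h1 1 0)))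

theorem OThy.comm_of_triv (hE : OThy E) (h : E [0] []) : E [0,1] [1,0] := by
  apply hE.comm_of_idem
  exact hE.sy (hE.mul (hE.rf [0]) h)

theorem Thy.perm (hF : Thy F) (hc : F [0,1] [1,0]) {u v : List ℕ} (h : u.Perm v) : F u v := by
  induction h with
  | nil => exact hF.rf _
  | cons x _ ih => exact hF.pre [x] ih
  | swap x y l =>
    have := hF.sub (fun n => if n = 0 then [y] else [x]) hc
    have := hF.mul this (hF.rf l)
    simpa using this
  | trans _ _ h1 h2 => exact hF.tr h1 h2

theorem Thy.comm_of_counts (hF : Thy F) (hc : F [0,1] [1,0]) : ∀ (L u v : List ℕ), (∀ a ∈ u, a ∈ L) →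
    (∀ a ∈ v, a ∈ L) → (∀ c, F (List.replicate (u.count c) c) (List.replicate (v.count c) c)) → F u v := by
  intro L
  induction L with
  | nil =>
    intro u v hu hv _
    have h1 : u = [] := List.eq_nil_iff_forall_not_mem.2 fun a ha => by simpa using hu a ha
    have h2 : v = [] := List.eq_nil_iff_forall_not_mem.2 fun a ha => by simpa using hv a ha
    subst h1; subst h2; exact hF.rf _
  | cons c L ih =>
    intro u v hu hv h
    have sp : ∀ w : List ℕ, F w (List.replicate (w.count c) c ++ w.filter (fun a => !(a == c))) := by
      intro w
      apply hF.perm hc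
      have := (List.filter_append_perm (fun a => a == c) w).symm
      rwa [List.filter_beq] at this
    refine hF.tr (sp u) (hF.tr (hF.mul (h c) (ih _ _ ?_ ?_ ?_)) (hF.sy (sp v)))
    · intro a ha
      have := hu a (List.mem_of_mem_filter ha)
      have h2 := (List.mem_filter.1 ha).2
      simp at this h2; tauto
    · intro a ha
      have := hv a (List.mem_of_mem_filter ha)
      have h2 := (List.mem_filter.1 ha).2
      simp at this h2; tauto
    · intro d
      by_cases hd : d = c
      · subst hd
        have : ∀ w : List ℕ, (w.filter (fun a => !(a == d))).count d = 0 := fun w =>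
          List.count_eq_zero_of_not_mem (by simp)
        rw [this, this]; exact hF.rf _
      · have : ∀ w : List ℕ, (w.filter (fun a => !(a == c))).count d = w.count d := fun w =>
          List.count_filter (by simp [hd])
        rw [this, this]; exact h d

theorem filter_nodup_ext : ∀ (A B : List ℕ), A.Nodup → B.Nodup → (∀ c, c ∈ A ↔ c ∈ B) →
    (∀ x y, x ≠ y → x ∈ A → y ∈ A → piW x y A = piW x y B) → A = B := by
  intro A
  induction A with
  | nil =>
    intro B _ _ hm _
    exact (List.eq_nil_iff_forall_not_mem.2 fun a ha => by simpa using (hm a).2 ha).symm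
  | cons a A ih =>
    intro B hA hB hm hp
    cases B with
    | nil => exact absurd ((hm a).1 (by simp)) (by simp)
    | cons b B =>
      have hab : a = b := by
        by_contra hne
        have := hp a b hne (by simp) ((hm b).2 (by simp))
        simp [piW] at this
        exact hne this.1
      subst hab
      rw [List.nodup_cons] at hA hB
      congr 1
      have hm' : ∀ c, c ∈ A ↔ c ∈ B := by
        intro c
        by_cases hc : c = a
        · subst hc; simp [hA.1, hB.1]
        · have := hm c; simpa [hc] using this
      refine ih B hA.2 hB.2 hm' ?_
      intro x y hxy hx hy
      have h1 := hp x y hxy (by simp [hx]) (by simp [hy])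
      have hxa : a ≠ x := fun h => hA.1 (h ▸ hx)
      have hya : a ≠ y := fun h => hA.1 (h ▸ hy)
      simpa [piW, hxa, hya] using h1

theorem two_nodup {x y : ℕ} : ∀ {l : List ℕ}, l.Nodup → x ≠ y → x ∈ l → y ∈ l → (∀ a ∈ l, a = x ∨ a = y) →
    l = [x,y] ∨ l = [y,x] := by
  intro l hn hxy hx hy ha
  have : l.Perm [x,y] := by
    rw [List.perm_ext_iff_of_nodup hn (by simp [hxy])]
    intro a
    constructor
    · intro h; simpa using ha a h
    · intro h
      simp at h
      rcases h with rfl | rfl <;> assumption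
  have hl : l.length = 2 := this.length_eq
  obtain ⟨a, b, rfl⟩ := List.length_eq_two.1 hl
  have hab : a ≠ b := by simpa using hn
  rcases ha a (by simp) with rfl | rfl <;> rcases ha b (by simp) with rfl | rfl
  · exact absurd rfl hab
  · exact Or.inl rfl
  · exact Or.inr rfl
  · exact absurd rfl hab

theorem Ctx.nondeg (C : Ctx E F) (hc : ¬ E [0,1] [1,0]) {u v : List ℕ} (h : E u v) : F u v := by
  have hE := C.hE
  have n1 : ¬ E [0] [] := fun h => hc (hE.comm_of_triv h)
  have n2 : ¬ E [0] [0,0] := fun h => hc (hE.comm_of_idem h)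
  have mem1 : ∀ {u v : List ℕ}, E u v → ∀ c, c ∈ u → c ∈ v := by
    intro u v h c hu
    by_contra hv
    have := hE.oneL c 0 h
    rw [List.count_eq_zero_of_not_mem hv] at this
    exact n1 (hE.triv (List.count_pos_iff.2 hu) this)
  have me : ∀ c, c ∈ u ↔ c ∈ v := fun c => ⟨mem1 h c, mem1 (hE.sy h) c⟩
  have cnt1 : ∀ {u v : List ℕ}, E u v → ∀ c, u.count c = 1 → v.count c = 1 := by
    intro u v h c hu
    have hv : 0 < v.count c := List.count_pos_iff.2 (mem1 h c (List.count_pos_iff.1 (by omega)))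
    by_contra hne
    have := hE.oneL c 0 h
    rw [hu] at this
    exact n2 (hE.idem (by omega) this)
  have cnt : ∀ c, u.count c = 1 ↔ v.count c = 1 := fun c => ⟨cnt1 h c, cnt1 (hE.sy h) c⟩
  have key : u.filter (fun b => u.count b = 1) = v.filter (fun b => u.count b = 1) := by
    have nd : ∀ w : List ℕ, (∀ c, u.count c = 1 → w.count c = 1) →
        (w.filter (fun b => u.count b = 1)).Nodup := by
      intro w hw
      rw [List.nodup_iff_count_le_one]
      intro a
      by_cases ha : u.count a = 1
      · rw [List.count_filter (by simpa using ha), hw a ha]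
      · rw [List.count_eq_zero_of_not_mem (by simp [ha])]; omega
    apply filter_nodup_ext
    · exact nd u (fun c hc => hc)
    · exact nd v (fun c hc => (cnt c).1 hc)
    · intro c; simp [me c]
    · intro x y hxy hx hy
      simp only [List.mem_filter, decide_eq_true_eq] at hx hy
      have hp : ∀ w : List ℕ, piW x y (w.filter (fun b => u.count b = 1)) = piW x y w := by
        intro w
        unfold piW
        rw [List.filter_filter]
        apply List.filter_congr
        intro a _
        by_cases h1 : a = x
        · subst h1; simp [hx.2]
        · by_cases h2 : a = y
          · subst h2; simp [hy.2]
          · simp [h1, h2]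
      rw [hp, hp]
      have pE := hE.pi2 x y h
      have form : ∀ w : List ℕ, w.count x = 1 → w.count y = 1 → piW x y w = [x,y] ∨ piW x y w = [y,x] := by
        intro w h1 h2
        apply two_nodup _ hxy
        · rw [mem_piW]; exact ⟨List.count_pos_iff.1 (by omega), Or.inl rfl⟩
        · rw [mem_piW]; exact ⟨List.count_pos_iff.1 (by omega), Or.inr rfl⟩
        · intro a ha; exact (mem_piW.1 ha).2
        · rw [List.nodup_iff_count_le_one]
          intro a
          by_cases ha : a ∈ piW x y w
          · have h3 : (piW x y w).count a ≤ w.count a := List.Sublist.count_le _ List.filter_sublist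
            rcases (mem_piW.1 ha).2 with rfl | rfl <;> omega
          · rw [List.count_eq_zero_of_not_mem ha]; omega
      have bad : ¬ E [x,y] [y,x] := by
        intro hb
        apply hc
        have := hE.sub (fun n => if n = x then [0] else [1]) hb
        simpa [hxy.symm] using this
      rcases form u hx.2 hy.2 with e1 | e1 <;> rcases form v ((cnt x).1 hx.2) ((cnt y).1 hy.2) with e2 | e2 <;>
        rw [e1, e2] at pE ⊢
      · exact absurd pE bad
      · exact absurd (hE.sy pE) bad
  obtain ⟨t0, ht⟩ : ∃ t0, t0 ∉ u := by
    obtain ⟨t, ht⟩ := Infinite.exists_notMem_finset u.toFinset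
    exact ⟨t, by simpa using ht⟩
  have ht' : t0 ∉ v := fun h => ht ((me t0).2 h)
  have fD : ∀ w : List ℕ, t0 ∉ w → w.filter (fun b => decide (b = t0 ∨ u.count b = 1)) =
      w.filter (fun b => u.count b = 1) := by
    intro w hw
    apply List.filter_congr
    intro a ha
    have : a ≠ t0 := fun h => hw (h ▸ ha)
    simp [this]
  have gd : ∀ w : List ℕ, t0 ∉ w → (∀ c, u.count c = 1 ↔ w.count c = 1) →
      GoodW (fun b => decide (b = t0 ∨ u.count b = 1)) (t0 :: w) := by
    intro w hw hcw
    constructor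
    · rw [List.filter_cons_of_pos (by simp), fD w hw, List.nodup_cons]
      refine ⟨fun h => hw (List.mem_of_mem_filter h), ?_⟩
      rw [List.nodup_iff_count_le_one]
      intro a
      by_cases ha : u.count a = 1
      · rw [List.count_filter (by simpa using ha), (hcw a).1 ha]
      · rw [List.count_eq_zero_of_not_mem (by simp [ha])]; omega
    · intro b hb hD
      simp only [decide_eq_false_iff_not, not_or] at hD
      have hbw : b ∈ w := by simpa [hD.1] using hb
      have h1 := List.count_pos_iff.2 hbw
      have h2 : w.count b ≠ 1 := fun h => hD.2 ((hcw b).2 h)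
      rw [List.count_cons_of_ne (Ne.symm hD.1)]; omega
  have St : StW E (fun b => decide (b = t0 ∨ u.count b = 1)) t0 (t0 :: u) (t0 :: v) := by
    refine ⟨hE.pre [t0] h, gd u ht (fun c => Iff.rfl), gd v ht' cnt, ?_, by simp, ⟨u, rfl⟩, ⟨v, rfl⟩, ?_⟩
    · rw [List.filter_cons_of_pos (by simp), List.filter_cons_of_pos (by simp), fD u ht, fD v ht', key]
    · intro c; simp [me c]
  have fin := PhaseEnd C St
  have := C.hF.sub (fun a => if a = t0 then [] else [a]) fin
  have er : ∀ w : List ℕ, t0 ∉ w → (t0 :: w).flatMap (fun a => if a = t0 then [] else [a]) = w := by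
    intro w hw
    rw [flatMap_filter_of (k := fun a => !(a == t0))]
    · rw [List.filter_cons_of_neg (by simp), List.filter_eq_self]
      intro a ha
      have : a ≠ t0 := fun h => hw (h ▸ ha)
      simp [this]
    · intro a _
      by_cases h : a = t0 <;> simp [h]
  rwa [er u ht, er v ht'] at this

theorem fixed_basis (E : List ℕ → List ℕ → Prop) (A : Finset (List ℕ × List ℕ)) :
    ∃ T : Finset (List ℕ × List ℕ), (∀ e ∈ T, E e.1 e.2) ∧
      ∀ e ∈ A, E e.1 e.2 → e ∈ T := by
  classical
  exact ⟨A.filter (fun e => E e.1 e.2), fun e he => (Finset.mem_filter.1 he).2,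
    fun e he h => Finset.mem_filter.2 ⟨he, h⟩⟩

theorem OThy.finite_basis (hE : OThy E) :
    ∃ T : Finset (List ℕ × List ℕ), (∀ e ∈ T, E e.1 e.2) ∧
      ∀ F, Thy F → (∀ e ∈ T, F e.1 e.2) → ∀ u v, E u v → F u v := by
  classical
  obtain ⟨T1, a1, b1⟩ := tmpl_basis E [0] [0,0] (by simp) (by simp)
  obtain ⟨T2, a2, b2⟩ := tmpl_basis E [0,1] [0,1,0] (by simp) (by simp)
  obtain ⟨T3, a3, b3⟩ := tmpl_basis E [0,0,1] [0,0,1,0] (by simp) (by simp)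
  obtain ⟨T4, a4, b4⟩ := tmpl_basis E [0,1] [1,0] (by simp) (by simp)
  obtain ⟨T5, a5, b5⟩ := fixed_basis E ({([0,0,1,1], [1,1,0,0]), ([0,2,0,1,0,3,1], [0,2,1,0,3,1]),
    ([0,0,1,0], [1,0,0]), ([0,1,0], [0,0,1,0]), ([0,1], [1,0])} : Finset (List ℕ × List ℕ))
  obtain ⟨T6, a6, b6⟩ := fixed_basis E ((Finset.range 3 ×ˢ Finset.range 3).image
    (fun p => (List.replicate p.1 0, List.replicate p.2 0)))
  refine ⟨T1 ∪ T2 ∪ T3 ∪ T4 ∪ T5 ∪ T6, ?_, ?_⟩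
  · intro e he
    simp only [Finset.mem_union] at he
    rcases he with ((((he | he) | he) | he) | he) | he
    exacts [a1 e he, a2 e he, a3 e he, a4 e he, a5 e he, a6 e he]
  intro F hF hT u v huv
  have G : Thy (fun a b => E a b ∧ F a b) :=
    { rf := fun a => ⟨hE.rf a, hF.rf a⟩
      sy := fun h => ⟨hE.sy h.1, hF.sy h.2⟩
      tr := fun h k => ⟨hE.tr h.1 k.1, hF.tr h.2 k.2⟩
      mul := fun h k => ⟨hE.mul h.1 k.1, hF.mul h.2 k.2⟩
      sub := fun σ _ _ h => ⟨hE.sub σ h.1, hF.sub σ h.2⟩ }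
  have fx : ∀ e ∈ T5, F e.1 e.2 := fun e he => hT e (by simp [he])
  have GO : OThy (fun a b => E a b ∧ F a b) :=
    { G with
      o1 := ⟨hE.o1, fx _ (b5 ([0,0,1,1], [1,1,0,0]) (by simp) hE.o1)⟩
      o2 := ⟨hE.o2, fx _ (b5 ([0,2,0,1,0,3,1], [0,2,1,0,3,1]) (by simp) hE.o2)⟩ }
  by_cases hc : E [0,1] [1,0]
  · have hcF : E [0,1] [1,0] ∧ F [0,1] [1,0] := ⟨hc, fx _ (b5 ([0,1], [1,0]) (by simp) hc)⟩
    refine (G.comm_of_counts hcF (u ++ v) u v (by simp +contextual) (by simp +contextual) ?_).2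
    intro c
    have h1 := hE.oneL c 0 huv
    have h2 : E (List.replicate (min (u.count c) 2) 0) (List.replicate (min (v.count c) 2) 0) :=
      hE.tr (hE.sy (hE.cap 0 _)) (hE.tr h1 (hE.cap 0 _))
    have h3 : F (List.replicate (min (u.count c) 2) 0) (List.replicate (min (v.count c) 2) 0) := by
      refine hT (List.replicate (min (u.count c) 2) 0, List.replicate (min (v.count c) 2) 0) ?_
      have := b6 (List.replicate (min (u.count c) 2) 0, List.replicate (min (v.count c) 2) 0) ?_ h2
      · simp [this]
      · refine Finset.mem_image.2 ⟨(min (u.count c) 2, min (v.count c) 2), ?_, rfl⟩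
        simp only [Finset.mem_product, Finset.mem_range]
        omega
    have h4 := GO.tr (GO.cap 0 (u.count c)) (GO.tr ⟨h2, h3⟩ (GO.sy (GO.cap 0 (v.count c))))
    simpa [List.flatMap_replicate] using GO.sub (fun _ => [c]) h4
  · have C : Ctx E (fun a b => E a b ∧ F a b) :=
      { hE := hE
        hF := GO
        le := fun h => h.1
        t1 := b1 _ G fun e he => ⟨a1 e he, hT e (by simp [he])⟩
        t2 := b2 _ G fun e he => ⟨a2 e he, hT e (by simp [he])⟩
        t3 := b3 _ G fun e he => ⟨a3 e he, hT e (by simp [he])⟩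
        t4 := b4 _ G fun e he => ⟨a4 e he, hT e (by simp [he])⟩
        dl := fun h => ⟨h, fx _ (b5 ([0,0,1,0], [1,0,0]) (by simp) h)⟩
        th := fun h => ⟨h, fx _ (b5 ([0,1,0], [0,0,1,0]) (by simp) h)⟩ }
    exact (C.nondeg hc huv).2

end assembly

theorem MSat_thy (M : Type uM) [Monoid M] : Thy (fun u v => MSat M (wd u, wd v)) where
  rf := fun _ _ => rfl
  sy := fun h φ => (h φ).symm
  tr := fun h k φ => (h φ).trans (k φ)
  mul := fun {a b c d} h k φ => by
    have h1 := h φ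
    have h2 := k φ
    simp only [wd, FreeMonoid.ofList_append, map_mul] at h1 h2 ⊢
    rw [h1, h2]
  sub := fun σ {a b} h φ => by
    have key : ∀ w : List ℕ, φ (wd (w.flatMap σ)) =
        (φ.comp (FreeMonoid.lift fun n => wd (σ n))) (wd w) := by
      intro w
      induction w with
      | nil => simp [wd]
      | cons a w ih =>
        simp only [wd, List.flatMap_cons, FreeMonoid.ofList_append, FreeMonoid.ofList_cons, map_mul] at ih ⊢
        rw [ih]; simp
    have := h (φ.comp (FreeMonoid.lift fun n => wd (σ n)))
    simp only [key]
    exact this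

/-- The variety `O = Mod {x²y² ≈ y²x², xzxyxty ≈ xzyxty}` is hereditarily finitely
based: every variety `Mod (Oset ∪ S)` is finitely based. -/
theorem O_is_hereditarily_finitely_based (S : Set (Word × Word)) :
    ∃ T : Finset (Word × Word), ∀ (M : Type uM) [Monoid M],
      SatAll M (Oset ∪ S) ↔ SatAll M (↑T) := by
  classical
  have hE : OThy (fun u v => ∀ (M : Type uM) [Monoid M], SatAll M (Oset ∪ S) → MSat M (wd u, wd v)) :=
    { rf := fun a M _ _ => (MSat_thy M).rf a
      sy := fun h M _ hM => (MSat_thy M).sy (h M hM)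
      tr := fun h k M _ hM => (MSat_thy M).tr (h M hM) (k M hM)
      mul := fun h k M _ hM => (MSat_thy M).mul (h M hM) (k M hM)
      sub := fun σ _ _ h M _ hM => (MSat_thy M).sub σ (h M hM)
      o1 := fun M _ hM => hM _ (Or.inl (by simp [Oset]))
      o2 := fun M _ hM => hM _ (Or.inl (by simp [Oset])) }
  obtain ⟨T, hT, hb⟩ := hE.finite_basis
  refine ⟨T.image (fun e => (wd e.1, wd e.2)), fun M _ => ⟨fun hM e he => ?_, fun hM e he => ?_⟩⟩
  · simp only [Finset.coe_image, Set.mem_image, Finset.mem_coe] at he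
    obtain ⟨p, hp, rfl⟩ := he
    exact hT p hp M hM
  · have := hb _ (MSat_thy M) (fun p hp => hM _ (by
      simp only [Finset.coe_image, Set.mem_image, Finset.mem_coe]
      exact ⟨p, hp, rfl⟩)) (toList e.1) (toList e.2) (fun N _ hN => hN e he)
    exact this
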